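/- Let ρ:[0,1]→(0,∞) be a periodic probability density of class C^{3,α}, extended by ρ(y):=ρ(−y) for y∈[−1,0] and ρ(y):=ρ(2−y) for y∈[1,2]. Let (x̄^i) solve d/dt x̄^i = 2N^3 ∫_{(x̄^i+x̄^{i−1})/2}^{(x̄^i+x̄^{i+1})/2}(z−x̄^i)ρ(z)dz (with x̄^0:=−x̄^1, x̄^{N+1}:=2−x̄^N), and let X^i(t) := X(t,(i−1/2)/N), where X solves ∂_t X = (1/2)ρ(X)∂_θX ∂²_{θθ}X + (1/6)ρ'(X)(∂_θX)^3 with X(t,0)=0, X(t,1)=1. Assume X_0 ∈ C^{4,α}([0,1]), X_0(0)=0, X_0(1)=1, a_0 ≤ ∂_θX_0 ≤ A_0 for positive constants a_0, A_0, and |X^i(0)−x̄^i(0)| ≤ C'/N^2 for all i and some C' > 0. Then there exists ε_1 > 0, depending only on a_0, A_0, ‖ρ‖_{C^{3,α}([0,1])} and ‖X_0‖_{C^{4,α}([0,1])}, such that if ‖ρ'‖_∞ + ‖ρ''‖_∞ ≤ ε_1, then there is a constant C̄ with (1/N)Σ_{i=1}^N (x̄^i(t)−X^i(t))^2 ≤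 C̄/N^4 for all t ∈ [0,∞). -/

import Mathlib

open MeasureTheory

/-- The reference grid points `(i - 1/2)/N`. -/
noncomputable def grid (N i : ℕ) : ℝ := ((i : ℝ) - 1 / 2) / N

/-- Extension of a finite family `v 1, …, v N` by the boundary conventions
`v 0 := -v 1` and `v (N+1) := 2 - v N`. -/
noncomputable def pad (N : ℕ) (v : ℕ → ℝ) : ℕ → ℝ :=
  fun i => if i = 0 then -v 1 else if i = N + 1 then 2 - v N else v i

/-- `f` is of class `C^{4,α}` on `[0,1]` with all relevant norms bounded by `K`. -/
def C4HolderBound (α K : ℝ) (f : ℝ → ℝ) : Prop :=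
  ContDiff ℝ 4 f ∧
    (∀ k : ℕ, k ≤ 4 → ∀ θ ∈ Set.Icc (0 : ℝ) 1, |iteratedDeriv k f θ| ≤ K) ∧
    ∀ θ ∈ Set.Icc (0 : ℝ) 1, ∀ θ' ∈ Set.Icc (0 : ℝ) 1,
      |iteratedDeriv 4 f θ - iteratedDeriv 4 f θ'| ≤ K * |θ - θ'| ^ α

/-- `f` is of class `C^{3,α}` on `[0,1]` with all relevant norms bounded by `K`. -/
def C3HolderBound (α K : ℝ) (f : ℝ → ℝ) : Prop :=
  ContDiff ℝ 3 f ∧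
    (∀ k : ℕ, k ≤ 3 → ∀ y ∈ Set.Icc (0 : ℝ) 1, |iteratedDeriv k f y| ≤ K) ∧
    ∀ y ∈ Set.Icc (0 : ℝ) 1, ∀ y' ∈ Set.Icc (0 : ℝ) 1,
      |iteratedDeriv 3 f y - iteratedDeriv 3 f y'| ≤ K * |y - y'| ^ α

namespace QuantizationFlow

open Set Filter Topology

theorem le_deriv_of_left_le {f : ℝ → ℝ} {d ε t t0 : ℝ} (hd : HasDerivAt f d t) (ht : t0 < t)
    (h : ∀ s, t0 ≤ s → s < t → f s ≤ f t - ε * (t - s)) : ε ≤ d := by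
  have h1 := (hasDerivAt_iff_tendsto_slope.1 hd).mono_left
    (nhdsWithin_mono t (fun s (hs : s ∈ Iio t) => ne_of_lt hs))
  refine ge_of_tendsto h1 ?_
  filter_upwards [Ioo_mem_nhdsLT ht] with s hs
  rw [slope_def_field, le_div_iff_of_neg (by linarith [hs.2])]
  linarith [h s hs.1.le hs.2]

theorem max_principle {K : Type*} [TopologicalSpace K] {S : Set K} (hS : IsCompact S)
    {Φ : ℝ → K → ℝ} {t0 t1 : ℝ}
    (hc : ContinuousOn (fun q : ℝ × K => Φ q.1 q.2) (Icc t0 t1 ×ˢ S))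
    (h0 : ∀ k ∈ S, Φ t0 k ≤ 0)
    (hmax : ∀ t ∈ Ioc t0 t1, ∀ k ∈ S, 0 < Φ t k → (∀ k' ∈ S, Φ t k' ≤ Φ t k) →
      ∃ d ≤ 0, HasDerivAt (fun s => Φ s k) d t) :
    ∀ t ∈ Icc t0 t1, ∀ k ∈ S, Φ t k ≤ 0 := by
  intro ts hts ks hks
  by_contra! hpos
  have h01 : t0 ≤ t1 := hts.1.trans hts.2
  obtain ⟨ε, hε, hε1⟩ : ∃ ε > 0, ε * (t1 - t0) < Φ ts ks := by
    refine ⟨Φ ts ks / (2 * (t1 - t0 + 1)), by positivity, ?_⟩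
    rw [div_mul_eq_mul_div, div_lt_iff₀ (by positivity)]
    nlinarith
  obtain ⟨⟨t, k⟩, ⟨ht, hk⟩, hm⟩ := (isCompact_Icc.prod hS).exists_isMaxOn
    (f := fun q : ℝ × K => Φ q.1 q.2 - ε * (q.1 - t0)) ⟨(ts, ks), hts, hks⟩
    (hc.sub (by fun_prop))
  have hm' : ∀ s ∈ Icc t0 t1, ∀ k' ∈ S, Φ s k' - ε * (s - t0) ≤ Φ t k - ε * (t - t0) :=
    fun s hs k' hk' => hm (show (s, k') ∈ Icc t0 t1 ×ˢ S from ⟨hs, hk'⟩)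
  simp only at ht hk
  have h2 := hm' ts hts ks hks
  have h3 : 0 < Φ t k := by
    have : ε * (ts - t0) ≤ ε * (t1 - t0) := by gcongr; exact hts.2
    have : 0 ≤ ε * (t - t0) := mul_nonneg hε.le (by linarith [ht.1])
    linarith
  have ht0 : t0 < t := by
    rcases ht.1.lt_or_eq with h | h
    · exact h
    · subst h; linarith [h0 k hk]
  obtain ⟨d, hd, hd'⟩ := hmax t ⟨ht0, ht.2⟩ k hk h3 (fun k' hk' => by linarith [hm' t ht k' hk'])
  have := le_deriv_of_left_le hd' ht0 (ε := ε) (fun s hs hst => by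
    linarith [hm' s ⟨hs, hst.le.trans ht.2⟩ k hk])
  linarith

theorem deriv_deriv_nonpos_of_isLocalMax {f : ℝ → ℝ} (hf : ContDiff ℝ 2 f) {x : ℝ}
    (h : IsLocalMax f x) : deriv f x = 0 ∧ deriv (deriv f) x ≤ 0 := by
  refine ⟨h.deriv_eq_zero, ?_⟩
  by_contra! hpos
  have hmin := isLocalMin_of_deriv_deriv_pos hpos h.deriv_eq_zero hf.continuous.continuousAt
  have hconst : f =ᶠ[𝓝 x] fun _ => f x := by
    filter_upwards [h, hmin] with y h1 h2 using le_antisymm h1 h2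
  have : deriv (deriv f) x = 0 := by
    have h1 : deriv f =ᶠ[𝓝 x] deriv (fun _ => f x) := hconst.deriv
    rw [h1.deriv_eq]; simp
  linarith

theorem deriv_deriv_nonneg_of_isLocalMin {f : ℝ → ℝ} (hf : ContDiff ℝ 2 f) {x : ℝ}
    (h : IsLocalMin f x) : deriv f x = 0 ∧ 0 ≤ deriv (deriv f) x := by
  have h2 := deriv_deriv_nonpos_of_isLocalMax (f := fun y => - f y) hf.neg h.neg
  have e : deriv (fun y => - f y) = fun y => - deriv f y := by
    funext y; exact deriv.fun_neg
  rw [e] at h2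
  simp only [deriv.fun_neg] at h2
  constructor <;> linarith [h2.1, h2.2]

theorem stays_below {f : ℝ → ℝ} {t0 η : ℝ} (hη : 0 < η) (hf : ContinuousOn f (Ici t0))
    (h0 : f t0 ≤ 0)
    (hd : ∀ t, t0 < t → 0 < f t → f t < η → ∃ d ≤ 0, HasDerivAt f d t) :
    ∀ t, t0 ≤ t → f t ≤ 0 := by
  intro T hT
  by_contra! hpos
  set m := min (f T) (η / 2) with hm
  have hm0 : 0 < m := lt_min hpos (by linarith)
  have hcT : ContinuousOn f (Icc t0 T) := hf.mono Icc_subset_Ici_self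
  have hcomp : IsCompact (Icc t0 T ∩ f ⁻¹' (Ici m)) :=
    isCompact_Icc.of_isClosed_subset
      (hcT.preimage_isClosed_of_isClosed isClosed_Icc isClosed_Ici) inter_subset_left
  obtain ⟨T1, ⟨hT1, hT1m⟩, hleast⟩ := hcomp.exists_isLeast
    ⟨T, ⟨hT, le_rfl⟩, show m ≤ f T from min_le_left _ _⟩
  have hle : ∀ t ∈ Icc t0 T1, f t ≤ m := by
    have hlt : ∀ t ∈ Ico t0 T1, f t < m := by
      intro t ht
      by_contra! h
      exact absurd (hleast ⟨⟨ht.1, ht.2.le.trans hT1.2⟩, h⟩) (not_le.2 ht.2)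
    have h01 : t0 ≠ T1 := by
      rintro rfl
      exact absurd (hm0.trans_le hT1m) (not_lt.2 h0)
    have hcl := closure_Ico h01
    intro t ht
    rw [← hcl] at ht
    refine closure_minimal (s := Ico t0 T1) (t := Icc t0 T1 ∩ f ⁻¹' (Iic m))
      (fun s hs => ⟨Ico_subset_Icc_self hs, (hlt s hs).le⟩) ?_ ht |>.2
    exact (hcT.mono (Icc_subset_Icc_right hT1.2)).preimage_isClosed_of_isClosed
      isClosed_Icc isClosed_Iic
  have hres := max_principle (K := Unit) (S := univ) isCompact_univ (Φ := fun t _ => f t)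
    (t0 := t0) (t1 := T1)
    ((hcT.mono (Icc_subset_Icc_right hT1.2)).comp continuousOn_fst (fun q hq => hq.1))
    (fun _ _ => h0)
    (fun t ht _ _ hp _ => hd t ht.1 hp
      ((hle t (Ioc_subset_Icc_self ht)).trans_lt
        ((min_le_right _ _).trans_lt (by linarith))))
    T1 ⟨hT1.1, le_rfl⟩ () trivial
  exact absurd (hm0.trans_le hT1m) (not_lt.2 hres)

theorem deriv_sub_mul_const {V : ℝ → ℝ} (hV : ContDiff ℝ 2 V) (L : ℝ) :
    (deriv fun x => V x - L * x) = (fun x => deriv V x - L) ∧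
    (deriv (deriv fun x => V x - L * x)) = deriv (deriv V) := by
  have h1 : (deriv fun x => V x - L * x) = (fun x => deriv V x - L) := by
    funext x
    have : HasDerivAt (fun y => V y - L * y) (deriv V x - L * 1) x :=
      ((hV.differentiable (by norm_num) x).hasDerivAt).sub ((hasDerivAt_id x).const_mul L)
    simpa using this.deriv
  refine ⟨h1, ?_⟩
  rw [h1]
  funext x
  simp

theorem tilted_max {V : ℝ → ℝ} (hV : ContDiff ℝ 2 V) {L x : ℝ}
    (h : IsLocalMax (fun y => V y - L * y) x) : deriv V x = L ∧ deriv (deriv V) x ≤ 0 := by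
  obtain ⟨h1, h2⟩ := deriv_sub_mul_const hV L
  have := deriv_deriv_nonpos_of_isLocalMax (f := fun y => V y - L * y) (by fun_prop) h
  rw [h1] at this
  rw [← h2, h1]
  exact ⟨by linarith [this.1], this.2⟩

theorem tilted_min {V : ℝ → ℝ} (hV : ContDiff ℝ 2 V) {L x : ℝ}
    (h : IsLocalMin (fun y => V y - L * y) x) : deriv V x = L ∧ 0 ≤ deriv (deriv V) x := by
  obtain ⟨h1, h2⟩ := deriv_sub_mul_const hV L
  have := deriv_deriv_nonneg_of_isLocalMin (f := fun y => V y - L * y) (by fun_prop) h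
  rw [h1] at this
  rw [← h2, h1]
  exact ⟨by linarith [this.1], this.2⟩

theorem isCompact_pairs : IsCompact {k : ℝ × ℝ | 0 ≤ k.1 ∧ k.1 ≤ k.2 ∧ k.2 ≤ 1} := by
  refine (isCompact_Icc (a := (0 : ℝ)) (b := 1) |>.prod
    (isCompact_Icc (a := (0 : ℝ)) (b := 1))).of_isClosed_subset ?_ ?_
  · exact (isClosed_le continuous_const continuous_fst).inter
      ((isClosed_le continuous_fst continuous_snd).inter
        (isClosed_le continuous_snd continuous_const))
  · rintro ⟨a, b⟩ ⟨h1, h2, h3⟩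
    exact ⟨⟨h1, h2.trans h3⟩, ⟨h1.trans h2, h3⟩⟩

theorem slope_le_of_initial {V κ : ℝ → ℝ → ℝ} {L s r : ℝ}
    (hreg : ∀ t ∈ Icc s r, ContDiff ℝ 2 (V t))
    (hpde : ∀ t ∈ Ioc s r, ∀ θ ∈ Icc (0 : ℝ) 1, HasDerivAt (fun τ => V τ θ)
      (κ t θ * deriv (V t) θ * deriv (deriv (V t)) θ) t)
    (hκ : ∀ t ∈ Ioc s r, ∀ θ ∈ Icc (0 : ℝ) 1, 0 ≤ κ t θ * L)
    (hb0 : ∀ t ∈ Ioc s r, HasDerivAt (fun τ => V τ 0) 0 t)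
    (hb1 : ∀ t ∈ Ioc s r, HasDerivAt (fun τ => V τ 1) 0 t)
    (hc : ContinuousOn (fun q : ℝ × ℝ => V q.1 q.2) (Icc s r ×ˢ Icc 0 1))
    (hi : ∀ a b, 0 ≤ a → a ≤ b → b ≤ 1 → V s b - V s a ≤ L * (b - a)) :
    ∀ t ∈ Icc s r, ∀ a b, 0 ≤ a → a ≤ b → b ≤ 1 → V t b - V t a ≤ L * (b - a) := by
  have key := max_principle (K := ℝ × ℝ) isCompact_pairs
    (Φ := fun t k => V t k.2 - V t k.1 - L * (k.2 - k.1)) (t0 := s) (t1 := r) ?_ ?_ ?_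
  · intro t ht a b h0 hab h1
    have := key t ht (a, b) ⟨h0, hab, h1⟩
    simp only at this; linarith
  · refine ((hc.comp (f := fun q : ℝ × ℝ × ℝ => (q.1, q.2.2)) (by fun_prop) ?_).sub
      (hc.comp (f := fun q : ℝ × ℝ × ℝ => (q.1, q.2.1)) (by fun_prop) ?_)).sub (by fun_prop)
    · rintro ⟨t, a, b⟩ ⟨ht, h0, hab, h1⟩
      exact ⟨ht, h0.trans hab, h1⟩
    · rintro ⟨t, a, b⟩ ⟨ht, h0, hab, h1⟩
      exact ⟨ht, h0, hab.trans h1⟩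
  · rintro ⟨a, b⟩ ⟨h0, hab, h1⟩
    have := hi a b h0 hab h1
    simp only; linarith
  · rintro t ht ⟨a, b⟩ ⟨h0, hab, h1⟩ hpos hm
    simp only at h0 hab h1 hpos hm
    have hm' : ∀ a' b', 0 ≤ a' → a' ≤ b' → b' ≤ 1 →
        V t b' - V t a' - L * (b' - a') ≤ V t b - V t a - L * (b - a) :=
      fun a' b' h h' h'' => hm (a', b') ⟨h, h', h''⟩
    have hlt : a < b := by
      rcases hab.lt_or_eq with h | h
      · exact h
      · subst h; simp at hpos
    have hV := hreg t (Ioc_subset_Icc_self ht)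
    obtain ⟨db, hdb, hdb'⟩ : ∃ d ≤ 0, HasDerivAt (fun τ => V τ b) d t := by
      rcases h1.lt_or_eq with h | h
      · refine ⟨_, ?_, hpde t ht b ⟨h0.trans hab, h1⟩⟩
        have hloc : IsLocalMax (fun y => V t y - L * y) b := by
          filter_upwards [Ioo_mem_nhds hlt h] with y hy
          have := hm' a y h0 hy.1.le hy.2.le
          linarith
        obtain ⟨e1, e2⟩ := tilted_max hV hloc
        rw [e1]
        exact mul_nonpos_of_nonneg_of_nonpos (hκ t ht b ⟨h0.trans hab, h1⟩) e2
      · subst h; exact ⟨0, le_rfl, hb1 t ht⟩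
    obtain ⟨da, hda, hda'⟩ : ∃ d, 0 ≤ d ∧ HasDerivAt (fun τ => V τ a) d t := by
      rcases h0.lt_or_eq with h | h
      · refine ⟨_, ?_, hpde t ht a ⟨h0, hab.trans h1⟩⟩
        have hloc : IsLocalMin (fun y => V t y - L * y) a := by
          filter_upwards [Ioo_mem_nhds h hlt] with y hy
          have := hm' y b hy.1.le hy.2.le h1
          linarith
        obtain ⟨e1, e2⟩ := tilted_min hV hloc
        rw [e1]
        exact mul_nonneg (hκ t ht a ⟨h0, hab.trans h1⟩) e2
      · subst h; exact ⟨0, le_rfl, hb0 t ht⟩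
    exact ⟨db - da, by linarith, (hdb'.sub hda').sub_const _⟩

theorem continuousOn_prod_of_slope_le {g : ℝ → ℝ → ℝ} {T : Set ℝ} {L : ℝ} (hL : 0 ≤ L)
    (h1 : ∀ θ ∈ Icc (0 : ℝ) 1, ContinuousOn (fun t => g t θ) T)
    (h2 : ∀ t ∈ T, Continuous (g t))
    (h3 : ∀ t ∈ T, ∀ a b, 0 ≤ a → a ≤ b → b ≤ 1 → g t b - g t a ≤ L * (b - a)) :
    ContinuousOn (fun q : ℝ × ℝ => g q.1 q.2) (T ×ˢ Icc 0 1) := by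
  rintro ⟨t, θ⟩ ⟨ht, hθ⟩
  simp only at ht hθ
  rw [ContinuousWithinAt, Metric.tendsto_nhds]
  intro ε hε
  obtain ⟨δ, hδ, hδ1⟩ := Metric.continuous_iff.1 (h2 t ht) θ (ε / 4) (by positivity)
  obtain ⟨η, hη, hηδ, hηL⟩ : ∃ η > 0, η < δ ∧ L * (2 * η) < ε / 4 := by
    refine ⟨min (δ / 2) (ε / (16 * (L + 1))), by positivity, ?_, ?_⟩
    · exact (min_le_left _ _).trans_lt (by linarith)
    · calc L * (2 * min (δ / 2) (ε / (16 * (L + 1)))) ≤ L * (2 * (ε / (16 * (L + 1)))) := by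
            gcongr; exact min_le_right _ _
        _ < ε / 4 := by
            rw [mul_div_assoc', mul_div_assoc', div_lt_div_iff₀ (by positivity) (by positivity)]
            nlinarith
  set θ1 := max 0 (θ - η) with hθ1
  set θ2 := min 1 (θ + η) with hθ2
  have e1 : θ1 ∈ Icc (0 : ℝ) 1 := ⟨le_max_left _ _, max_le zero_le_one (by linarith [hθ.2])⟩
  have e2 : θ2 ∈ Icc (0 : ℝ) 1 := ⟨le_min zero_le_one (by linarith [hθ.1]), min_le_left _ _⟩
  have l1 : θ1 ≤ θ := max_le hθ.1 (by linarith)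
  have l2 : θ ≤ θ2 := le_min hθ.2 (by linarith)
  have l3 : θ - η ≤ θ1 := le_max_right _ _
  have l4 : θ2 ≤ θ + η := min_le_right _ _
  have d1 := hδ1 θ1 (by rw [Real.dist_eq, abs_lt]; constructor <;> linarith)
  have d2 := hδ1 θ2 (by rw [Real.dist_eq, abs_lt]; constructor <;> linarith)
  have c1 : ∀ᶠ s in 𝓝[T] t, dist (g s θ1) (g t θ1) < ε / 4 :=
    (Metric.tendsto_nhds.1 (h1 θ1 e1 t ht)) _ (by positivity)
  have c2 : ∀ᶠ s in 𝓝[T] t, dist (g s θ2) (g t θ2) < ε / 4 :=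
    (Metric.tendsto_nhds.1 (h1 θ2 e2 t ht)) _ (by positivity)
  have c3 : ∀ᶠ x in 𝓝[Icc (0 : ℝ) 1] θ, θ1 ≤ x ∧ x ≤ θ2 := by
    filter_upwards [self_mem_nhdsWithin, mem_nhdsWithin_of_mem_nhds
      (Ioo_mem_nhds (show θ - η < θ by linarith) (show θ < θ + η by linarith))] with x hx hx'
    exact ⟨max_le hx.1 hx'.1.le, le_min hx.2 hx'.2.le⟩
  rw [nhdsWithin_prod_eq]
  filter_upwards [((c1.and c2).and self_mem_nhdsWithin).prod_mk c3] with ⟨s, x⟩ ⟨⟨⟨p1, p2⟩, p3⟩,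
      p4, p5⟩
  simp only [Real.dist_eq, abs_lt] at *
  have q1 := h3 s p3 θ1 x e1.1 p4 (p5.trans e2.2)
  have q2 := h3 s p3 x θ2 (e1.1.trans p4) p5 e2.2
  have r1 : L * (x - θ1) ≤ L * (2 * η) := by gcongr; linarith
  have r2 : L * (θ2 - x) ≤ L * (2 * η) := by gcongr; linarith
  constructor <;> linarith

/-- A classical solution of `U_t = γ U_θ U_θθ` on `[0,∞) × [0,1]` with constant boundary values. -/
structure DegenerateFlow (U γ : ℝ → ℝ → ℝ) : Prop where
  reg : ∀ t, 0 ≤ t → ContDiff ℝ 2 (U t)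
  pde : ∀ t, 0 ≤ t → ∀ θ ∈ Icc (0 : ℝ) 1, HasDerivAt (fun s => U s θ)
    (γ t θ * deriv (U t) θ * deriv (deriv (U t)) θ) t
  nonneg : ∀ t, 0 ≤ t → ∀ θ ∈ Icc (0 : ℝ) 1, 0 ≤ γ t θ
  left : ∀ t, 0 ≤ t → U t 0 = U 0 0
  right : ∀ t, 0 ≤ t → U t 1 = U 0 1

theorem hasDerivAt_zero_of_const {f : ℝ → ℝ} {d t : ℝ} (ht : 0 ≤ t)
    (hf : ∀ s, 0 ≤ s → f s = f 0) (hd : HasDerivAt f d t) : d = 0 := by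
  have h1 : HasDerivWithinAt f d (Ici t) t := hd.hasDerivWithinAt
  have h2 : HasDerivWithinAt f 0 (Ici t) t :=
    (hasDerivWithinAt_const t (Ici t) (f 0)).congr
      (fun s hs => hf s (ht.trans hs)) (hf t ht)
  exact (uniqueDiffOn_Ici t t self_mem_Ici).eq_deriv _ h1 h2

theorem lipschitz_bound_of_contDiff {f : ℝ → ℝ} (hf : ContDiff ℝ 1 f) :
    ∃ L, 0 ≤ L ∧ ∀ a b, 0 ≤ a → a ≤ b → b ≤ 1 → |f b - f a| ≤ L * (b - a) := by
  obtain ⟨C, hC⟩ := isCompact_Icc.exists_bound_of_continuousOn (s := Icc (0 : ℝ) 1)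
    (hf.continuous_deriv le_rfl).continuousOn
  refine ⟨C, (norm_nonneg _).trans (hC 0 (by simp)), fun a b h0 hab h1 => ?_⟩
  have := (convex_Icc (0 : ℝ) 1).norm_image_sub_le_of_norm_deriv_le
    (fun x _ => (hf.differentiable one_ne_zero) x) hC (x := a) (y := b)
    ⟨h0, hab.trans h1⟩ ⟨h0.trans hab, h1⟩
  rwa [Real.norm_eq_abs, Real.norm_eq_abs, abs_of_nonneg (sub_nonneg.2 hab)] at this

theorem hasDerivAt_comp_neg {f : ℝ → ℝ} {d t : ℝ} (h : HasDerivAt f d (-t)) :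
    HasDerivAt (fun s => f (-s)) (-d) t := by
  have := h.scomp t (hasDerivAt_neg t)
  simpa [Function.comp_def] using this

namespace DegenerateFlow

variable {U γ : ℝ → ℝ → ℝ}

theorem hasDerivAt_left (h : DegenerateFlow U γ) {t : ℝ} (ht : 0 ≤ t) :
    HasDerivAt (fun s => U s 0) 0 t := by
  have h1 := h.pde t ht 0 (by simp)
  rwa [hasDerivAt_zero_of_const ht h.left h1] at h1

theorem hasDerivAt_right (h : DegenerateFlow U γ) {t : ℝ} (ht : 0 ≤ t) :
    HasDerivAt (fun s => U s 1) 0 t := by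
  have h1 := h.pde t ht 1 (by simp)
  rwa [hasDerivAt_zero_of_const ht h.right h1] at h1

theorem slope_le (h : DegenerateFlow U γ) {s r L : ℝ} (hs : 0 ≤ s) (hL : 0 ≤ L)
    (hc : ContinuousOn (fun q : ℝ × ℝ => U q.1 q.2) (Icc s r ×ˢ Icc 0 1))
    (hi : ∀ a b, 0 ≤ a → a ≤ b → b ≤ 1 → U s b - U s a ≤ L * (b - a)) :
    ∀ t ∈ Icc s r, ∀ a b, 0 ≤ a → a ≤ b → b ≤ 1 → U t b - U t a ≤ L * (b - a) :=
  slope_le_of_initial (κ := γ) (fun t ht => h.reg t (hs.trans ht.1))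
    (fun t ht => h.pde t (hs.trans ht.1.le))
    (fun t ht θ hθ => mul_nonneg (h.nonneg t (hs.trans ht.1.le) θ hθ) hL)
    (fun _ ht => h.hasDerivAt_left (hs.trans ht.1.le))
    (fun _ ht => h.hasDerivAt_right (hs.trans ht.1.le)) hc hi

theorem le_slope (h : DegenerateFlow U γ) {s r L : ℝ} (hs : 0 ≤ s) (hL : 0 ≤ L)
    (hc : ContinuousOn (fun q : ℝ × ℝ => U q.1 q.2) (Icc s r ×ˢ Icc 0 1))
    (hi : ∀ a b, 0 ≤ a → a ≤ b → b ≤ 1 → L * (b - a) ≤ U s b - U s a) :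
    ∀ t ∈ Icc s r, ∀ a b, 0 ≤ a → a ≤ b → b ≤ 1 → L * (b - a) ≤ U t b - U t a := by
  have key := slope_le_of_initial (V := fun t θ => - U t θ) (κ := fun t θ => - γ t θ) (L := -L)
    (s := s) (r := r) (fun t ht => (h.reg t (hs.trans ht.1)).neg)
    (fun t ht θ hθ => ?_)
    (fun t ht θ hθ => by
      have := mul_nonneg (h.nonneg t (hs.trans ht.1.le) θ hθ) hL
      linarith)
    (fun _ ht => by simpa using (h.hasDerivAt_left (hs.trans ht.1.le)).fun_neg)
    (fun _ ht => by simpa using (h.hasDerivAt_right (hs.trans ht.1.le)).fun_neg) hc.neg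
    (fun a b h0 hab h1 => by linarith [hi a b h0 hab h1])
  · intro t ht a b h0 hab h1
    have := key t ht a b h0 hab h1
    linarith
  · have e : (deriv fun y => - U t y) = fun y => - deriv (U t) y := by
      funext y; exact deriv.fun_neg
    rw [e]
    simp only [deriv.fun_neg]
    exact (h.pde t (hs.trans ht.1.le) θ hθ).fun_neg.congr_deriv (by ring)

theorem neg_le_slope_backward (h : DegenerateFlow U γ) {s r L : ℝ} (hs : 0 ≤ s) (hL : 0 ≤ L)
    (hc : ContinuousOn (fun q : ℝ × ℝ => U q.1 q.2) (Icc s r ×ˢ Icc 0 1))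
    (hi : ∀ a b, 0 ≤ a → a ≤ b → b ≤ 1 → - (L * (b - a)) ≤ U r b - U r a) :
    ∀ t ∈ Icc s r, ∀ a b, 0 ≤ a → a ≤ b → b ≤ 1 → - (L * (b - a)) ≤ U t b - U t a := by
  have key := slope_le_of_initial (V := fun t θ => - U (-t) θ) (κ := fun t θ => γ (-t) θ) (L := L)
    (s := -r) (r := -s) (fun t ht => (h.reg (-t) (by linarith [ht.2])).neg)
    (fun t ht θ hθ => ?_)
    (fun t ht θ hθ => mul_nonneg (h.nonneg (-t) (by linarith [ht.2]) θ hθ) hL)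
    (fun t ht => by
      exact (hasDerivAt_comp_neg (h.hasDerivAt_left (t := -t)
        (by linarith [ht.2]))).fun_neg.congr_deriv (by simp))
    (fun t ht => by
      exact (hasDerivAt_comp_neg (h.hasDerivAt_right (t := -t)
        (by linarith [ht.2]))).fun_neg.congr_deriv (by simp))
    ((hc.comp (f := fun q : ℝ × ℝ => (-q.1, q.2)) (by fun_prop) (by
      rintro ⟨t, θ⟩ ⟨ht, hθ⟩
      exact ⟨⟨by simp only; linarith [ht.2], by simp only; linarith [ht.1]⟩, hθ⟩)).neg)
    (fun a b h0 hab h1 => by simp only [neg_neg]; linarith [hi a b h0 hab h1])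
  · intro t ht a b h0 hab h1
    have := key (-t) ⟨by linarith [ht.2], by linarith [ht.1]⟩ a b h0 hab h1
    simp only [neg_neg] at this
    linarith
  · have e : (deriv fun y => - U (-t) y) = fun y => - deriv (U (-t)) y := by
      funext y; exact deriv.fun_neg
    rw [e]
    simp only [deriv.fun_neg]
    exact (hasDerivAt_comp_neg (h.pde (-t) (by linarith [ht.2]) θ hθ)).fun_neg.congr_deriv (by ring)

/-- `U (t, ·)` is `L`-Lipschitz on `[0,1]`. -/
def SliceLip (U : ℝ → ℝ → ℝ) (L t : ℝ) : Prop :=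
  ∀ a b, 0 ≤ a → a ≤ b → b ≤ 1 → |U t b - U t a| ≤ L * (b - a)

theorem continuous_time (h : DegenerateFlow U γ) {θ : ℝ} (hθ : θ ∈ Icc (0 : ℝ) 1) :
    ContinuousOn (fun t => U t θ) (Ici 0) :=
  fun t ht => (h.pde t ht θ hθ).continuousAt.continuousWithinAt

theorem continuousOn_of_slope_le (h : DegenerateFlow U γ) {T : Set ℝ} (hT : T ⊆ Ici 0) {L : ℝ}
    (hL : 0 ≤ L)
    (h3 : ∀ t ∈ T, ∀ a b, 0 ≤ a → a ≤ b → b ≤ 1 → U t b - U t a ≤ L * (b - a)) :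
    ContinuousOn (fun q : ℝ × ℝ => U q.1 q.2) (T ×ˢ Icc 0 1) :=
  continuousOn_prod_of_slope_le hL (fun _ hθ => (h.continuous_time hθ).mono hT)
    (fun t ht => (h.reg t (hT ht)).continuous) h3

theorem continuousOn_of_neg_le_slope (h : DegenerateFlow U γ) {T : Set ℝ} (hT : T ⊆ Ici 0)
    {L : ℝ} (hL : 0 ≤ L)
    (h3 : ∀ t ∈ T, ∀ a b, 0 ≤ a → a ≤ b → b ≤ 1 → - (L * (b - a)) ≤ U t b - U t a) :
    ContinuousOn (fun q : ℝ × ℝ => U q.1 q.2) (T ×ˢ Icc 0 1) := by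
  have := continuousOn_prod_of_slope_le (g := fun t θ => - U t θ) hL
    (fun _ hθ => ((h.continuous_time hθ).mono hT).neg)
    (fun t ht => (h.reg t (hT ht)).continuous.neg)
    (fun t ht a b h0 hab h1 => by linarith [h3 t ht a b h0 hab h1])
  exact this.neg.congr fun q _ => (neg_neg _).symm

/-- `U` is jointly continuous in a time neighbourhood of `t`. -/
def LocallyContinuousAt (U : ℝ → ℝ → ℝ) (t : ℝ) : Prop :=
  ∃ δ > 0, ContinuousOn (fun q : ℝ × ℝ => U q.1 q.2) ((Ioo (t - δ) (t + δ) ∩ Ici 0) ×ˢ Icc 0 1)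

theorem isOpen_locallyContinuousAt (U : ℝ → ℝ → ℝ) : IsOpen {t | LocallyContinuousAt U t} := by
  rw [Metric.isOpen_iff]
  rintro t ⟨δ, hδ, hc⟩
  refine ⟨δ / 2, by positivity, fun s hs => ⟨δ / 2, by positivity, hc.mono ?_⟩⟩
  rw [Metric.mem_ball, Real.dist_eq, abs_lt] at hs
  rintro ⟨r, θ⟩ ⟨⟨h1, h2⟩, h3⟩
  exact ⟨⟨⟨by linarith [h1.1], by linarith [h1.2]⟩, h2⟩, h3⟩

theorem continuousOn_of_locally {T : Set ℝ} (hT : T ⊆ Ici 0)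
    (h : ∀ t ∈ T, LocallyContinuousAt U t) :
    ContinuousOn (fun q : ℝ × ℝ => U q.1 q.2) (T ×ˢ Icc 0 1) := by
  rintro ⟨t, θ⟩ ⟨ht, hθ⟩
  obtain ⟨δ, hδ, hc⟩ := h t ht
  refine (hc (t, θ) ⟨⟨⟨by simp only; linarith, by simp only; linarith⟩, hT ht⟩, hθ⟩
    ).mono_of_mem_nhdsWithin ?_
  have : (Ioo (t - δ) (t + δ) ×ˢ univ) ∈ 𝓝 (t, θ) :=
    prod_mem_nhds (Ioo_mem_nhds (by linarith) (by linarith)) univ_mem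
  filter_upwards [mem_nhdsWithin_of_mem_nhds this, self_mem_nhdsWithin] with q h1 h2
  exact ⟨⟨h1.1, hT h2.1⟩, h2.2⟩

theorem sliceLip_of_gap (h : DegenerateFlow U γ) {l q n : ℝ} (hl : 0 ≤ l) (hn : 0 ≤ n)
    (hlq : l < q) (hgap : ∀ t ∈ Ioo l q, LocallyContinuousAt U t) (hUl : SliceLip U n l)
    (hUq : SliceLip U n q) : ∀ t ∈ Icc l q, SliceLip U n t := by
  obtain ⟨t1, h1, h2⟩ := exists_between hlq
  obtain ⟨L0, hL0, hLip⟩ := lipschitz_bound_of_contDiff ((h.reg t1 (hl.trans h1.le)).of_le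
    (by norm_num : (1 : WithTop ℕ∞) ≤ 2))
  set L := max L0 n
  have hL : 0 ≤ L := hn.trans (le_max_right _ _)
  have grow : ∀ {M a b : ℝ}, M ≤ L → a ≤ b → M * (b - a) ≤ L * (b - a) := fun hM hab =>
    mul_le_mul_of_nonneg_right hM (sub_nonneg.2 hab)
  have cl : ContinuousOn (fun q : ℝ × ℝ => U q.1 q.2) (Icc l t1 ×ˢ Icc 0 1) := by
    refine h.continuousOn_of_neg_le_slope (fun t ht => hl.trans ht.1) hL ?_
    intro t ht a b h0 hab hb
    rcases ht.1.eq_or_lt with e | e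
    · subst e
      have := neg_le_of_abs_le (hUl a b h0 hab hb)
      linarith [grow (le_max_right L0 n) hab]
    · refine h.neg_le_slope_backward (hl.trans e.le) hL (r := t1) (continuousOn_of_locally
        (fun s hs => (hl.trans e.le).trans hs.1)
        (fun s hs => hgap s ⟨e.trans_le hs.1, hs.2.trans_lt h2⟩)) ?_ t ⟨le_rfl, ht.2⟩ a b h0 hab hb
      intro a b h0 hab hb
      have := neg_le_of_abs_le (hLip a b h0 hab hb)
      linarith [grow (le_max_left L0 n) hab]
  have cr : ContinuousOn (fun q : ℝ × ℝ => U q.1 q.2) (Icc t1 q ×ˢ Icc 0 1) := by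
    refine h.continuousOn_of_slope_le (fun t ht => (hl.trans h1.le).trans ht.1) hL ?_
    intro t ht a b h0 hab hb
    rcases ht.2.eq_or_lt with e | e
    · subst e
      have := le_of_abs_le (hUq a b h0 hab hb)
      linarith [grow (le_max_right L0 n) hab]
    · refine h.slope_le (hl.trans h1.le) hL (r := t) (continuousOn_of_locally
        (fun s hs => (hl.trans h1.le).trans hs.1)
        (fun s hs => hgap s ⟨h1.trans_le hs.1, hs.2.trans_lt e⟩)) ?_ t ⟨ht.1, le_rfl⟩ a b h0 hab hb
      intro a b h0 hab hb
      have := le_of_abs_le (hLip a b h0 hab hb)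
      linarith [grow (le_max_left L0 n) hab]
  have c : ContinuousOn (fun q : ℝ × ℝ => U q.1 q.2) (Icc l q ×ˢ Icc 0 1) := by
    rw [← Icc_union_Icc_eq_Icc h1.le h2.le, union_prod]
    exact cl.union_of_isClosed cr (isClosed_Icc.prod isClosed_Icc) (isClosed_Icc.prod isClosed_Icc)
  intro t ht a b h0 hab hb
  rw [abs_le]
  exact ⟨h.neg_le_slope_backward hl hn c (fun a b h0 hab hb => neg_le_of_abs_le (hUq a b h0 hab hb))
      t ht a b h0 hab hb,
    h.slope_le hl hn c (fun a b h0 hab hb => le_of_abs_le (hUl a b h0 hab hb)) t ht a b h0 hab hb⟩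

theorem exists_sliceLip (h : DegenerateFlow U γ) {t : ℝ} (ht : 0 ≤ t) :
    ∃ L, 0 ≤ L ∧ SliceLip U L t :=
  lipschitz_bound_of_contDiff ((h.reg t ht).of_le (by norm_num : (1 : WithTop ℕ∞) ≤ 2))

theorem SliceLip.mono {L M t : ℝ} (h : SliceLip U L t) (hLM : L ≤ M) : SliceLip U M t :=
  fun a b h0 hab h1 => (h a b h0 hab h1).trans
    (mul_le_mul_of_nonneg_right hLM (sub_nonneg.2 hab))

theorem sliceLip_of_subset (h : DegenerateFlow U γ) {a b n : ℝ} (ha : 0 ≤ a) (hn : 0 ≤ n)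
    (hUa : SliceLip U n a) (hUb : SliceLip U n b)
    (hE : ∀ t ∈ Icc a b, ¬ LocallyContinuousAt U t → SliceLip U n t) :
    ∀ t ∈ Icc a b, SliceLip U n t := by
  intro t ht
  by_cases hlc : LocallyContinuousAt U t
  swap
  · exact hE t ht hlc
  set G := ({s | ¬ LocallyContinuousAt U s} ∩ Icc a b) ∪ {a, b} with hG
  have hGc : IsClosed G := ((isOpen_locallyContinuousAt U).isClosed_compl.inter isClosed_Icc).union
    (Set.toFinite {a, b}).isClosed
  have hGab : G ⊆ Icc a b := by
    rintro s (hs | rfl | rfl)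
    · exact hs.2
    · exact ⟨le_rfl, ht.1.trans ht.2⟩
    · exact ⟨ht.1.trans ht.2, le_rfl⟩
  have hGlip : ∀ s ∈ G, SliceLip U n s := by
    rintro s (hs | rfl | rfl)
    · exact hE s hs.2 hs.1
    · exact hUa
    · exact hUb
  obtain ⟨l, ⟨hlG, hlt⟩, hlmax⟩ := (isCompact_Icc.inter_left hGc : IsCompact (G ∩ Icc a t)
    ).exists_isGreatest ⟨a, by simp [hG], le_rfl, ht.1⟩
  obtain ⟨q, ⟨hqG, hqt⟩, hqmin⟩ := (isCompact_Icc.inter_left hGc : IsCompact (G ∩ Icc t b)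
    ).exists_isLeast ⟨b, by simp [hG], ht.2, le_rfl⟩
  rcases (hlt.2.trans hqt.1).eq_or_lt with e | e
  · have : t = l := le_antisymm (e ▸ hqt.1) hlt.2
    exact this ▸ hGlip l hlG
  · refine h.sliceLip_of_gap (ha.trans hlt.1) hn e ?_ (hGlip l hlG) (hGlip q hqG) t ⟨hlt.2, hqt.1⟩
    intro s hs
    by_contra hns
    have hsab : s ∈ Icc a b := ⟨hlt.1.trans hs.1.le, hs.2.le.trans hqt.2⟩
    have hsG : s ∈ G := Or.inl ⟨hns, hsab⟩
    rcases le_total s t with hst | hst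
    · exact absurd (hlmax ⟨hsG, hsab.1, hst⟩) (not_le.2 hs.1)
    · exact absurd (hqmin ⟨hsG, hst, hsab.2⟩) (not_le.2 hs.2)

theorem locallyContinuousAt (h : DegenerateFlow U γ) : ∀ t, 0 ≤ t → LocallyContinuousAt U t := by
  by_contra! hne
  set E : Set ℝ := Ici 0 ∩ {t | ¬ LocallyContinuousAt U t} with hEdef
  have hEc : IsClosed E := isClosed_Ici.inter (isOpen_locallyContinuousAt U).isClosed_compl
  have hEn : Nonempty E := by
    obtain ⟨t, ht, h'⟩ := hne
    exact ⟨⟨t, ht, h'⟩⟩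
  have : CompleteSpace E := hEc.isComplete.completeSpace_coe
  obtain ⟨n, ⟨⟨t0, ht0⟩, hint⟩⟩ := nonempty_interior_of_iUnion_of_closed
    (X := E) (f := fun n : ℕ => {t : E | SliceLip U n t}) (fun n => by
      simp only [SliceLip, Set.ofPred_forall]
      refine isClosed_iInter fun a => isClosed_iInter fun b => isClosed_iInter fun h0 =>
        isClosed_iInter fun hab => isClosed_iInter fun h1 => isClosed_le ?_ continuous_const
      have hcb := (h.continuous_time (θ := b) ⟨h0.trans hab, h1⟩).sub
        (h.continuous_time (θ := a) ⟨h0, hab.trans h1⟩)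
      exact (hcb.comp_continuous (f := fun t : E => (t : ℝ)) continuous_subtype_val
        (fun t => t.2.1)).abs)
    (by
      refine eq_univ_of_forall fun t => ?_
      obtain ⟨L, hL, hLip⟩ := h.exists_sliceLip t.2.1
      obtain ⟨n, hn⟩ := exists_nat_ge L
      exact mem_iUnion.2 ⟨n, hLip.mono hn⟩)
  rw [mem_interior_iff_mem_nhds, Metric.mem_nhds_iff] at hint
  obtain ⟨δ, hδ, hball⟩ := hint
  have ht00 : 0 ≤ t0 := ht0.1
  obtain ⟨L1, hL1, hLip1⟩ := h.exists_sliceLip (le_max_right (t0 - δ / 2) 0)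
  obtain ⟨L2, hL2, hLip2⟩ := h.exists_sliceLip (show 0 ≤ t0 + δ / 2 by positivity)
  set m : ℝ := max n (max L1 L2) with hm
  have hm0 : 0 ≤ m := (Nat.cast_nonneg n).trans (le_max_left _ _)
  have key := h.sliceLip_of_subset (le_max_right (t0 - δ / 2) 0) hm0
    (hLip1.mono ((le_max_left _ _).trans (le_max_right _ _)))
    (hLip2.mono ((le_max_right _ _).trans (le_max_right _ _)))
    (fun t ht hnt => by
      have ht' : t ∈ E := ⟨(le_max_right _ _).trans ht.1, hnt⟩
      have : (⟨t, ht'⟩ : E) ∈ Metric.ball (⟨t0, ht0⟩ : E) δ := by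
        rw [Metric.mem_ball, Subtype.dist_eq, Real.dist_eq, abs_lt]
        constructor
        · simp only; linarith [(le_max_left (t0 - δ / 2) 0).trans ht.1]
        · simp only; linarith [ht.2]
      exact SliceLip.mono (hball this) (le_max_left _ _))
  apply ht0.2
  refine ⟨δ / 2, by positivity, (h.continuousOn_of_slope_le
    (T := Icc (max (t0 - δ / 2) 0) (t0 + δ / 2)) (fun t ht => (le_max_right _ _).trans ht.1) hm0
    (fun t ht a b h0 hab h1 => le_of_abs_le (key t ht a b h0 hab h1))).mono ?_⟩
  gcongr
  rintro t ⟨h1, h2⟩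
  exact ⟨max_le h1.1.le h2, h1.2.le⟩

theorem continuousOn_joint (h : DegenerateFlow U γ) :
    ContinuousOn (fun q : ℝ × ℝ => U q.1 q.2) (Ici 0 ×ˢ Icc 0 1) :=
  continuousOn_of_locally subset_rfl h.locallyContinuousAt

end DegenerateFlow

/-- A `C³` density close to `1`, with first and second derivatives bounded by `ε` and third
derivative bounded by `K`. -/
structure NiceDensity (ρ : ℝ → ℝ) (ε K : ℝ) : Prop where
  smooth : ContDiff ℝ 3 ρ
  lower : ∀ y, 1 / 2 ≤ ρ y
  upper : ∀ y, ρ y ≤ 3 / 2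
  d1 : ∀ y, |deriv ρ y| ≤ ε
  d2 : ∀ y, |deriv (deriv ρ) y| ≤ ε
  d3 : ∀ y, |deriv (deriv (deriv ρ)) y| ≤ K

/-- A classical solution of the continuum quantization flow. -/
structure ContinuumFlow (ρ : ℝ → ℝ) (X : ℝ → ℝ → ℝ) : Prop where
  reg : ∀ t, 0 ≤ t → ContDiff ℝ 2 (X t)
  pde : ∀ t, 0 ≤ t → ∀ θ ∈ Icc (0 : ℝ) 1, HasDerivAt (fun s => X s θ)
    ((1 / 2) * ρ (X t θ) * deriv (X t) θ * deriv (deriv (X t)) θ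
      + (1 / 6) * deriv ρ (X t θ) * (deriv (X t) θ) ^ 3) t
  left : ∀ t, 0 ≤ t → X t 0 = 0
  right : ∀ t, 0 ≤ t → X t 1 = 1

theorem deriv_le_of_slope_le {f : ℝ → ℝ} {d x L : ℝ} (hd : HasDerivAt f d x)
    (hx : x ∈ Icc (0 : ℝ) 1)
    (h : ∀ a b, 0 ≤ a → a ≤ b → b ≤ 1 → f b - f a ≤ L * (b - a)) : d ≤ L := by
  rcases hx.1.eq_or_lt with e | e
  · subst e
    have h1 : HasDerivAt (fun s => f (-s)) (-d) 0 := hasDerivAt_comp_neg (by simpa using hd)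
    have := le_deriv_of_left_le h1 (t0 := -1) (ε := -L) (by norm_num) (fun s hs hs' => by
      have := h 0 (-s) le_rfl (by linarith) (by linarith)
      simp only [neg_zero]
      linarith)
    linarith
  · have := le_deriv_of_left_le hd.fun_neg (ε := -L) e (fun s hs hs' => by
      have := h s x hs hs'.le hx.2
      linarith)
    linarith

theorem le_deriv_of_le_slope {f : ℝ → ℝ} {d x L : ℝ} (hd : HasDerivAt f d x)
    (hx : x ∈ Icc (0 : ℝ) 1)
    (h : ∀ a b, 0 ≤ a → a ≤ b → b ≤ 1 → L * (b - a) ≤ f b - f a) : L ≤ d := by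
  have := deriv_le_of_slope_le hd.fun_neg hx (L := -L)
    (fun a b h0 hab h1 => by linarith [h a b h0 hab h1])
  linarith

theorem slope_le_of_deriv_le {f : ℝ → ℝ} {L : ℝ} (hf : Differentiable ℝ f)
    (h : ∀ x ∈ Icc (0 : ℝ) 1, deriv f x ≤ L) :
    ∀ a b, 0 ≤ a → a ≤ b → b ≤ 1 → f b - f a ≤ L * (b - a) := fun a b h0 hab h1 =>
  (convex_Icc (0 : ℝ) 1).image_sub_le_mul_sub_of_deriv_le hf.continuous.continuousOn
    hf.differentiableOn (fun x hx => h x (interior_subset hx)) a ⟨h0, hab.trans h1⟩ b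
    ⟨h0.trans hab, h1⟩ hab

theorem le_slope_of_le_deriv {f : ℝ → ℝ} {L : ℝ} (hf : Differentiable ℝ f)
    (h : ∀ x ∈ Icc (0 : ℝ) 1, L ≤ deriv f x) :
    ∀ a b, 0 ≤ a → a ≤ b → b ≤ 1 → L * (b - a) ≤ f b - f a := fun a b h0 hab h1 =>
  (convex_Icc (0 : ℝ) 1).mul_sub_le_image_sub_of_le_deriv hf.continuous.continuousOn
    hf.differentiableOn (fun x hx => h x (interior_subset hx)) a ⟨h0, hab.trans h1⟩ b
    ⟨h0.trans hab, h1⟩ hab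

/-- The antiderivative of `ρ^{1/3}`. -/
noncomputable def cubeRootPrimitive (ρ : ℝ → ℝ) (y : ℝ) : ℝ :=
  ∫ z in (0 : ℝ)..y, (ρ z) ^ (1 / 3 : ℝ)

namespace NiceDensity

variable {ρ : ℝ → ℝ} {ε K : ℝ}

theorem pos (h : NiceDensity ρ ε K) (y : ℝ) : 0 < ρ y := by linarith [h.lower y]

theorem contDiff_cubeRoot (h : NiceDensity ρ ε K) :
    ContDiff ℝ 3 (fun z => (ρ z) ^ (1 / 3 : ℝ)) :=
  h.smooth.rpow_const_of_ne (fun z => (h.pos z).ne')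

theorem cubeRoot_pow (h : NiceDensity ρ ε K) (y : ℝ) : ((ρ y) ^ (1 / 3 : ℝ)) ^ 3 = ρ y := by
  rw [← Real.rpow_natCast, ← Real.rpow_mul (h.pos y).le]
  norm_num

theorem cubeRoot_bounds (h : NiceDensity ρ ε K) (y : ℝ) :
    1 / 2 ≤ (ρ y) ^ (1 / 3 : ℝ) ∧ (ρ y) ^ (1 / 3 : ℝ) ≤ 3 / 2 := by
  have h1 := h.cubeRoot_pow y
  have h2 := h.lower y
  have h3 := h.upper y
  constructor
  · by_contra! hlt
    have := pow_lt_pow_left₀ hlt (Real.rpow_nonneg (h.pos y).le _) (n := 3) (by norm_num)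
    norm_num at this
    linarith
  · by_contra! hlt
    have := pow_lt_pow_left₀ hlt (by norm_num) (n := 3) (by norm_num)
    norm_num at this
    linarith

theorem hasDerivAt_primitive (h : NiceDensity ρ ε K) (y : ℝ) :
    HasDerivAt (cubeRootPrimitive ρ) ((ρ y) ^ (1 / 3 : ℝ)) y :=
  (h.contDiff_cubeRoot.continuous.integral_hasStrictDerivAt 0 y).hasDerivAt

theorem contDiff_primitive (h : NiceDensity ρ ε K) : ContDiff ℝ 2 (cubeRootPrimitive ρ) := by
  have h2 : deriv (cubeRootPrimitive ρ) = fun z => (ρ z) ^ (1 / 3 : ℝ) :=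
    funext fun y => (h.hasDerivAt_primitive y).deriv
  have : (2 : WithTop ℕ∞) = 1 + 1 := by norm_num
  rw [this, contDiff_succ_iff_deriv]
  refine ⟨fun y => (h.hasDerivAt_primitive y).differentiableAt, by simp, ?_⟩
  rw [h2]
  exact h.contDiff_cubeRoot.of_le (by norm_num)

theorem primitive_sub_le (h : NiceDensity ρ ε K) {a b : ℝ} (hab : a ≤ b) :
    (1 / 2) * (b - a) ≤ cubeRootPrimitive ρ b - cubeRootPrimitive ρ a ∧
    cubeRootPrimitive ρ b - cubeRootPrimitive ρ a ≤ (3 / 2) * (b - a) := by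
  have hd : Differentiable ℝ (cubeRootPrimitive ρ) :=
    fun y => (h.hasDerivAt_primitive y).differentiableAt
  constructor
  · exact mul_sub_le_image_sub_of_le_deriv hd
      (fun y => by rw [(h.hasDerivAt_primitive y).deriv]; exact (h.cubeRoot_bounds y).1) hab
  · exact image_sub_le_mul_sub_of_deriv_le hd
      (fun y => by rw [(h.hasDerivAt_primitive y).deriv]; exact (h.cubeRoot_bounds y).2) hab

end NiceDensity

namespace ContinuumFlow

variable {ρ : ℝ → ℝ} {ε K : ℝ} {X : ℝ → ℝ → ℝ}

theorem degenerateFlow (hX : ContinuumFlow ρ X) (h : NiceDensity ρ ε K) :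
    DegenerateFlow (fun t θ => cubeRootPrimitive ρ (X t θ))
      (fun t θ => (1 / 2) * ((ρ (X t θ)) ^ (1 / 3 : ℝ)) ^ 2) where
  reg t ht := h.contDiff_primitive.comp (hX.reg t ht)
  nonneg t ht θ hθ := by positivity
  left t ht := by simp only [hX.left t ht, hX.left 0 le_rfl]
  right t ht := by simp only [hX.right t ht, hX.right 0 le_rfl]
  pde t ht θ hθ := by
    have hreg := hX.reg t ht
    have hX1 : ∀ x, HasDerivAt (X t) (deriv (X t) x) x := fun x =>
      (hreg.differentiable (by norm_num) x).hasDerivAt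
    have hX2 : ∀ x, HasDerivAt (deriv (X t)) (deriv (deriv (X t)) x) x := fun x =>
      (hreg.differentiable_deriv_two x).hasDerivAt
    have e1 : (deriv fun y => cubeRootPrimitive ρ (X t y)) =
        fun y => (ρ (X t y)) ^ (1 / 3 : ℝ) * deriv (X t) y := funext fun y =>
      ((h.hasDerivAt_primitive (X t y)).comp y (hX1 y)).deriv
    set σ : ℝ → ℝ := fun z => (ρ z) ^ (1 / 3 : ℝ) with hσ
    have hσd : HasDerivAt σ (deriv σ (X t θ)) (X t θ) :=
      (h.contDiff_cubeRoot.differentiable (by norm_num) _).hasDerivAt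
    have e2 : HasDerivAt (fun y => σ (X t y) * deriv (X t) y)
        (deriv σ (X t θ) * deriv (X t) θ * deriv (X t) θ +
          σ (X t θ) * deriv (deriv (X t)) θ) θ :=
      (hσd.comp θ (hX1 θ)).mul (hX2 θ)
    have e3 : deriv ρ (X t θ) = 3 * σ (X t θ) ^ 2 * deriv σ (X t θ) := by
      have : ρ = fun z => σ z ^ 3 := funext fun z => (h.cubeRoot_pow z).symm
      have hd := (hσd.pow 3).deriv
      have e : deriv ρ (X t θ) = deriv (σ ^ 3) (X t θ) := by
        conv_lhs => rw [this]
        rfl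
      rw [e, hd]; norm_num
    have e4 : ρ (X t θ) = σ (X t θ) ^ 3 := (h.cubeRoot_pow _).symm
    have := (h.hasDerivAt_primitive (X t θ)).comp t (hX.pde t ht θ hθ)
    refine this.congr_deriv ?_
    rw [e1]
    change σ (X t θ) * _ = 1 / 2 * σ (X t θ) ^ 2 * (σ (X t θ) * deriv (X t) θ) *
      deriv (fun y => σ (X t y) * deriv (X t) y) θ
    rw [e2.deriv, e3, e4]
    ring

theorem continuousOn_joint (hX : ContinuumFlow ρ X) (h : NiceDensity ρ ε K) :
    ContinuousOn (fun q : ℝ × ℝ => X q.1 q.2) (Ici 0 ×ˢ Icc 0 1) := by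
  have hU := (hX.degenerateFlow h).continuousOn_joint
  have key : ∀ a b, dist a b ≤ 2 * dist (cubeRootPrimitive ρ a) (cubeRootPrimitive ρ b) := by
    intro a b
    rw [Real.dist_eq, Real.dist_eq]
    rcases le_total a b with hab | hab
    · rw [abs_sub_comm, abs_sub_comm (cubeRootPrimitive ρ a), abs_of_nonneg (sub_nonneg.2 hab)]
      linarith [(h.primitive_sub_le hab).1,
          le_abs_self (cubeRootPrimitive ρ b - cubeRootPrimitive ρ a)]
    · rw [abs_of_nonneg (sub_nonneg.2 hab)]
      linarith [(h.primitive_sub_le hab).1,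
          le_abs_self (cubeRootPrimitive ρ a - cubeRootPrimitive ρ b)]
  intro q hq
  have h1 := tendsto_iff_dist_tendsto_zero.1 (hU q hq)
  refine tendsto_iff_dist_tendsto_zero.2 (squeeze_zero (fun _ => dist_nonneg) (fun p => key _ _) ?_)
  simpa using h1.const_mul 2

theorem slope_bounds (hX : ContinuumFlow ρ X) (h : NiceDensity ρ ε K) {a0 A0 : ℝ} (ha0 : 0 < a0)
    (hA0 : 0 < A0) (hi : ∀ θ ∈ Icc (0 : ℝ) 1, a0 ≤ deriv (X 0) θ ∧ deriv (X 0) θ ≤ A0)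
    {t : ℝ} (ht : 0 ≤ t) :
    ∀ a b, 0 ≤ a → a ≤ b → b ≤ 1 →
      a0 / 3 * (b - a) ≤ X t b - X t a ∧ X t b - X t a ≤ 3 * A0 * (b - a) := by
  have hU := hX.degenerateFlow h
  have hc : ContinuousOn (fun q : ℝ × ℝ => cubeRootPrimitive ρ (X q.1 q.2))
      (Icc 0 t ×ˢ Icc 0 1) := hU.continuousOn_joint.mono (by gcongr; exact Icc_subset_Ici_self)
  have hd := (hX.reg 0 le_rfl).differentiable (by norm_num)
  have lo := le_slope_of_le_deriv hd (fun x hx => (hi x hx).1)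
  have up := slope_le_of_deriv_le hd (fun x hx => (hi x hx).2)
  have hlow := hU.le_slope le_rfl (L := a0 / 2) (by positivity) hc (fun a b h0 hab h1 => by
    have e := lo a b h0 hab h1
    have e' : 0 ≤ a0 * (b - a) := mul_nonneg ha0.le (sub_nonneg.2 hab)
    have := (h.primitive_sub_le (a := X 0 a) (b := X 0 b) (by linarith)).1
    linarith) t ⟨ht, le_rfl⟩
  have hup := hU.slope_le le_rfl (L := 3 / 2 * A0) (by positivity) hc (fun a b h0 hab h1 => by
    have e := lo a b h0 hab h1
    have e1 := up a b h0 hab h1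
    have e' : 0 ≤ a0 * (b - a) := mul_nonneg ha0.le (sub_nonneg.2 hab)
    have := (h.primitive_sub_le (a := X 0 a) (b := X 0 b) (by linarith)).2
    linarith) t ⟨ht, le_rfl⟩
  intro a b h0 hab h1
  have e1 := hlow a b h0 hab h1
  have e2 := hup a b h0 hab h1
  have e' : 0 ≤ a0 * (b - a) := mul_nonneg ha0.le (sub_nonneg.2 hab)
  have hmono : X t a ≤ X t b := by
    by_contra! hlt
    have := (h.primitive_sub_le hlt.le).1
    linarith
  have := h.primitive_sub_le hmono
  constructor <;> linarith [this.1, this.2]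

theorem deriv_bounds (hX : ContinuumFlow ρ X) (h : NiceDensity ρ ε K) {a0 A0 : ℝ} (ha0 : 0 < a0)
    (hA0 : 0 < A0) (hi : ∀ θ ∈ Icc (0 : ℝ) 1, a0 ≤ deriv (X 0) θ ∧ deriv (X 0) θ ≤ A0)
    {t : ℝ} (ht : 0 ≤ t) {θ : ℝ} (hθ : θ ∈ Icc (0 : ℝ) 1) :
    a0 / 3 ≤ deriv (X t) θ ∧ deriv (X t) θ ≤ 3 * A0 := by
  have hd := ((hX.reg t ht).differentiable (by norm_num) θ).hasDerivAt
  have hs := hX.slope_bounds h ha0 hA0 hi ht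
  exact ⟨le_deriv_of_le_slope hd hθ (fun a b h0 hab h1 => (hs a b h0 hab h1).1),
    deriv_le_of_slope_le hd hθ (fun a b h0 hab h1 => (hs a b h0 hab h1).2)⟩

end ContinuumFlow

/-- The right-hand side of the continuum flow as a function of position, slope and curvature. -/
noncomputable def flux (ρ : ℝ → ℝ) (x p r : ℝ) : ℝ :=
  (1 / 2) * ρ x * p * r + (1 / 6) * deriv ρ x * p ^ 3

/-- A time-dependent family of increasing parametrizations of `[0,1]` on the time interval
`[0,T]`. -/
structure MonotoneFamily (V : ℝ → ℝ → ℝ) (a T : ℝ) : Prop where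
  cont : ContinuousOn (fun q : ℝ × ℝ => V q.1 q.2) (Icc 0 T ×ˢ Icc 0 1)
  reg : ∀ t ∈ Icc 0 T, ContDiff ℝ 2 (V t)
  left : ∀ t ∈ Icc 0 T, V t 0 = 0
  right : ∀ t ∈ Icc 0 T, V t 1 = 1
  slope : ∀ t ∈ Icc 0 T, ∀ x y, 0 ≤ x → x ≤ y → y ≤ 1 → a * (y - x) ≤ V t y - V t x

theorem horizontal_comparison {ρ : ℝ → ℝ} (hρ : ∀ y, 0 ≤ ρ y) {V Z : ℝ → ℝ → ℝ} {a T κ δ : ℝ}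
    (ha : 0 < a) (hκ : 0 ≤ κ) (hδ : 0 ≤ δ) (hV : MonotoneFamily V a T) (hZ : MonotoneFamily Z a T)
    (hVt : ∀ t ∈ Ioc 0 T, ∀ θ ∈ Ioo (0 : ℝ) 1, ∃ v,
      v ≤ flux ρ (V t θ) (deriv (V t) θ) (deriv (deriv (V t)) θ) + κ ∧
      HasDerivAt (fun s => V s θ) v t)
    (hZt : ∀ t ∈ Ioc 0 T, ∀ θ ∈ Ioo (0 : ℝ) 1, ∃ v,
      flux ρ (Z t θ) (deriv (Z t) θ) (deriv (deriv (Z t)) θ) - κ ≤ v ∧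
      HasDerivAt (fun s => Z s θ) v t)
    (hi : ∀ θ ∈ Icc (0 : ℝ) 1, ∀ θ' ∈ Icc (0 : ℝ) 1, Z 0 θ' ≤ V 0 θ → θ' - θ ≤ δ) :
    ∀ t ∈ Icc 0 T, ∀ θ ∈ Icc (0 : ℝ) 1, ∀ θ' ∈ Icc (0 : ℝ) 1, Z t θ' ≤ V t θ →
      θ' - θ ≤ δ + 2 * κ / a * t := by
  intro ts hts θs hθs θs' hθs' hs
  refine le_of_forall_pos_le_add fun ε' hε' => ?_
  obtain ⟨ε, hε, hεt⟩ : ∃ ε > 0, ε * ts ≤ ε' := by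
    refine ⟨ε' / (ts + 1), div_pos hε' (by linarith [hts.1]), ?_⟩
    rw [div_mul_eq_mul_div, div_le_iff₀ (by linarith [hts.1])]
    nlinarith [hts.1]
  set μ := 2 * κ / a + ε with hμ
  have hμ0 : 0 < μ := by positivity
  suffices θs' - θs - μ * ts ≤ δ by
    have : μ * ts = 2 * κ / a * ts + ε * ts := by rw [hμ]; ring
    linarith
  by_contra! hlt
  set C : Set (ℝ × ℝ × ℝ) := (Icc 0 T ×ˢ Icc (0 : ℝ) 1 ×ˢ Icc (0 : ℝ) 1) ∩
    (fun q : ℝ × ℝ × ℝ => Z q.1 q.2.2 - V q.1 q.2.1) ⁻¹' Iic 0 with hC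
  have hcomp : IsCompact C := by
    refine (isCompact_Icc.prod (isCompact_Icc.prod isCompact_Icc)).of_isClosed_subset
      (ContinuousOn.preimage_isClosed_of_isClosed ?_ (isClosed_Icc.prod
        (isClosed_Icc.prod isClosed_Icc)) isClosed_Iic) inter_subset_left
    refine (hZ.cont.comp (f := fun q : ℝ × ℝ × ℝ => (q.1, q.2.2)) (by fun_prop) ?_).sub
      (hV.cont.comp (f := fun q : ℝ × ℝ × ℝ => (q.1, q.2.1)) (by fun_prop) ?_)
    · rintro q ⟨h1, h2, h3⟩; exact ⟨h1, h3⟩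
    · rintro q ⟨h1, h2, h3⟩; exact ⟨h1, h2⟩
  obtain ⟨⟨t, θ, θ'⟩, ⟨⟨ht, hθ, hθ'⟩, hle⟩, hmax⟩ := hcomp.exists_isMaxOn
    (f := fun q : ℝ × ℝ × ℝ => q.2.2 - q.2.1 - μ * q.1)
    ⟨(ts, θs, θs'), ⟨hts, hθs, hθs'⟩, by simpa using hs⟩ (by fun_prop)
  simp only [mem_preimage, mem_Iic, sub_nonpos] at ht hθ hθ' hle
  have hm : ∀ s ∈ Icc 0 T, ∀ w ∈ Icc (0 : ℝ) 1, ∀ y ∈ Icc (0 : ℝ) 1, Z s y ≤ V s w →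
      y - w - μ * s ≤ θ' - θ - μ * t := fun s hs w hw y hy h =>
    hmax (show (s, w, y) ∈ C from ⟨⟨hs, hw, hy⟩, by simpa using h⟩)
  have hbig : δ < θ' - θ - μ * t := hlt.trans_le (hm ts hts θs hθs θs' hθs' hs)
  have hpert : ∀ s ∈ Icc 0 T, ∀ w ∈ Icc (0 : ℝ) 1, ∀ y ∈ Ico (0 : ℝ) 1,
      θ' - θ - μ * t ≤ y - w - μ * s → V s w ≤ Z s y := by
    intro s hs w hw y hy hge
    by_contra! hlt
    have hc := (hZ.reg s hs).continuous
    have : ∀ᶠ y' in 𝓝[>] y, Z s y' < V s w ∧ y' < 1 :=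
      ((hc.tendsto y).eventually_lt_const hlt |>.filter_mono nhdsWithin_le_nhds).and
        ((eventually_lt_nhds hy.2).filter_mono nhdsWithin_le_nhds)
    obtain ⟨y', ⟨h1, h2⟩, h3⟩ := (this.and self_mem_nhdsWithin).exists
    replace h3 : y < y' := h3
    have := hm s hs w hw y' ⟨hy.1.trans h3.le, h2.le⟩ h1.le
    linarith
  have ht0 : 0 < t := by
    rcases ht.1.eq_or_lt with e | e
    · subst e
      have := hi θ hθ θ' hθ' hle
      linarith
    · exact e
  have hμt : 0 ≤ μ * t := by positivity
  have hlt' : θ < θ' := by linarith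
  have hθ'1 : θ' < 1 := by
    rcases hθ'.2.eq_or_lt with e | e
    · subst e
      have h1 := hV.slope t ht θ 1 hθ.1 hθ.2 le_rfl
      rw [hV.right t ht] at h1
      rw [hZ.right t ht] at hle
      nlinarith
    · exact e
  have hθ0 : 0 < θ := by
    rcases hθ.1.eq_or_lt with e | e
    · subst e
      have h1 := hZ.slope t ht 0 θ' le_rfl hθ'.1 hθ'.2
      rw [hZ.left t ht] at h1
      rw [hV.left t ht] at hle
      nlinarith
    · exact e
  have heq : V t θ = Z t θ' := le_antisymm (hpert t ht θ hθ θ' ⟨hθ'.1, hθ'1⟩ le_rfl) hle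
  have hrV := hV.reg t ht
  have hrZ := hZ.reg t ht
  have hloc : IsLocalMax (fun x => V t (θ + x) - Z t (θ' + x)) 0 := by
    have : ∀ᶠ x in 𝓝 (0 : ℝ), -θ < x ∧ x < 1 - θ' :=
      Ioo_mem_nhds (by linarith) (by linarith)
    filter_upwards [this] with x hx
    simp only [add_zero, heq, sub_self, sub_nonpos]
    exact hpert t ht _ ⟨by linarith, by linarith⟩ _ ⟨by linarith, by linarith⟩ (by linarith)
  have hsec := deriv_deriv_nonpos_of_isLocalMax (f := fun x => V t (θ + x) - Z t (θ' + x))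
    ((hrV.comp (contDiff_const.add contDiff_id)).sub (hrZ.comp (contDiff_const.add contDiff_id)))
    hloc
  have e1 : (deriv fun x => V t (θ + x) - Z t (θ' + x)) =
      fun x => deriv (V t) (θ + x) - deriv (Z t) (θ' + x) := by
    funext x
    exact ((((hrV.differentiable (by norm_num)) _).hasDerivAt.comp_const_add θ x).fun_sub
      (((hrZ.differentiable (by norm_num)) _).hasDerivAt.comp_const_add θ' x)).deriv
  have e2 : deriv (fun x => deriv (V t) (θ + x) - deriv (Z t) (θ' + x)) 0 =
      deriv (deriv (V t)) θ - deriv (deriv (Z t)) θ' := by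
    have := (((hrV.differentiable_deriv_two _).hasDerivAt.comp_const_add θ 0).fun_sub
      ((hrZ.differentiable_deriv_two _).hasDerivAt.comp_const_add θ' 0)).deriv
    simpa using this
  rw [e1, e2] at hsec
  simp only [add_zero] at hsec
  obtain ⟨v, hv, hdv⟩ := hVt t ⟨ht0, ht.2⟩ θ ⟨hθ0, by linarith⟩
  obtain ⟨z, hz, hdz⟩ := hZt t ⟨ht0, ht.2⟩ θ' ⟨by linarith, hθ'1⟩
  have htime : a * μ ≤ v - z := by
    refine le_deriv_of_left_le (hdv.fun_sub hdz) (t0 := max 0 (t - θ' / μ)) (max_lt ht0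
      (by have := div_pos (hθ0.trans hlt') hμ0; linarith)) (fun s hs hst => ?_)
    have hs0 : 0 ≤ s := (le_max_left _ _).trans hs
    have hs1 : t - θ' / μ ≤ s := (le_max_right _ _).trans hs
    have hs2 : μ * (t - s) ≤ θ' := by
      have : t - s ≤ θ' / μ := by linarith
      rw [le_div_iff₀ hμ0] at this; linarith
    have hs3 : 0 ≤ μ * (t - s) := mul_nonneg hμ0.le (by linarith)
    have hsT : s ∈ Icc 0 T := ⟨hs0, hst.le.trans ht.2⟩
    have h1 := hpert s hsT θ hθ (θ' - μ * (t - s)) ⟨by linarith, by linarith⟩ (by linarith)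
    have h2 := hZ.slope s hsT (θ' - μ * (t - s)) θ' (by linarith) (by linarith) hθ'.2
    simp only [heq]
    linarith
  have hp : deriv (V t) θ = deriv (Z t) θ' := by linarith [hsec.1]
  have hpa : a ≤ deriv (V t) θ := le_deriv_of_le_slope
    ((hrV.differentiable (by norm_num)) θ).hasDerivAt hθ (hV.slope t ht)
  have haμ : a * μ = 2 * κ + a * ε := by rw [hμ]; field_simp
  have haε : 0 < a * ε := by positivity
  have hflux : flux ρ (V t θ) (deriv (V t) θ) (deriv (deriv (V t)) θ) ≤
      flux ρ (Z t θ') (deriv (Z t) θ') (deriv (deriv (Z t)) θ') := by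
    rw [flux, flux, heq, hp]
    have : 0 ≤ 1 / 2 * ρ (Z t θ') * deriv (Z t) θ' := by
      have := hρ (Z t θ')
      have : 0 ≤ deriv (Z t) θ' := by linarith
      positivity
    have := mul_le_mul_of_nonneg_left (show deriv (deriv (V t)) θ ≤ deriv (deriv (Z t)) θ' by
      linarith [hsec.2]) this
    linarith
  linarith

theorem abs_sub_le_of_horizontal {f g : ℝ → ℝ} {A D : ℝ} (hg : Continuous g)
    (hf0 : 0 ≤ f 0) (hmono : ∀ x y, 0 ≤ x → x ≤ y → y ≤ 1 → f x ≤ f y) (hf1 : f 1 ≤ 1)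
    (hg0 : g 0 = 0) (hg1 : g 1 = 1) (hA : 0 ≤ A)
    (hs : ∀ x y, 0 ≤ x → x ≤ y → y ≤ 1 → |g y - g x| ≤ A * (y - x))
    (h1 : ∀ θ ∈ Icc (0 : ℝ) 1, ∀ θ' ∈ Icc (0 : ℝ) 1, g θ' ≤ f θ → θ' - θ ≤ D)
    (h2 : ∀ θ ∈ Icc (0 : ℝ) 1, ∀ θ' ∈ Icc (0 : ℝ) 1, f θ' ≤ g θ → θ' - θ ≤ D) :
    ∀ θ ∈ Icc (0 : ℝ) 1, |f θ - g θ| ≤ A * D := by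
  intro θ hθ
  obtain ⟨w, hw, hwe⟩ : f θ ∈ g '' Icc 0 1 := by
    refine intermediate_value_Icc zero_le_one hg.continuousOn ⟨?_, ?_⟩
    · rw [hg0]; exact hf0.trans (hmono 0 θ le_rfl hθ.1 hθ.2)
    · rw [hg1]; exact (hmono θ 1 hθ.1 hθ.2 le_rfl).trans hf1
  have e1 := h1 θ hθ w hw hwe.le
  have e2 := h2 w hw θ hθ hwe.ge
  rw [← hwe]
  rcases le_total w θ with h | h
  · rw [abs_sub_comm]
    exact (hs w θ hw.1 h hθ.2).trans (by gcongr)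
  · exact (hs θ w hθ.1 h hw.2).trans (by gcongr)

theorem ContinuumFlow.shift {ρ : ℝ → ℝ} {X : ℝ → ℝ → ℝ} (hX : ContinuumFlow ρ X) {τ : ℝ}
    (hτ : 0 ≤ τ) : ContinuumFlow ρ (fun t => X (t + τ)) where
  reg t ht := hX.reg _ (by linarith)
  left t ht := hX.left _ (by linarith)
  right t ht := hX.right _ (by linarith)
  pde t ht θ hθ := (hX.pde (t + τ) (by linarith) θ hθ).comp_add_const t τ

/-- A continuum flow with uniformly bounded initial slopes and initial speed. -/
structure RegularFlow (ρ : ℝ → ℝ) (X : ℝ → ℝ → ℝ) (ε K a A B : ℝ) : Prop where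
  density : NiceDensity ρ ε K
  eps_le : ε ≤ 1
  flow : ContinuumFlow ρ X
  a_pos : 0 < a
  A_pos : 0 < A
  B_nonneg : 0 ≤ B
  slope_init : ∀ θ ∈ Icc (0 : ℝ) 1, a ≤ deriv (X 0) θ ∧ deriv (X 0) θ ≤ A
  curv_init : ∀ θ ∈ Icc (0 : ℝ) 1, |deriv (deriv (X 0)) θ| ≤ B
  curv_lip : ∀ x ∈ Icc (0 : ℝ) 1, ∀ y ∈ Icc (0 : ℝ) 1,
    |deriv (deriv (X 0)) x - deriv (deriv (X 0)) y| ≤ B * |x - y|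

namespace RegularFlow

variable {ρ : ℝ → ℝ} {X : ℝ → ℝ → ℝ} {ε K a A B : ℝ}

theorem slope (h : RegularFlow ρ X ε K a A B) {t : ℝ} (ht : 0 ≤ t) : ∀ x y, 0 ≤ x → x ≤ y → y ≤ 1 →
    a / 3 * (y - x) ≤ X t y - X t x ∧ X t y - X t x ≤ 3 * A * (y - x) :=
  h.flow.slope_bounds h.density h.a_pos h.A_pos h.slope_init ht

theorem deriv_mem (h : RegularFlow ρ X ε K a A B) {t θ : ℝ} (ht : 0 ≤ t) (hθ : θ ∈ Icc (0 : ℝ) 1) :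
    a / 3 ≤ deriv (X t) θ ∧ deriv (X t) θ ≤ 3 * A :=
  h.flow.deriv_bounds h.density h.a_pos h.A_pos h.slope_init ht hθ

theorem continuousOn (h : RegularFlow ρ X ε K a A B) :
    ContinuousOn (fun q : ℝ × ℝ => X q.1 q.2) (Ici 0 ×ˢ Icc 0 1) :=
  h.flow.continuousOn_joint h.density

theorem monotoneFamily (h : RegularFlow ρ X ε K a A B) {τ T : ℝ} (hτ : 0 ≤ τ) :
    MonotoneFamily (fun t => X (t + τ)) (a / 3) T where
  cont := h.continuousOn.comp (f := fun q : ℝ × ℝ => (q.1 + τ, q.2)) (by fun_prop)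
    (fun q hq => ⟨add_nonneg hq.1.1 hτ, hq.2⟩)
  reg t ht := h.flow.reg _ (add_nonneg ht.1 hτ)
  left t ht := h.flow.left _ (add_nonneg ht.1 hτ)
  right t ht := h.flow.right _ (add_nonneg ht.1 hτ)
  slope t ht x y h0 hxy h1 := (h.slope (add_nonneg ht.1 hτ) x y h0 hxy h1).1

theorem monotoneFamily_const (h : RegularFlow ρ X ε K a A B) {T : ℝ} :
    MonotoneFamily (fun _ => X 0) (a / 3) T where
  cont := ((h.flow.reg 0 le_rfl).continuous.comp continuous_snd).continuousOn
  reg _ _ := h.flow.reg 0 le_rfl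
  left _ _ := h.flow.left 0 le_rfl
  right _ _ := h.flow.right 0 le_rfl
  slope _ _ x y h0 hxy h1 := (h.slope le_rfl x y h0 hxy h1).1

/-- Uniform bound for the initial speed. -/
noncomputable def initialSpeed (A B : ℝ) : ℝ := A * B + A ^ 3

theorem initialSpeed_nonneg (h : RegularFlow ρ X ε K a A B) : 0 ≤ initialSpeed A B := by
  have := h.A_pos
  have := h.B_nonneg
  unfold initialSpeed; positivity

theorem abs_flux_init (h : RegularFlow ρ X ε K a A B) {θ : ℝ} (hθ : θ ∈ Icc (0 : ℝ) 1) :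
    |flux ρ (X 0 θ) (deriv (X 0) θ) (deriv (deriv (X 0)) θ)| ≤ initialSpeed A B := by
  have hp := h.slope_init θ hθ
  have hp0 : 0 ≤ deriv (X 0) θ := h.a_pos.le.trans hp.1
  have hr := h.curv_init θ hθ
  have h1 := h.density.upper (X 0 θ)
  have h2 := h.density.pos (X 0 θ)
  have h3 := (h.density.d1 (X 0 θ)).trans h.eps_le
  have hA := h.A_pos
  have hB := h.B_nonneg
  unfold flux initialSpeed
  refine (abs_add_le _ _).trans ?_
  rw [abs_mul, abs_mul, abs_mul, abs_mul, abs_mul, abs_pow, abs_of_pos h2, abs_of_nonneg hp0]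
  norm_num
  have e1 : 1 / 2 * ρ (X 0 θ) * deriv (X 0) θ * |deriv (deriv (X 0)) θ| ≤
      1 / 2 * (3 / 2) * A * B := by
    gcongr
    exact hp.2
  have e2 : 1 / 6 * |deriv ρ (X 0 θ)| * deriv (X 0) θ ^ 3 ≤ 1 / 6 * 1 * A ^ 3 := by
    gcongr
    exact hp.2
  have : 0 ≤ A * B := by positivity
  have : 0 ≤ A ^ 3 := by positivity
  norm_num at e1 e2 ⊢
  linarith

theorem horizontal_init (h : RegularFlow ρ X ε K a A B) {τ : ℝ} (hτ : 0 ≤ τ) :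
    (∀ θ ∈ Icc (0 : ℝ) 1, ∀ θ' ∈ Icc (0 : ℝ) 1, X 0 θ' ≤ X τ θ →
      θ' - θ ≤ 2 * initialSpeed A B / (a / 3) * τ) ∧
    (∀ θ ∈ Icc (0 : ℝ) 1, ∀ θ' ∈ Icc (0 : ℝ) 1, X τ θ' ≤ X 0 θ →
      θ' - θ ≤ 2 * initialSpeed A B / (a / 3) * τ) := by
  have ha := h.a_pos
  have hsp := h.initialSpeed_nonneg
  have hfam := h.monotoneFamily (τ := 0) (T := τ) le_rfl
  simp only [add_zero] at hfam
  have hinit : ∀ θ ∈ Icc (0 : ℝ) 1, ∀ θ' ∈ Icc (0 : ℝ) 1, X 0 θ' ≤ X 0 θ → θ' - θ ≤ 0 := by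
    intro θ hθ θ' hθ' hle
    by_contra! hlt
    have := (h.slope le_rfl θ θ' hθ.1 (by linarith) hθ'.2).1
    have : 0 < a / 3 * (θ' - θ) := by positivity
    linarith
  have hρ : ∀ y, 0 ≤ ρ y := fun y => (h.density.pos y).le
  constructor
  · intro θ hθ θ' hθ' hle
    have := horizontal_comparison hρ (a := a / 3) (by positivity) hsp le_rfl hfam
      (h.monotoneFamily_const (T := τ))
      (fun t ht θ hθ => ⟨_, le_add_of_nonneg_right hsp,
        h.flow.pde t ht.1.le θ (Ioo_subset_Icc_self hθ)⟩)
      (fun t ht θ hθ => ⟨0, by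
        linarith [le_of_abs_le (h.abs_flux_init (Ioo_subset_Icc_self hθ))], hasDerivAt_const _ _⟩)
      hinit τ ⟨hτ, le_rfl⟩ θ hθ θ' hθ' hle
    linarith
  · intro θ hθ θ' hθ' hle
    have := horizontal_comparison hρ (a := a / 3) (by positivity) hsp le_rfl
      (h.monotoneFamily_const (T := τ)) hfam
      (fun t ht θ hθ => ⟨0, by
        linarith [neg_le_of_abs_le (h.abs_flux_init (Ioo_subset_Icc_self hθ))],
        hasDerivAt_const _ _⟩)
      (fun t ht θ hθ => ⟨_, sub_le_self _ hsp,
        h.flow.pde t ht.1.le θ (Ioo_subset_Icc_self hθ)⟩)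
      hinit τ ⟨hτ, le_rfl⟩ θ hθ θ' hθ' hle
    linarith

/-- Uniform bound for the speed. -/
noncomputable def speedBound (a A B : ℝ) : ℝ := 3 * A * (2 * initialSpeed A B / (a / 3))

theorem speedBound_nonneg (h : RegularFlow ρ X ε K a A B) : 0 ≤ speedBound a A B := by
  have := h.A_pos
  have := h.a_pos
  have := h.initialSpeed_nonneg
  unfold speedBound; positivity

theorem abs_time_sub_le (h : RegularFlow ρ X ε K a A B) {t τ θ : ℝ} (ht : 0 ≤ t) (hτ : 0 ≤ τ)
    (hθ : θ ∈ Icc (0 : ℝ) 1) : |X (t + τ) θ - X t θ| ≤ speedBound a A B * τ := by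
  have ha := h.a_pos
  have hA := h.A_pos
  have hsp := h.initialSpeed_nonneg
  have hρ : ∀ y, 0 ≤ ρ y := fun y => (h.density.pos y).le
  have hD : 0 ≤ 2 * initialSpeed A B / (a / 3) * τ := by positivity
  have hfam := h.monotoneFamily (τ := 0) (T := t) le_rfl
  simp only [add_zero] at hfam
  have hfam' := h.monotoneFamily (τ := τ) (T := t) hτ
  have hsh := h.flow.shift hτ
  obtain ⟨i1, i2⟩ := h.horizontal_init hτ
  have c1 := horizontal_comparison hρ (a := a / 3) (by positivity) le_rfl hD hfam' hfam
    (fun t ht θ hθ => ⟨_, le_add_of_nonneg_right le_rfl,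
      hsh.pde t ht.1.le θ (Ioo_subset_Icc_self hθ)⟩)
    (fun t ht θ hθ => ⟨_, sub_le_self _ le_rfl,
      h.flow.pde t ht.1.le θ (Ioo_subset_Icc_self hθ)⟩)
    (by simpa using i1) t ⟨ht, le_rfl⟩
  have c2 := horizontal_comparison hρ (a := a / 3) (by positivity) le_rfl hD hfam hfam'
    (fun t ht θ hθ => ⟨_, le_add_of_nonneg_right le_rfl,
      h.flow.pde t ht.1.le θ (Ioo_subset_Icc_self hθ)⟩)
    (fun t ht θ hθ => ⟨_, sub_le_self _ le_rfl,
      hsh.pde t ht.1.le θ (Ioo_subset_Icc_self hθ)⟩)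
    (by simpa using i2) t ⟨ht, le_rfl⟩
  have hpos : ∀ x y : ℝ, x ≤ y → 0 ≤ a / 3 * (y - x) := fun x y hxy =>
    mul_nonneg (by positivity) (sub_nonneg.2 hxy)
  have := abs_sub_le_of_horizontal (f := X (t + τ)) (g := X t) (A := 3 * A)
    (h.flow.reg t ht).continuous (h.flow.left _ (by linarith)).ge
    (fun x y h0 hxy h1 => by
      linarith [(h.slope (add_nonneg ht hτ) x y h0 hxy h1).1, hpos x y hxy])
    (h.flow.right _ (by linarith)).le (h.flow.left t ht) (h.flow.right t ht) (by positivity)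
    (fun x y h0 hxy h1 => by
      rw [abs_of_nonneg (by linarith [(h.slope ht x y h0 hxy h1).1, hpos x y hxy])]
      exact (h.slope ht x y h0 hxy h1).2)
    (by simpa using c1) (by simpa using c2) θ hθ
  refine this.trans (le_of_eq ?_)
  unfold speedBound; ring

theorem abs_flux_le (h : RegularFlow ρ X ε K a A B) {t θ : ℝ} (ht : 0 ≤ t)
    (hθ : θ ∈ Icc (0 : ℝ) 1) :
    |flux ρ (X t θ) (deriv (X t) θ) (deriv (deriv (X t)) θ)| ≤ speedBound a A B := by
  have hd := h.flow.pde t ht θ hθ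
  have h1 := (hasDerivAt_iff_tendsto_slope.1 hd).mono_left
    (nhdsWithin_mono t (fun s (hs : s ∈ Ioi t) => ne_of_gt hs))
  refine le_of_tendsto h1.abs ?_
  filter_upwards [self_mem_nhdsWithin] with s hs
  simp only [mem_Ioi] at hs
  have hst : 0 < s - t := sub_pos.2 hs
  have := h.abs_time_sub_le ht hst.le hθ
  rw [slope_def_field, abs_div, abs_of_pos hst, div_le_iff₀ hst]
  simpa using this

/-- Uniform bound for the second space derivative. -/
noncomputable def curvBound (a A B : ℝ) : ℝ := 12 / a * (speedBound a A B + 27 * A ^ 3)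

theorem curvBound_nonneg (h : RegularFlow ρ X ε K a A B) : 0 ≤ curvBound a A B := by
  have := h.A_pos
  have := h.a_pos
  have := h.speedBound_nonneg
  unfold curvBound; positivity

theorem abs_curv_le (h : RegularFlow ρ X ε K a A B) {t θ : ℝ} (ht : 0 ≤ t)
    (hθ : θ ∈ Icc (0 : ℝ) 1) : |deriv (deriv (X t)) θ| ≤ curvBound a A B := by
  have hf := h.abs_flux_le ht hθ
  obtain ⟨hp1, hp2⟩ := h.deriv_mem ht hθ
  have ha := h.a_pos
  have hA := h.A_pos
  have hp0 : 0 < deriv (X t) θ := by linarith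
  have h1 := h.density.lower (X t θ)
  have h3 := (h.density.d1 (X t θ)).trans h.eps_le
  set p := deriv (X t) θ
  set r := deriv (deriv (X t)) θ
  have e2 : |1 / 6 * deriv ρ (X t θ) * p ^ 3| ≤ 1 / 6 * 1 * (3 * A) ^ 3 := by
    rw [abs_mul, abs_mul, abs_of_nonneg (by norm_num : (0 : ℝ) ≤ 1 / 6),
      abs_of_pos (by positivity : 0 < p ^ 3)]
    gcongr
  have e3 : |1 / 2 * ρ (X t θ) * p * r| ≤ speedBound a A B + 1 / 6 * 1 * (3 * A) ^ 3 := by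
    have : 1 / 2 * ρ (X t θ) * p * r = flux ρ (X t θ) p r - 1 / 6 * deriv ρ (X t θ) * p ^ 3 := by
      unfold flux; ring
    rw [this]
    exact (abs_sub _ _).trans (add_le_add hf e2)
  have e4 : 1 / 2 * (1 / 2) * (a / 3) * |r| ≤ |1 / 2 * ρ (X t θ) * p * r| := by
    rw [abs_mul, abs_of_pos (by positivity : 0 < 1 / 2 * ρ (X t θ) * p)]
    gcongr
  unfold curvBound
  rw [div_mul_eq_mul_div, le_div_iff₀ ha]
  have : 0 < A ^ 3 := by positivity
  nlinarith

end RegularFlow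

theorem max_touching {V g g1 : ℝ → ℝ} {g2 x : ℝ} (hV : ContDiff ℝ 2 V) (hg : ContDiff ℝ 2 g)
    (hg1 : ∀ y, HasDerivAt g (g1 y) y) (hg2 : HasDerivAt g1 g2 x)
    (h : IsLocalMax (fun y => V y - g y) x) : deriv V x = g1 x ∧ deriv (deriv V) x ≤ g2 := by
  have key := deriv_deriv_nonpos_of_isLocalMax (hV.sub hg) h
  have e1 : (deriv fun y => V y - g y) = fun y => deriv V y - g1 y := funext fun y =>
    ((hV.differentiable (by norm_num) y).hasDerivAt.fun_sub (hg1 y)).deriv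
  have e2 : deriv (fun y => deriv V y - g1 y) x = deriv (deriv V) x - g2 :=
    ((hV.differentiable_deriv_two x).hasDerivAt.fun_sub hg2).deriv
  rw [e1, e2] at key
  constructor <;> linarith [key.1, key.2]

theorem min_touching {V g g1 : ℝ → ℝ} {g2 x : ℝ} (hV : ContDiff ℝ 2 V) (hg : ContDiff ℝ 2 g)
    (hg1 : ∀ y, HasDerivAt g (g1 y) y) (hg2 : HasDerivAt g1 g2 x)
    (h : IsLocalMin (fun y => V y - g y) x) : deriv V x = g1 x ∧ g2 ≤ deriv (deriv V) x := by
  have key := deriv_deriv_nonneg_of_isLocalMin (hV.sub hg) h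
  have e1 : (deriv fun y => V y - g y) = fun y => deriv V y - g1 y := funext fun y =>
    ((hV.differentiable (by norm_num) y).hasDerivAt.fun_sub (hg1 y)).deriv
  have e2 : deriv (fun y => deriv V y - g1 y) x = deriv (deriv V) x - g2 :=
    ((hV.differentiable_deriv_two x).hasDerivAt.fun_sub hg2).deriv
  rw [e1, e2] at key
  constructor <;> linarith [key.1, key.2]

/-- Doubling of variables: Lipschitz bounds for solutions of parabolic inequalities that vanish at
the end points. -/
theorem doubling_bound {E e : ℝ → ℝ → ℝ} {S k k' : ℝ → ℝ} {α B M T : ℝ} (hα : 0 < α) (hB : 0 ≤ B)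
    (hM : 0 ≤ M) (hT : 0 ≤ T) (hkc : ContinuousOn k (Icc 0 T)) (hk : ∀ t ∈ Icc 0 T, 0 ≤ k t)
    (hk' : ∀ t ∈ Ioc 0 T, 0 ≤ k' t ∧ HasDerivAt k (k' t) t)
    (hc : ContinuousOn (fun q : ℝ × ℝ => E q.1 q.2) (Icc 0 T ×ˢ Icc 0 1))
    (hreg : ∀ t ∈ Ioc 0 T, ContDiff ℝ 2 (E t))
    (hd : ∀ t ∈ Ioc 0 T, ∀ θ ∈ Icc (0 : ℝ) 1, HasDerivAt (fun s => E s θ) (e t θ) t)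
    (he0 : ∀ t ∈ Ioc 0 T, e t 0 = 0) (he1 : ∀ t ∈ Ioc 0 T, e t 1 = 0) (hS0 : S 0 = 0)
    (hS1 : S 1 = 0)
    (hS : ∀ x y, 0 ≤ x → x ≤ y → y ≤ 1 → S y - S x ≤ M * (y - x))
    (heq : ∀ t ∈ Ioc 0 T, ∀ θ ∈ Ioo (0 : ℝ) 1, ∃ c, α ≤ c ∧
      |e t θ - c * deriv (deriv (E t)) θ - k' t * S θ| ≤ B * |deriv (E t) θ| + M * k t)
    (hi : ∀ x y, 0 ≤ x → x ≤ y → y ≤ 1 → E 0 y - E 0 x ≤ M * k 0 * (y - x)) :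
    ∀ t ∈ Icc 0 T, ∀ x y, 0 ≤ x → x ≤ y → y ≤ 1 →
      E t y - E t x ≤ M * Real.exp ((B + 1) / α) * k t * (y - x) := by
  set lam := (B + 1) / α with hlam
  have hlam0 : 0 < lam := by positivity
  have hlamα : lam * α = B + 1 := by rw [hlam]; field_simp
  set κ := M * Real.exp lam / lam with hκ
  have hκ0 : 0 ≤ κ := by positivity
  have hκlam : κ * lam = M * Real.exp lam := by rw [hκ]; field_simp
  have hω : ∀ s, 0 ≤ s → s ≤ 1 → M * s ≤ κ * (1 - Real.exp (-(lam * s))) := by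
    intro s h0 h1
    have h2 : lam * s * Real.exp (-(lam * s)) ≤ 1 - Real.exp (-(lam * s)) := by
      have := Real.add_one_le_exp (lam * s)
      have h3 := Real.exp_pos (-(lam * s))
      have h4 : Real.exp (lam * s) * Real.exp (-(lam * s)) = 1 := by
        rw [← Real.exp_add]; simp
      nlinarith
    have h5 : 1 ≤ Real.exp lam * Real.exp (-(lam * s)) := by
      rw [← Real.exp_add]
      exact Real.one_le_exp (by nlinarith)
    calc M * s ≤ M * s * (Real.exp lam * Real.exp (-(lam * s))) :=
          le_mul_of_one_le_right (by positivity) h5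
      _ = κ * (lam * s * Real.exp (-(lam * s))) := by
        linear_combination (- s * Real.exp (-(lam * s))) * hκlam
      _ ≤ _ := by gcongr
  have key := max_principle (K := ℝ × ℝ) isCompact_pairs
    (Φ := fun t q => E t q.2 - E t q.1 - κ * k t * (1 - Real.exp (-(lam * (q.2 - q.1)))))
    (t0 := 0) (t1 := T) ?_ ?_ ?_
  · intro t ht x y h0 hxy h1
    have h2 := key t ht (x, y) ⟨h0, hxy, h1⟩
    have h3 : 1 - Real.exp (-(lam * (y - x))) ≤ lam * (y - x) := by
      linarith [Real.add_one_le_exp (-(lam * (y - x)))]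
    have h4 : κ * k t * (1 - Real.exp (-(lam * (y - x)))) ≤ κ * k t * (lam * (y - x)) :=
      mul_le_mul_of_nonneg_left h3 (mul_nonneg hκ0 (hk t ht))
    simp only at h2
    have h5 : κ * k t * (lam * (y - x)) = M * Real.exp lam * k t * (y - x) := by
      linear_combination k t * (y - x) * hκlam
    linarith
  · refine ((hc.comp (f := fun q : ℝ × ℝ × ℝ => (q.1, q.2.2)) (by fun_prop) ?_).sub
      (hc.comp (f := fun q : ℝ × ℝ × ℝ => (q.1, q.2.1)) (by fun_prop) ?_)).sub
      ((continuousOn_const.mul (hkc.comp (f := fun q : ℝ × ℝ × ℝ => q.1) (by fun_prop) ?_)).mul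
        (by fun_prop))
    · rintro ⟨t, a, b⟩ ⟨ht, h0, hab, h1⟩
      exact ⟨ht, h0.trans hab, h1⟩
    · rintro ⟨t, a, b⟩ ⟨ht, h0, hab, h1⟩
      exact ⟨ht, h0, hab.trans h1⟩
    · rintro ⟨t, a, b⟩ ⟨ht, h0, hab, h1⟩
      exact ht
  · rintro ⟨x, y⟩ ⟨h0, hxy, h1⟩
    simp only at h0 hxy h1 ⊢
    have h2 := hi x y h0 hxy h1
    have h3 := mul_le_mul_of_nonneg_left (hω (y - x) (by linarith) (by linarith))
      (hk 0 ⟨le_rfl, hT⟩)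
    linarith
  · rintro t ht ⟨x, y⟩ ⟨h0, hxy, h1⟩ hpos hm
    simp only at h0 hxy h1 hpos hm
    have ht' := Ioc_subset_Icc_self ht
    have hm' : ∀ x' y', 0 ≤ x' → x' ≤ y' → y' ≤ 1 →
        E t y' - E t x' - κ * k t * (1 - Real.exp (-(lam * (y' - x')))) ≤
          E t y - E t x - κ * k t * (1 - Real.exp (-(lam * (y - x)))) :=
      fun x' y' h h' h'' => hm (x', y') ⟨h, h', h''⟩
    have hlt : x < y := by
      rcases hxy.lt_or_eq with h | h
      · exact h
      · subst h; simp at hpos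
    set w := Real.exp (-(lam * (y - x))) with hw
    have hw0 : 0 < w := Real.exp_pos _
    have hkt := hk t ht'
    have hcw : M * k t ≤ κ * k t * lam * w := by
      have h5 : 1 ≤ Real.exp lam * w := by
        rw [hw, ← Real.exp_add]
        exact Real.one_le_exp (by nlinarith)
      have : κ * k t * lam * w = M * k t * (Real.exp lam * w) := by
        linear_combination k t * w * hκlam
      rw [this]
      exact le_mul_of_one_le_right (by positivity) h5
    have habs : |κ * k t * (lam * w)| = κ * k t * (lam * w) := abs_of_nonneg (by positivity)
    have hcurv : ∀ c, α ≤ c → c * (κ * k t * (lam ^ 2 * w)) ≥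
        (B + 1) * (κ * k t * (lam * w)) := by
      intro c hc
      have h6 : α * (κ * k t * (lam ^ 2 * w)) ≤ c * (κ * k t * (lam ^ 2 * w)) := by gcongr
      have h7 : α * (κ * k t * (lam ^ 2 * w)) = (B + 1) * (κ * k t * (lam * w)) := by
        linear_combination (κ * k t * (lam * w)) * hlamα
      linarith
    have hbound_y : e t y ≤ k' t * S y := by
      rcases h1.lt_or_eq with h | h
      · have hloc : IsLocalMax (fun z => E t z - κ * k t * (1 - Real.exp (-(lam * (z - x))))) y := by
          filter_upwards [Ioo_mem_nhds hlt h] with z hz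
          have := hm' x z h0 hz.1.le hz.2.le
          linarith
        obtain ⟨e1, e2⟩ := max_touching (hreg t ht) (by fun_prop)
          (g1 := fun z => κ * k t * (lam * Real.exp (-(lam * (z - x)))))
          (g2 := κ * k t * (-(lam ^ 2 * w)))
          (fun z => by
            have : HasDerivAt (fun z => -(lam * (z - x))) (-(lam * 1)) z :=
              (((hasDerivAt_id z).sub_const x).const_mul lam).fun_neg
            exact ((this.exp.const_sub 1).const_mul (κ * k t)).congr_deriv (by ring))
          (by
            have : HasDerivAt (fun z => -(lam * (z - x))) (-(lam * 1)) y :=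
              (((hasDerivAt_id y).sub_const x).const_mul lam).fun_neg
            exact ((this.exp.const_mul lam).const_mul (κ * k t)).congr_deriv (by rw [hw]; ring))
          hloc
        obtain ⟨c, hc1, hc2⟩ := heq t ht y ⟨h0.trans_lt hlt, h⟩
        rw [e1, ← hw, habs] at hc2
        have := le_of_abs_le hc2
        have h8 := mul_le_mul_of_nonneg_left e2 (hα.le.trans hc1)
        have h9 := hcurv c hc1
        linarith
      · subst h; rw [he1 t ht, hS1, mul_zero]
    have hbound_x : k' t * S x ≤ e t x := by
      rcases h0.lt_or_eq with h | h
      · have hloc : IsLocalMin (fun z => E t z - (- (κ * k t * (1 - Real.exp (-(lam * (y - z)))))))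
            x := by
          filter_upwards [Ioo_mem_nhds h hlt] with z hz
          have := hm' z y hz.1.le hz.2.le h1
          linarith
        obtain ⟨e1, e2⟩ := min_touching (hreg t ht) (by fun_prop)
          (g1 := fun z => κ * k t * (lam * Real.exp (-(lam * (y - z)))))
          (g2 := κ * k t * (lam ^ 2 * w))
          (fun z => by
            have : HasDerivAt (fun z => -(lam * (y - z))) (-(lam * (-1))) z :=
              (((hasDerivAt_id z).const_sub y).const_mul lam).fun_neg
            exact ((this.exp.const_sub 1).const_mul (κ * k t)).fun_neg.congr_deriv (by ring))
          (by
            have : HasDerivAt (fun z => -(lam * (y - z))) (-(lam * (-1))) x :=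
              (((hasDerivAt_id x).const_sub y).const_mul lam).fun_neg
            exact ((this.exp.const_mul lam).const_mul (κ * k t)).congr_deriv (by rw [hw]; ring))
          hloc
        obtain ⟨c, hc1, hc2⟩ := heq t ht x ⟨h, hlt.trans_le h1⟩
        rw [e1, ← hw, habs] at hc2
        have := neg_le_of_abs_le hc2
        have h8 := mul_le_mul_of_nonneg_left e2 (hα.le.trans hc1)
        have h9 := hcurv c hc1
        linarith
      · rw [← h, he0 t ht, hS0, mul_zero]
    obtain ⟨hk1, hk2⟩ := hk' t ht
    refine ⟨_, ?_, ((hd t ht y ⟨h0.trans hxy, h1⟩).fun_sub (hd t ht x ⟨h0, hxy.trans h1⟩)).fun_sub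
      ((hk2.const_mul κ).mul_const (1 - w))⟩
    have h3 := hω (y - x) (by linarith) (by linarith)
    have h4 := hS x y h0 hxy h1
    have h5 := mul_le_mul_of_nonneg_left (h4.trans h3) hk1
    linarith

theorem abs_sub_le_of_abs_deriv_le {f : ℝ → ℝ} {L : ℝ} (hf : Differentiable ℝ f)
    (h : ∀ x, |deriv f x| ≤ L) (x y : ℝ) : |f x - f y| ≤ L * |x - y| := by
  simpa only [Real.norm_eq_abs] using Convex.norm_image_sub_le_of_norm_deriv_le (𝕜 := ℝ)
    (fun z _ => hf z) (fun z _ => h z) convex_univ (mem_univ y) (mem_univ x)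

theorem abs_sub_le_of_abs_deriv_le_Icc {f : ℝ → ℝ} {L : ℝ} (hf : Differentiable ℝ f)
    (h : ∀ x ∈ Icc (0 : ℝ) 1, |deriv f x| ≤ L) {x y : ℝ} (hx : x ∈ Icc (0 : ℝ) 1)
    (hy : y ∈ Icc (0 : ℝ) 1) : |f x - f y| ≤ L * |x - y| := by
  simpa only [Real.norm_eq_abs] using Convex.norm_image_sub_le_of_norm_deriv_le (𝕜 := ℝ)
    (fun z _ => hf z) h (convex_Icc 0 1) hy hx

theorem abs_mul_le_mul {a b A B : ℝ} (ha : |a| ≤ A) (hb : |b| ≤ B) : |a * b| ≤ A * B := by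
  rw [abs_mul]
  exact mul_le_mul ha hb (abs_nonneg _) ((abs_nonneg _).trans ha)

namespace NiceDensity

variable {ρ : ℝ → ℝ} {ε K : ℝ}

theorem differentiable (h : NiceDensity ρ ε K) : Differentiable ℝ ρ :=
  h.smooth.differentiable (by norm_num)

theorem contDiff_deriv (h : NiceDensity ρ ε K) : ContDiff ℝ 2 (deriv ρ) :=
  ((contDiff_succ_iff_deriv (n := 2)).1 h.smooth).2.2

theorem contDiff_deriv_deriv (h : NiceDensity ρ ε K) : ContDiff ℝ 1 (deriv (deriv ρ)) :=
  ((contDiff_succ_iff_deriv (n := 1)).1 h.contDiff_deriv).2.2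

theorem abs_apply_le (h : NiceDensity ρ ε K) (y : ℝ) : |ρ y| ≤ 3 / 2 :=
  abs_le.2 ⟨by linarith [h.lower y], h.upper y⟩

theorem abs_sub_le (h : NiceDensity ρ ε K) (x y : ℝ) : |ρ x - ρ y| ≤ ε * |x - y| :=
  abs_sub_le_of_abs_deriv_le h.differentiable h.d1 x y

theorem abs_deriv_sub_le (h : NiceDensity ρ ε K) (x y : ℝ) :
    |deriv ρ x - deriv ρ y| ≤ ε * |x - y| :=
  abs_sub_le_of_abs_deriv_le (h.contDiff_deriv.differentiable (by norm_num)) h.d2 x y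

theorem abs_deriv_deriv_sub_le (h : NiceDensity ρ ε K) (x y : ℝ) :
    |deriv (deriv ρ) x - deriv (deriv ρ) y| ≤ K * |x - y| :=
  abs_sub_le_of_abs_deriv_le (h.contDiff_deriv_deriv.differentiable (by norm_num)) h.d3 x y

theorem flux_sub (h : NiceDensity ρ ε K) (hε : ε ≤ 1) {x₁ x₂ p₁ p₂ r₁ r₂ P R : ℝ} (hP : 0 ≤ P)
    (hp₁ : |p₁| ≤ P) (hp₂ : |p₂| ≤ P) (hr₂ : |r₂| ≤ R) :
    |flux ρ x₁ p₁ r₁ - flux ρ x₂ p₂ r₂ - (1 / 2) * ρ x₁ * p₁ * (r₁ - r₂)| ≤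
      (R + P ^ 2) * |p₁ - p₂| + (P * R + P ^ 3) * |x₁ - x₂| := by
  have hR : 0 ≤ R := (abs_nonneg _).trans hr₂
  have a1 : |ρ x₁ - ρ x₂| ≤ |x₁ - x₂| :=
    (h.abs_sub_le x₁ x₂).trans (mul_le_of_le_one_left (abs_nonneg _) hε)
  have a2 : |deriv ρ x₁ - deriv ρ x₂| ≤ |x₁ - x₂| :=
    (h.abs_deriv_sub_le x₁ x₂).trans (mul_le_of_le_one_left (abs_nonneg _) hε)
  have b1 := abs_mul_le_mul (abs_mul_le_mul (h.abs_apply_le x₁) (le_refl |p₁ - p₂|)) hr₂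
  have b2 := abs_mul_le_mul (abs_mul_le_mul a1 hp₂) hr₂
  have b3 : |p₁ ^ 2 + p₁ * p₂ + p₂ ^ 2| ≤ 3 * P ^ 2 := by
    obtain ⟨u1, u2⟩ := abs_le.1 hp₁
    obtain ⟨v1, v2⟩ := abs_le.1 hp₂
    rw [abs_le]
    constructor <;> nlinarith [mul_nonneg (sub_nonneg.2 u2) (sub_nonneg.2 v2),
      mul_nonneg (sub_nonneg.2 u1) (sub_nonneg.2 v1), sq_nonneg (p₁ + p₂),
      mul_nonneg (sub_nonneg.2 u1) (sub_nonneg.2 u2),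
      mul_nonneg (sub_nonneg.2 v1) (sub_nonneg.2 v2),
      mul_nonneg (sub_nonneg.2 u1) (sub_nonneg.2 v2),
      mul_nonneg (sub_nonneg.2 v1) (sub_nonneg.2 u2)]
  have b4 := abs_mul_le_mul ((h.d1 x₁).trans hε) (abs_mul_le_mul (le_refl |p₁ - p₂|) b3)
  have b5 : |(deriv ρ x₁ - deriv ρ x₂) * p₂ ^ 3| ≤ |x₁ - x₂| * P ^ 3 := by
    refine abs_mul_le_mul a2 ?_
    rw [abs_pow]; gcongr
  have e : flux ρ x₁ p₁ r₁ - flux ρ x₂ p₂ r₂ - (1 / 2) * ρ x₁ * p₁ * (r₁ - r₂) =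
      (1 / 2) * (ρ x₁ * (p₁ - p₂) * r₂) + (1 / 2) * ((ρ x₁ - ρ x₂) * p₂ * r₂)
      + (1 / 6) * (deriv ρ x₁ * ((p₁ - p₂) * (p₁ ^ 2 + p₁ * p₂ + p₂ ^ 2)))
      + (1 / 6) * ((deriv ρ x₁ - deriv ρ x₂) * p₂ ^ 3) := by
    unfold flux; ring
  rw [e]
  obtain ⟨c1, c1'⟩ := abs_le.1 b1
  obtain ⟨c2, c2'⟩ := abs_le.1 b2
  obtain ⟨c4, c4'⟩ := abs_le.1 b4
  obtain ⟨c5, c5'⟩ := abs_le.1 b5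
  have n1 : 0 ≤ |p₁ - p₂| * R := by positivity
  have n2 : 0 ≤ |p₁ - p₂| * P ^ 2 := by positivity
  have n3 : 0 ≤ |x₁ - x₂| * P * R := by positivity
  have n4 : 0 ≤ |x₁ - x₂| * P ^ 3 := by positivity
  rw [abs_le]
  constructor <;> nlinarith

end NiceDensity

/-- The speed of a flow at a point. -/
noncomputable def speed (ρ : ℝ → ℝ) (X : ℝ → ℝ → ℝ) (t θ : ℝ) : ℝ :=
  flux ρ (X t θ) (deriv (X t) θ) (deriv (deriv (X t)) θ)

namespace RegularFlow

variable {ρ : ℝ → ℝ} {X : ℝ → ℝ → ℝ} {ε K a A B : ℝ}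

theorem hasDerivAt_time (h : RegularFlow ρ X ε K a A B) {t θ : ℝ} (ht : 0 ≤ t)
    (hθ : θ ∈ Icc (0 : ℝ) 1) : HasDerivAt (fun s => X s θ) (speed ρ X t θ) t :=
  h.flow.pde t ht θ hθ

theorem speed_left (h : RegularFlow ρ X ε K a A B) {t : ℝ} (ht : 0 ≤ t) : speed ρ X t 0 = 0 :=
  hasDerivAt_zero_of_const ht (fun s hs => by rw [h.flow.left s hs, h.flow.left 0 le_rfl])
    (h.hasDerivAt_time ht (by simp))

theorem speed_right (h : RegularFlow ρ X ε K a A B) {t : ℝ} (ht : 0 ≤ t) : speed ρ X t 1 = 0 :=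
  hasDerivAt_zero_of_const ht (fun s hs => by rw [h.flow.right s hs, h.flow.right 0 le_rfl])
    (h.hasDerivAt_time ht (by simp))

/-- Coefficient of the first derivative in the equation for differences of flows. -/
noncomputable def driftBound (a A B : ℝ) : ℝ := curvBound a A B + (3 * A) ^ 2

/-- Coefficient of the zeroth order term in the equation for differences of flows. -/
noncomputable def reactionBound (a A B : ℝ) : ℝ := 3 * A * curvBound a A B + (3 * A) ^ 3

theorem driftBound_nonneg (h : RegularFlow ρ X ε K a A B) : 0 ≤ driftBound a A B := by
  have := h.curvBound_nonneg
  unfold driftBound; positivity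

theorem reactionBound_nonneg (h : RegularFlow ρ X ε K a A B) : 0 ≤ reactionBound a A B := by
  have := h.curvBound_nonneg
  have := h.A_pos
  unfold reactionBound; positivity

theorem abs_deriv_le (h : RegularFlow ρ X ε K a A B) {t θ : ℝ} (ht : 0 ≤ t)
    (hθ : θ ∈ Icc (0 : ℝ) 1) : |deriv (X t) θ| ≤ 3 * A := by
  obtain ⟨h1, h2⟩ := h.deriv_mem ht hθ
  rw [abs_of_nonneg (by linarith [h.a_pos])]
  exact h2

theorem speed_sub (h : RegularFlow ρ X ε K a A B) {t t' x y : ℝ} (ht : 0 ≤ t) (ht' : 0 ≤ t')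
    (hx : x ∈ Icc (0 : ℝ) 1) (hy : y ∈ Icc (0 : ℝ) 1) :
    |speed ρ X t x - speed ρ X t' y - (1 / 2) * ρ (X t x) * deriv (X t) x *
        (deriv (deriv (X t)) x - deriv (deriv (X t')) y)| ≤
      driftBound a A B * |deriv (X t) x - deriv (X t') y| +
        reactionBound a A B * |X t x - X t' y| :=
  h.density.flux_sub h.eps_le (by linarith [h.A_pos]) (h.abs_deriv_le ht hx) (h.abs_deriv_le ht' hy)
    (h.abs_curv_le ht' hy)

theorem ellipticity (h : RegularFlow ρ X ε K a A B) {t x : ℝ} (ht : 0 ≤ t)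
    (hx : x ∈ Icc (0 : ℝ) 1) : a / 12 ≤ (1 / 2) * ρ (X t x) * deriv (X t) x := by
  obtain ⟨h1, h2⟩ := h.deriv_mem ht hx
  nlinarith [h.density.lower (X t x), h.a_pos, mul_nonneg (sub_nonneg.2 (h.density.lower (X t x)))
    (by linarith [h.a_pos] : (0 : ℝ) ≤ deriv (X t) x)]

theorem abs_space_sub_le (h : RegularFlow ρ X ε K a A B) {t x y : ℝ} (ht : 0 ≤ t)
    (hx : x ∈ Icc (0 : ℝ) 1) (hy : y ∈ Icc (0 : ℝ) 1) : |X t x - X t y| ≤ 3 * A * |x - y| :=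
  abs_sub_le_of_abs_deriv_le_Icc ((h.flow.reg t ht).differentiable (by norm_num))
    (fun _ hz => h.abs_deriv_le ht hz) hx hy

theorem abs_deriv_sub_le (h : RegularFlow ρ X ε K a A B) {t x y : ℝ} (ht : 0 ≤ t)
    (hx : x ∈ Icc (0 : ℝ) 1) (hy : y ∈ Icc (0 : ℝ) 1) :
    |deriv (X t) x - deriv (X t) y| ≤ curvBound a A B * |x - y| :=
  abs_sub_le_of_abs_deriv_le_Icc (h.flow.reg t ht).differentiable_deriv_two
    (fun _ hz => h.abs_curv_le ht hz) hx hy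

/-- Lipschitz constant (in space) for the initial speed and the forcing terms. -/
noncomputable def initialSpeedLip (a A B : ℝ) : ℝ :=
  3 * A * B + driftBound a A B * curvBound a A B + reactionBound a A B * (3 * A)
    + reactionBound a A B * speedBound a A B

theorem initialSpeedLip_nonneg (h : RegularFlow ρ X ε K a A B) : 0 ≤ initialSpeedLip a A B := by
  have := h.curvBound_nonneg
  have := h.A_pos
  have := h.B_nonneg
  have := h.driftBound_nonneg
  have := h.reactionBound_nonneg
  have := h.speedBound_nonneg
  unfold initialSpeedLip; positivity

theorem abs_initial_speed_sub_le (h : RegularFlow ρ X ε K a A B) {x y : ℝ}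
    (hx : x ∈ Icc (0 : ℝ) 1) (hy : y ∈ Icc (0 : ℝ) 1) :
    |speed ρ X 0 x - speed ρ X 0 y| ≤ initialSpeedLip a A B * |x - y| := by
  have h1 := h.speed_sub le_rfl le_rfl hx hy
  have h2 : |(1 / 2) * ρ (X 0 x) * deriv (X 0) x *
      (deriv (deriv (X 0)) x - deriv (deriv (X 0)) y)| ≤ 3 / 4 * (3 * A) * (B * |x - y|) := by
    refine abs_mul_le_mul (abs_mul_le_mul ?_ (h.abs_deriv_le le_rfl hx)) (h.curv_lip x hx y hy)
    have := h.density.upper (X 0 x)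
    have := h.density.pos (X 0 x)
    rw [abs_of_nonneg (by positivity)]
    linarith
  have h3 := mul_le_mul_of_nonneg_left (h.abs_deriv_sub_le le_rfl hx hy) h.driftBound_nonneg
  have h4 := mul_le_mul_of_nonneg_left (h.abs_space_sub_le le_rfl hx hy) h.reactionBound_nonneg
  have h5 : 0 ≤ reactionBound a A B * speedBound a A B * |x - y| :=
    mul_nonneg (mul_nonneg h.reactionBound_nonneg h.speedBound_nonneg) (abs_nonneg _)
  have h6 : 0 ≤ A * B * |x - y| :=
    mul_nonneg (mul_nonneg h.A_pos.le h.B_nonneg) (abs_nonneg _)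
  have h7 := abs_add_le (speed ρ X 0 x - speed ρ X 0 y - (1 / 2) * ρ (X 0 x) * deriv (X 0) x *
      (deriv (deriv (X 0)) x - deriv (deriv (X 0)) y)) ((1 / 2) * ρ (X 0 x) * deriv (X 0) x *
      (deriv (deriv (X 0)) x - deriv (deriv (X 0)) y))
  rw [sub_add_cancel] at h7
  unfold initialSpeedLip
  nlinarith

theorem continuousOn_shift_sub (h : RegularFlow ρ X ε K a A B) {s r : ℝ → ℝ} {b σ : ℝ}
    (hs : Continuous s) (hr : Continuous r) (hs0 : ∀ t ∈ Icc 0 b, 0 ≤ s t)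
    (hr0 : ∀ t ∈ Icc 0 b, 0 ≤ r t) :
    ContinuousOn (fun q : ℝ × ℝ => σ * (X (s q.1) q.2 - X (r q.1) q.2)) (Icc 0 b ×ˢ Icc 0 1) :=
  continuousOn_const.mul
    ((h.continuousOn.comp (f := fun q : ℝ × ℝ => (s q.1, q.2)) (by fun_prop)
      (fun q hq => ⟨hs0 _ hq.1, hq.2⟩)).sub
    (h.continuousOn.comp (f := fun q : ℝ × ℝ => (r q.1, q.2)) (by fun_prop)
      (fun q hq => ⟨hr0 _ hq.1, hq.2⟩)))

theorem deriv_const_mul_sub (h : RegularFlow ρ X ε K a A B) {s r σ : ℝ} (hs : 0 ≤ s) (hr : 0 ≤ r) :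
    deriv (fun θ => σ * (X s θ - X r θ)) = fun θ => σ * (deriv (X s) θ - deriv (X r) θ) :=
  funext fun θ => ((((h.flow.reg s hs).differentiable (by norm_num) θ).hasDerivAt.fun_sub
    ((h.flow.reg r hr).differentiable (by norm_num) θ).hasDerivAt).const_mul σ).deriv

theorem deriv_deriv_const_mul_sub (h : RegularFlow ρ X ε K a A B) {s r σ : ℝ} (hs : 0 ≤ s)
    (hr : 0 ≤ r) (θ : ℝ) :
    deriv (deriv (fun θ => σ * (X s θ - X r θ))) θ =
      σ * (deriv (deriv (X s)) θ - deriv (deriv (X r)) θ) := by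
  rw [h.deriv_const_mul_sub hs hr]
  exact ((((h.flow.reg s hs).differentiable_deriv_two θ).hasDerivAt.fun_sub
    ((h.flow.reg r hr).differentiable_deriv_two θ).hasDerivAt).const_mul σ).deriv

theorem initial_difference_slope (h : RegularFlow ρ X ε K a A B) {σ τ : ℝ} (hσ : |σ| = 1)
    (hτ : 0 ≤ τ) : ∀ x y, 0 ≤ x → x ≤ y → y ≤ 1 →
      σ * (X τ y - X 0 y) - σ * (X τ x - X 0 x) ≤
        initialSpeedLip a A B * Real.exp ((driftBound a A B + 1) / (a / 12)) * τ * (y - x) := by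
  have ha := h.a_pos
  have hL := h.initialSpeedLip_nonneg
  refine doubling_bound (E := fun t θ => σ * (X t θ - X 0 θ))
    (e := fun t θ => σ * speed ρ X t θ) (S := fun θ => σ * speed ρ X 0 θ) (k := fun t => t)
    (k' := fun _ => 1) (by positivity) h.driftBound_nonneg hL hτ
    continuousOn_id (fun t ht => ht.1) (fun t ht => ⟨zero_le_one, hasDerivAt_id t⟩)
    (h.continuousOn_shift_sub (s := fun t => t) (r := fun _ => 0) continuous_id
      continuous_const (fun t ht => ht.1) (fun t ht => le_rfl))
    (fun t ht => contDiff_const.mul ((h.flow.reg t ht.1.le).sub (h.flow.reg 0 le_rfl)))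
    (fun t ht θ hθ => ((h.hasDerivAt_time ht.1.le hθ).sub_const _).const_mul σ)
    (fun t ht => by simp only [h.speed_left ht.1.le, mul_zero])
    (fun t ht => by simp only [h.speed_right ht.1.le, mul_zero])
    (by simp only [h.speed_left le_rfl, mul_zero]) (by simp only [h.speed_right le_rfl, mul_zero])
    ?_ ?_ ?_ τ ⟨hτ, le_rfl⟩
  · intro x y h0 hxy h1
    have := h.abs_initial_speed_sub_le (x := y) (y := x) ⟨h0.trans hxy, h1⟩ ⟨h0, hxy.trans h1⟩
    rw [abs_of_nonneg (sub_nonneg.2 hxy)] at this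
    rw [← mul_sub]
    refine (le_abs_self _).trans ?_
    rw [abs_mul, hσ, one_mul]
    exact this
  · intro t ht θ hθ
    have hθ' := Ioo_subset_Icc_self hθ
    refine ⟨_, h.ellipticity ht.1.le hθ', ?_⟩
    rw [h.deriv_deriv_const_mul_sub ht.1.le le_rfl, h.deriv_const_mul_sub ht.1.le le_rfl]
    have h1 := h.speed_sub ht.1.le le_rfl hθ' hθ'
    have h2 := h.abs_time_sub_le le_rfl ht.1.le hθ'
    rw [zero_add] at h2
    have h3 := mul_le_mul_of_nonneg_left h2 h.reactionBound_nonneg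
    have e : σ * speed ρ X t θ - 1 / 2 * ρ (X t θ) * deriv (X t) θ *
        (σ * (deriv (deriv (X t)) θ - deriv (deriv (X 0)) θ)) - 1 * (σ * speed ρ X 0 θ) =
        σ * (speed ρ X t θ - speed ρ X 0 θ - (1 / 2) * ρ (X t θ) * deriv (X t) θ *
        (deriv (deriv (X t)) θ - deriv (deriv (X 0)) θ)) := by ring
    rw [e, abs_mul, abs_mul, hσ, one_mul, one_mul]
    have h4 : reactionBound a A B * speedBound a A B ≤ initialSpeedLip a A B := by
      have := h.curvBound_nonneg
      have := h.A_pos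
      have := h.B_nonneg
      have := h.driftBound_nonneg
      have := h.reactionBound_nonneg
      unfold initialSpeedLip
      have : 0 ≤ 3 * A * B + driftBound a A B * curvBound a A B +
          reactionBound a A B * (3 * A) := by
        positivity
      linarith
    have h5 := mul_le_mul_of_nonneg_right h4 ht.1.le
    linarith
  · intro x y h0 hxy h1
    simp

/-- Lipschitz constant of the speed in space. -/
noncomputable def speedLip (a A B : ℝ) : ℝ :=
  initialSpeedLip a A B * Real.exp ((driftBound a A B + 1) / (a / 12)) *
    Real.exp ((driftBound a A B + 1) / (a / 12))

theorem speedLip_nonneg (h : RegularFlow ρ X ε K a A B) : 0 ≤ speedLip a A B := by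
  have := h.initialSpeedLip_nonneg
  unfold speedLip; positivity

theorem difference_slope (h : RegularFlow ρ X ε K a A B) {σ τ t : ℝ} (hσ : |σ| = 1)
    (hτ : 0 ≤ τ) (ht : 0 ≤ t) : ∀ x y, 0 ≤ x → x ≤ y → y ≤ 1 →
      σ * (X (t + τ) y - X t y) - σ * (X (t + τ) x - X t x) ≤ speedLip a A B * τ * (y - x) := by
  have ha := h.a_pos
  have hL := h.initialSpeedLip_nonneg
  have hexp : 1 ≤ Real.exp ((driftBound a A B + 1) / (a / 12)) := by
    have := h.driftBound_nonneg
    exact Real.one_le_exp (by positivity)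
  refine doubling_bound (E := fun t θ => σ * (X (t + τ) θ - X t θ))
    (e := fun t θ => σ * (speed ρ X (t + τ) θ - speed ρ X t θ)) (S := fun θ => 0) (k := fun _ => τ)
    (k' := fun _ => 0) (M := initialSpeedLip a A B * Real.exp ((driftBound a A B + 1) / (a / 12)))
    (by positivity) h.driftBound_nonneg (by positivity) ht
    continuousOn_const (fun t ht => hτ) (fun t ht => ⟨le_rfl, hasDerivAt_const t τ⟩)
    (h.continuousOn_shift_sub (s := fun t => t + τ) (r := fun t => t) (by fun_prop)
      continuous_id (fun t ht => add_nonneg ht.1 hτ) (fun t ht => ht.1))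
    (fun t ht => contDiff_const.mul
      ((h.flow.reg _ (add_nonneg ht.1.le hτ)).sub (h.flow.reg t ht.1.le)))
    (fun t ht θ hθ => (((h.hasDerivAt_time (add_nonneg ht.1.le hτ) hθ).comp_add_const t τ).fun_sub
      (h.hasDerivAt_time ht.1.le hθ)).const_mul σ)
    (fun t ht => by simp only [h.speed_left ht.1.le, h.speed_left (add_nonneg ht.1.le hτ), sub_self,
      mul_zero])
    (fun t ht => by simp only [h.speed_right ht.1.le, h.speed_right (add_nonneg ht.1.le hτ),
      sub_self, mul_zero])
    rfl rfl ?_ ?_ ?_ t ⟨ht, le_rfl⟩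
  · intro x y h0 hxy h1
    have : 0 ≤ y - x := by linarith
    rw [sub_self]; positivity
  · intro t ht θ hθ
    have hθ' := Ioo_subset_Icc_self hθ
    have ht2 := add_nonneg ht.1.le hτ
    refine ⟨_, h.ellipticity ht2 hθ', ?_⟩
    rw [h.deriv_deriv_const_mul_sub ht2 ht.1.le, h.deriv_const_mul_sub ht2 ht.1.le]
    have h1 := h.speed_sub ht2 ht.1.le hθ' hθ'
    have h2 := h.abs_time_sub_le ht.1.le hτ hθ'
    have h3 := mul_le_mul_of_nonneg_left h2 h.reactionBound_nonneg
    have e : σ * (speed ρ X (t + τ) θ - speed ρ X t θ) -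
        1 / 2 * ρ (X (t + τ) θ) * deriv (X (t + τ)) θ *
        (σ * (deriv (deriv (X (t + τ))) θ - deriv (deriv (X t)) θ)) - 0 * 0 =
        σ * (speed ρ X (t + τ) θ - speed ρ X t θ - (1 / 2) * ρ (X (t + τ) θ) *
        deriv (X (t + τ)) θ * (deriv (deriv (X (t + τ))) θ - deriv (deriv (X t)) θ)) := by ring
    rw [e, abs_mul, abs_mul, hσ, one_mul, one_mul]
    have h4 : reactionBound a A B * speedBound a A B ≤ initialSpeedLip a A B := by
      have := h.curvBound_nonneg
      have := h.A_pos
      have := h.B_nonneg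
      have := h.driftBound_nonneg
      have := h.reactionBound_nonneg
      unfold initialSpeedLip
      have : 0 ≤ 3 * A * B + driftBound a A B * curvBound a A B +
          reactionBound a A B * (3 * A) := by
        positivity
      linarith
    have h5 := mul_le_mul_of_nonneg_right (h4.trans (le_mul_of_one_le_right hL hexp)) hτ
    linarith
  · intro x y h0 hxy h1
    simp only [zero_add]
    exact h.initial_difference_slope hσ hτ x y h0 hxy h1

theorem abs_speed_sub_le (h : RegularFlow ρ X ε K a A B) {t x y : ℝ} (ht : 0 ≤ t)
    (hx : x ∈ Icc (0 : ℝ) 1) (hy : y ∈ Icc (0 : ℝ) 1) :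
    |speed ρ X t x - speed ρ X t y| ≤ speedLip a A B * |x - y| := by
  wlog hxy : x ≤ y generalizing x y
  · rw [abs_sub_comm, abs_sub_comm x]
    exact this hy hx (le_of_not_ge hxy)
  have key : ∀ σ : ℝ, |σ| = 1 →
      σ * (speed ρ X t y - speed ρ X t x) ≤ speedLip a A B * (y - x) := by
    intro σ hσ
    have h1 := ((h.hasDerivAt_time ht hy).fun_sub (h.hasDerivAt_time ht hx)).const_mul σ
    refine le_of_tendsto h1.tendsto_slope_zero_right ?_
    filter_upwards [self_mem_nhdsWithin] with τ hτ
    replace hτ : 0 < τ := hτ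
    have h2 := h.difference_slope hσ hτ.le ht x y hx.1 hxy hy.2
    rw [smul_eq_mul, inv_mul_le_iff₀ hτ]
    linarith
  have k1 := key 1 (by simp)
  have k2 := key (-1) (by simp)
  rw [abs_sub_comm, abs_sub_comm x, abs_of_nonneg (sub_nonneg.2 hxy), abs_le]
  constructor <;> linarith

/-- Lipschitz constant of the second derivative in space. -/
noncomputable def curvLip (a A B : ℝ) : ℝ :=
  12 / a * (speedLip a A B + driftBound a A B * curvBound a A B + reactionBound a A B * (3 * A))

theorem curvLip_nonneg (h : RegularFlow ρ X ε K a A B) : 0 ≤ curvLip a A B := by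
  have := h.speedLip_nonneg
  have := h.curvBound_nonneg
  have := h.A_pos
  have := h.a_pos
  have := h.driftBound_nonneg
  have := h.reactionBound_nonneg
  unfold curvLip; positivity

theorem abs_curv_sub_le (h : RegularFlow ρ X ε K a A B) {t x y : ℝ} (ht : 0 ≤ t)
    (hx : x ∈ Icc (0 : ℝ) 1) (hy : y ∈ Icc (0 : ℝ) 1) :
    |deriv (deriv (X t)) x - deriv (deriv (X t)) y| ≤ curvLip a A B * |x - y| := by
  have ha := h.a_pos
  have h1 := h.speed_sub ht ht hx hy
  have h2 := h.abs_speed_sub_le ht hx hy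
  have h3 := mul_le_mul_of_nonneg_left (h.abs_deriv_sub_le ht hx hy) h.driftBound_nonneg
  have h4 := mul_le_mul_of_nonneg_left (h.abs_space_sub_le ht hx hy) h.reactionBound_nonneg
  have h5 := h.ellipticity ht hx
  set c := (1 / 2) * ρ (X t x) * deriv (X t) x
  set r := deriv (deriv (X t)) x - deriv (deriv (X t)) y
  set s := speed ρ X t x - speed ρ X t y
  have h6 : |c * r| ≤ |s| + |s - c * r| := by
    have := abs_sub s (s - c * r)
    rwa [sub_sub_cancel] at this
  have h7 : a / 12 * |r| ≤ |c * r| := by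
    rw [abs_mul]
    exact mul_le_mul_of_nonneg_right (h5.trans (le_abs_self c)) (abs_nonneg r)
  unfold curvLip
  rw [div_mul_eq_mul_div, div_mul_eq_mul_div, le_div_iff₀ ha]
  nlinarith

end RegularFlow

theorem abs_taylor_one_le {f f' : ℝ → ℝ} {L x y : ℝ} {s : Set ℝ} (hs : Convex ℝ s)
    (hf : ∀ z ∈ s, HasDerivAt f (f' z) z) (hL : ∀ z ∈ s, |f' z - f' x| ≤ L * |z - x|)
    (hL0 : 0 ≤ L) (hx : x ∈ s) (hy : y ∈ s) : |f y - f x - f' x * (y - x)| ≤ L * |y - x| ^ 2 := by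
  have hseg : segment ℝ x y ⊆ s := hs.segment_subset hx hy
  have key := Convex.norm_image_sub_le_of_norm_hasDerivWithin_le (𝕜 := ℝ)
    (f := fun z => f z - f' x * z) (f' := fun z => f' z - f' x) (s := segment ℝ x y)
    (C := L * |y - x|) (fun z hz => ((hf z (hseg hz)).fun_sub
      (by simpa using (hasDerivAt_id z).const_mul (f' x))).hasDerivWithinAt)
    (fun z hz => (hL z (hseg hz)).trans (mul_le_mul_of_nonneg_left ?_ hL0))
    (convex_segment x y) (left_mem_segment ℝ x y) (right_mem_segment ℝ x y)
  · rw [Real.norm_eq_abs, Real.norm_eq_abs] at key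
    rw [show f y - f x - f' x * (y - x) = f y - f' x * y - (f x - f' x * x) by ring]
    linarith [key, sq (|y - x|)]
  · have := norm_sub_le_of_mem_segment hz
    rwa [Real.norm_eq_abs, Real.norm_eq_abs] at this

theorem abs_taylor_two_le {f f' f'' : ℝ → ℝ} {L x y : ℝ} {s : Set ℝ} (hs : Convex ℝ s)
    (hf : ∀ z ∈ s, HasDerivAt f (f' z) z) (hf' : ∀ z ∈ s, HasDerivAt f' (f'' z) z)
    (hL : ∀ z ∈ s, |f'' z - f'' x| ≤ L * |z - x|)
    (hL0 : 0 ≤ L) (hx : x ∈ s) (hy : y ∈ s) :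
    |f y - f x - f' x * (y - x) - f'' x / 2 * (y - x) ^ 2| ≤ L * |y - x| ^ 3 := by
  have hseg : segment ℝ x y ⊆ s := hs.segment_subset hx hy
  have key := Convex.norm_image_sub_le_of_norm_hasDerivWithin_le (𝕜 := ℝ)
    (f := fun z => f z - f' x * (z - x) - f'' x / 2 * (z - x) ^ 2)
    (f' := fun z => f' z - f' x - f'' x * (z - x)) (s := segment ℝ x y)
    (C := L * |y - x| ^ 2) (fun z hz => ?_) (fun z hz => ?_)
    (convex_segment x y) (left_mem_segment ℝ x y) (right_mem_segment ℝ x y)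
  · rw [Real.norm_eq_abs, Real.norm_eq_abs] at key
    simp only [sub_self, mul_zero] at key
    rw [show f y - f x - f' x * (y - x) - f'' x / 2 * (y - x) ^ 2 =
      f y - f' x * (y - x) - f'' x / 2 * (y - x) ^ 2 - (f x - 0 - f'' x / 2 * 0 ^ 2) by ring]
    linarith [key, pow_succ (|y - x|) 2]
  · have h1 : HasDerivAt (fun z => z - x) 1 z := (hasDerivAt_id z).sub_const x
    exact (((hf z (hseg hz)).fun_sub (h1.const_mul (f' x))).fun_sub
      ((h1.fun_pow 2).const_mul (f'' x / 2))).hasDerivWithinAt.congr_deriv (by simp; ring)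
  · have h1 := norm_sub_le_of_mem_segment hz
    rw [Real.norm_eq_abs, Real.norm_eq_abs] at h1
    refine (abs_taylor_one_le hs hf' hL hL0 hx (hseg hz)).trans ?_
    gcongr

/-- The half cell moment of `ρ`, in rescaled variables. -/
noncomputable def kern (ρ : ℝ → ℝ) (p q : ℝ) : ℝ :=
  ∫ s in (0 : ℝ)..(1 / 2), s * ρ ((1 - s) * p + s * q)

theorem halfCell_eq (ρ : ℝ → ℝ) (u w : ℝ) :
    ∫ z in u..(u + w) / 2, (z - u) * ρ z = (w - u) ^ 2 * kern ρ u w := by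
  have h : (w - u) * ∫ s in (0 : ℝ)..(1 / 2), ((w - u) * s + u - u) * ρ ((w - u) * s + u) =
      ∫ z in (w - u) * 0 + u..(w - u) * (1 / 2) + u, (z - u) * ρ z :=
    intervalIntegral.mul_integral_comp_mul_add (f := fun z => (z - u) * ρ z) ..
  rw [show (w - u) * 0 + u = u by ring, show (w - u) * (1 / 2) + u = (u + w) / 2 by ring] at h
  rw [← h, kern, sq, mul_assoc, ← intervalIntegral.integral_const_mul (w - u) fun s => s * _]
  congr 1
  refine intervalIntegral.integral_congr fun s _ => ?_
  rw [show (1 - s) * u + s * w = (w - u) * s + u by ring]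
  ring

theorem integral_id_half : ∫ s in (0 : ℝ)..(1 / 2), s = 1 / 8 := by
  rw [integral_id]; norm_num

theorem abs_weighted_integral_le {F : ℝ → ℝ} {C : ℝ} (hF : ∀ s ∈ Icc (0 : ℝ) (1 / 2), |F s| ≤ C) :
    |∫ s in (0 : ℝ)..(1 / 2), s * F s| ≤ C / 8 := by
  have h := intervalIntegral.norm_integral_le_of_norm_le (μ := volume) (f := fun s => s * F s)
    (g := fun s => s * C) (a := 0) (b := 1 / 2) (by norm_num)
    (Filter.Eventually.of_forall fun s hs => by
      rw [Real.norm_eq_abs, abs_mul, abs_of_nonneg hs.1.le]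
      exact mul_le_mul_of_nonneg_left (hF s ⟨hs.1.le, hs.2⟩) hs.1.le)
    (Continuous.intervalIntegrable (by fun_prop) _ _)
  rw [Real.norm_eq_abs, intervalIntegral.integral_mul_const, integral_id_half] at h
  linarith

namespace NiceDensity

variable {ρ : ℝ → ℝ} {ε K : ℝ}

theorem continuous (h : NiceDensity ρ ε K) : Continuous ρ := h.differentiable.continuous

theorem eps_nonneg (h : NiceDensity ρ ε K) : 0 ≤ ε := (abs_nonneg _).trans (h.d1 0)

theorem const_nonneg (h : NiceDensity ρ ε K) : 0 ≤ K := (abs_nonneg _).trans (h.d3 0)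

theorem intervalIntegrable_kern (h : NiceDensity ρ ε K) (p q : ℝ) :
    IntervalIntegrable (fun s => s * ρ ((1 - s) * p + s * q)) volume 0 (1 / 2) := by
  have := h.continuous
  exact Continuous.intervalIntegrable (by fun_prop) _ _

theorem kern_bounds (h : NiceDensity ρ ε K) (p q : ℝ) :
    1 / 16 ≤ kern ρ p q ∧ kern ρ p q ≤ 3 / 16 := by
  have e : ∀ c : ℝ, ∫ s in (0 : ℝ)..(1 / 2), s * c = c / 8 := fun c => by
    rw [intervalIntegral.integral_mul_const, integral_id_half]; ring
  have hi := fun c : ℝ => Continuous.intervalIntegrable (μ := volume)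
    (by fun_prop : Continuous fun s : ℝ => s * c) 0 (1 / 2)
  constructor
  · have := intervalIntegral.integral_mono_on (by norm_num) (hi (1 / 2))
      (h.intervalIntegrable_kern p q)
      (fun s hs => mul_le_mul_of_nonneg_left (h.lower ((1 - s) * p + s * q)) hs.1)
    rw [e] at this
    unfold kern; linarith
  · have := intervalIntegral.integral_mono_on (by norm_num) (h.intervalIntegrable_kern p q)
      (hi (3 / 2)) (fun s hs => mul_le_mul_of_nonneg_left (h.upper ((1 - s) * p + s * q)) hs.1)
    rw [e] at this
    unfold kern; linarith

theorem abs_kern_sub_le (h : NiceDensity ρ ε K) (p q p' q' : ℝ) :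
    |kern ρ p q - kern ρ p' q'| ≤ ε * (|p - p'| + |q - q'|) / 8 := by
  unfold kern
  rw [← intervalIntegral.integral_sub (h.intervalIntegrable_kern p q)
    (h.intervalIntegrable_kern p' q')]
  simp only [← mul_sub]
  refine abs_weighted_integral_le fun s hs => (h.abs_sub_le _ _).trans ?_
  refine mul_le_mul_of_nonneg_left ?_ h.eps_nonneg
  rw [show (1 - s) * p + s * q - ((1 - s) * p' + s * q') = (1 - s) * (p - p') +
      s * (q - q') by ring]
  refine (abs_add_le _ _).trans ?_
  rw [abs_mul, abs_mul, abs_of_nonneg hs.1, abs_of_nonneg (by linarith [hs.2] : (0 : ℝ) ≤ 1 - s)]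
  nlinarith [abs_nonneg (p - p'), abs_nonneg (q - q'), hs.1, hs.2]

theorem kern_add (h : NiceDensity ρ ε K) (p q : ℝ) : kern ρ p q + kern ρ q p =
    ∫ s in (0 : ℝ)..(1 / 2), s * (ρ ((p + q) / 2 - (1 / 2 - s) * (q - p)) +
      ρ ((p + q) / 2 + (1 / 2 - s) * (q - p))) := by
  unfold kern
  rw [← intervalIntegral.integral_add (h.intervalIntegrable_kern p q)
    (h.intervalIntegrable_kern q p)]
  refine intervalIntegral.integral_congr fun s _ => ?_
  rw [mul_add, show (p + q) / 2 - (1 / 2 - s) * (q - p) = (1 - s) * p + s * q by ring,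
    show (p + q) / 2 + (1 / 2 - s) * (q - p) = (1 - s) * q + s * p by ring]

theorem kern_sub (h : NiceDensity ρ ε K) (p q : ℝ) : kern ρ p q - kern ρ q p =
    ∫ s in (0 : ℝ)..(1 / 2), s * (ρ ((p + q) / 2 - (1 / 2 - s) * (q - p)) -
      ρ ((p + q) / 2 + (1 / 2 - s) * (q - p))) := by
  unfold kern
  rw [← intervalIntegral.integral_sub (h.intervalIntegrable_kern p q)
    (h.intervalIntegrable_kern q p)]
  refine intervalIntegral.integral_congr fun s _ => ?_
  rw [mul_sub, show (p + q) / 2 - (1 / 2 - s) * (q - p) = (1 - s) * p + s * q by ring,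
    show (p + q) / 2 + (1 / 2 - s) * (q - p) = (1 - s) * q + s * p by ring]

theorem abs_kern_antisymm_le (h : NiceDensity ρ ε K) (p q : ℝ) :
    |kern ρ p q - kern ρ q p| ≤ ε * |q - p| / 8 := by
  rw [h.kern_sub]
  refine abs_weighted_integral_le fun s hs => (h.abs_sub_le _ _).trans ?_
  refine mul_le_mul_of_nonneg_left ?_ h.eps_nonneg
  rw [show (p + q) / 2 - (1 / 2 - s) * (q - p) - ((p + q) / 2 + (1 / 2 - s) * (q - p)) =
    -((1 - 2 * s) * (q - p)) by ring, abs_neg, abs_mul,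
    abs_of_nonneg (by linarith [hs.2] : (0 : ℝ) ≤ 1 - 2 * s)]
  nlinarith [abs_nonneg (q - p), hs.1]

theorem abs_kern_antisymm_sub_le (h : NiceDensity ρ ε K) (p q p' q' : ℝ) :
    |(kern ρ p q - kern ρ q p) - (kern ρ p' q' - kern ρ q' p')| ≤
      ε * (|(q - p) - (q' - p')| + |q' - p'| * |(p + q) / 2 - (p' + q') / 2|) / 8 := by
  have hc := h.continuous
  rw [h.kern_sub, h.kern_sub, ← intervalIntegral.integral_sub
    (Continuous.intervalIntegrable (by fun_prop) _ _)
    (Continuous.intervalIntegrable (by fun_prop) _ _)]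
  simp only [← mul_sub]
  refine abs_weighted_integral_le fun s hs => ?_
  set m := (p + q) / 2
  set m' := (p' + q') / 2
  set d := q - p
  set d' := q' - p'
  set v := 1 / 2 - s with hv
  have hv0 : 0 ≤ v := by linarith [hs.2]
  have hv1 : 2 * v ≤ 1 := by linarith [hs.1]
  have hε := h.eps_nonneg
  have b1 := h.abs_sub_le (m - v * d) (m - v * d')
  have b2 := h.abs_sub_le (m + v * d') (m + v * d)
  rw [show m - v * d - (m - v * d') = -(v * (d - d')) by ring, abs_neg, abs_mul,
    abs_of_nonneg hv0] at b1
  rw [show m + v * d' - (m + v * d) = -(v * (d - d')) by ring, abs_neg, abs_mul,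
    abs_of_nonneg hv0] at b2
  have hdz : ∀ z, HasDerivAt (fun z => ρ (z - v * d') - ρ (z + v * d'))
      (deriv ρ (z - v * d') - deriv ρ (z + v * d')) z := fun z =>
    ((h.differentiable _).hasDerivAt.comp_sub_const z _).fun_sub
      ((h.differentiable _).hasDerivAt.comp_add_const z _)
  have b3 := abs_sub_le_of_abs_deriv_le (f := fun z => ρ (z - v * d') - ρ (z + v * d'))
    (L := ε * (2 * v * |d'|)) (fun z => (hdz z).differentiableAt) (fun z => by
      rw [(hdz z).deriv]
      refine (h.abs_deriv_sub_le _ _).trans (le_of_eq ?_)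
      rw [show z - v * d' - (z + v * d') = -(2 * v * d') by ring, abs_neg, abs_mul,
        abs_of_nonneg (by linarith : (0 : ℝ) ≤ 2 * v)]) m m'
  have c1 : 2 * v * (ε * |d - d'|) ≤ ε * |d - d'| :=
    mul_le_of_le_one_left (by positivity) hv1
  have c2 : 2 * v * (ε * (|d'| * |m - m'|)) ≤ ε * (|d'| * |m - m'|) :=
    mul_le_of_le_one_left (by positivity) hv1
  obtain ⟨k1, k1'⟩ := abs_le.1 b1
  obtain ⟨k2, k2'⟩ := abs_le.1 b2
  obtain ⟨k3, k3'⟩ := abs_le.1 b3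
  rw [abs_le]
  constructor <;> linarith

theorem abs_kern_add_sub_le (h : NiceDensity ρ ε K) (p q : ℝ) :
    |kern ρ p q + kern ρ q p - ρ ((p + q) / 2) / 4| ≤ ε * (q - p) ^ 2 / 8 := by
  have hc := h.continuous
  set m := (p + q) / 2 with hm
  have e : ρ m / 4 = ∫ s in (0 : ℝ)..(1 / 2), s * (2 * ρ m) := by
    rw [intervalIntegral.integral_mul_const, integral_id_half]; ring
  rw [h.kern_add, e, ← hm, ← intervalIntegral.integral_sub
    (Continuous.intervalIntegrable (by fun_prop) _ _)
    (Continuous.intervalIntegrable (by fun_prop) _ _)]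
  simp only [← mul_sub]
  refine abs_weighted_integral_le fun s hs => ?_
  set d := q - p with hd
  have key : ∀ y, |ρ y - ρ m - deriv ρ m * (y - m)| ≤ ε * |y - m| ^ 2 := fun y =>
    abs_taylor_one_le (f' := deriv ρ) convex_univ (fun z _ => (h.differentiable z).hasDerivAt)
      (fun z _ => h.abs_deriv_sub_le z m) h.eps_nonneg (mem_univ m) (mem_univ y)
  have k1 := key (m - (1 / 2 - s) * d)
  have k2 := key (m + (1 / 2 - s) * d)
  rw [sq_abs] at k1 k2
  obtain ⟨k1, k1'⟩ := abs_le.1 k1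
  obtain ⟨k2, k2'⟩ := abs_le.1 k2
  have k3 : (m - (1 / 2 - s) * d - m) ^ 2 ≤ d ^ 2 / 4 := by
    have : (m - (1 / 2 - s) * d - m) ^ 2 = d ^ 2 / 4 - s * (1 - s) * d ^ 2 := by ring
    have : 0 ≤ s * (1 - s) * d ^ 2 :=
      mul_nonneg (mul_nonneg hs.1 (by linarith [hs.2])) (sq_nonneg d)
    linarith
  have k4 : (m + (1 / 2 - s) * d - m) ^ 2 ≤ d ^ 2 / 4 := by
    rw [show (m + (1 / 2 - s) * d - m) ^ 2 = (m - (1 / 2 - s) * d - m) ^ 2 by ring]; exact k3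
  have k5 := mul_le_mul_of_nonneg_left k3 h.eps_nonneg
  have k6 := mul_le_mul_of_nonneg_left k4 h.eps_nonneg
  have k7 := mul_nonneg h.eps_nonneg (sq_nonneg d)
  rw [abs_le]
  constructor <;> linarith

theorem abs_kern_antisymm_add_le (h : NiceDensity ρ ε K) (p q : ℝ) :
    |kern ρ p q - kern ρ q p + deriv ρ ((p + q) / 2) * (q - p) / 24| ≤ K * |q - p| ^ 3 / 8 := by
  have hc := h.continuous
  set m := (p + q) / 2 with hm
  set d := q - p with hd
  have e : deriv ρ m * d / 24 = ∫ s in (0 : ℝ)..(1 / 2), s * ((1 - 2 * s) * (deriv ρ m * d)) := by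
    simp only [← mul_assoc]
    rw [intervalIntegral.integral_mul_const, intervalIntegral.integral_mul_const]
    have : ∫ s in (0 : ℝ)..(1 / 2), s * (1 - 2 * s) = 1 / 24 := by
      have h2 : ∀ s ∈ uIcc (0 : ℝ) (1 / 2), HasDerivAt (fun s : ℝ => s ^ 2 / 2 - 2 / 3 * s ^ 3)
          (s * (1 - 2 * s)) s := fun s _ =>
        (((hasDerivAt_pow 2 s).div_const 2).fun_sub ((hasDerivAt_pow 3 s).const_mul (2 / 3))).congr_deriv
          (by push_cast; ring)
      rw [intervalIntegral.integral_eq_sub_of_hasDerivAt h2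
        (Continuous.intervalIntegrable (by fun_prop) _ _)]
      norm_num
    rw [this]; ring
  rw [h.kern_sub, e, ← hm, ← hd, ← intervalIntegral.integral_add
    (Continuous.intervalIntegrable (by fun_prop) _ _)
    (Continuous.intervalIntegrable (by fun_prop) _ _)]
  simp only [← mul_add]
  refine abs_weighted_integral_le fun s hs => ?_
  have key : ∀ y, |ρ y - ρ m - deriv ρ m * (y - m) - deriv (deriv ρ) m / 2 * (y - m) ^ 2| ≤
      K * |y - m| ^ 3 := fun y =>
    abs_taylor_two_le (f' := deriv ρ) convex_univ (fun z _ => (h.differentiable z).hasDerivAt)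
      (fun z _ => (h.contDiff_deriv.differentiable (by norm_num) z).hasDerivAt)
      (fun z _ => h.abs_deriv_deriv_sub_le z m) h.const_nonneg (mem_univ m) (mem_univ y)
  have k1 := key (m - (1 / 2 - s) * d)
  have k2 := key (m + (1 / 2 - s) * d)
  have hv0 : 0 ≤ 1 / 2 - s := by linarith [hs.2]
  have hv1 : (1 / 2 - s) ^ 3 ≤ (1 / 2) ^ 3 := by
    gcongr; linarith [hs.1]
  have k3 : |m - (1 / 2 - s) * d - m| ^ 3 ≤ |d| ^ 3 / 8 := by
    rw [show m - (1 / 2 - s) * d - m = - ((1 / 2 - s) * d) by ring, abs_neg, abs_mul,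
      abs_of_nonneg hv0, mul_pow]
    have := mul_le_mul_of_nonneg_right hv1 (pow_nonneg (abs_nonneg d) 3)
    linarith
  have k4 : |m + (1 / 2 - s) * d - m| ^ 3 ≤ |d| ^ 3 / 8 := by
    rw [show m + (1 / 2 - s) * d - m = - (m - (1 / 2 - s) * d - m) by ring, abs_neg]
    exact k3
  obtain ⟨k1, k1'⟩ := abs_le.1 k1
  obtain ⟨k2, k2'⟩ := abs_le.1 k2
  have k5 := mul_le_mul_of_nonneg_left k3 h.const_nonneg
  have k6 := mul_le_mul_of_nonneg_left k4 h.const_nonneg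
  have k7 : 0 ≤ K * |d| ^ 3 := mul_nonneg h.const_nonneg (by positivity)
  rw [abs_le]
  constructor <;> linarith

end NiceDensity

/-- Uniform regularity of a profile of the continuum flow at a fixed time. -/
structure Profile (ρ f : ℝ → ℝ) (ε m M : ℝ) : Prop where
  density : NiceDensity ρ ε M
  eps_le : ε ≤ 1
  m_pos : 0 < m
  one_le : 1 ≤ M
  reg : ContDiff ℝ 2 f
  left : f 0 = 0
  right : f 1 = 1
  deriv_ge : ∀ θ ∈ Icc (0 : ℝ) 1, m ≤ deriv f θ
  deriv_le : ∀ θ ∈ Icc (0 : ℝ) 1, |deriv f θ| ≤ M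
  curv : ∀ θ ∈ Icc (0 : ℝ) 1, |deriv (deriv f) θ| ≤ M
  curv_lip : ∀ x ∈ Icc (0 : ℝ) 1, ∀ y ∈ Icc (0 : ℝ) 1,
    |deriv (deriv f) x - deriv (deriv f) y| ≤ M * |x - y|
  bdry_left : deriv (deriv f) 0 = - deriv ρ 0 * deriv f 0 ^ 2 / (3 * ρ 0)
  bdry_right : deriv (deriv f) 1 = - deriv ρ 1 * deriv f 1 ^ 2 / (3 * ρ 1)

/-- The mean of `f` over the cell between `c` and `c + h`. -/
noncomputable def cellMean (f : ℝ → ℝ) (h c : ℝ) : ℝ := ∫ s in (0 : ℝ)..1, f (c + h * s)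

theorem cellMean_reflect (f : ℝ → ℝ) (h c : ℝ) : cellMean f h (c - h) = cellMean f (-h) c := by
  unfold cellMean
  have := intervalIntegral.integral_comp_sub_left (a := 0) (b := 1)
    (fun s => f (c - h + h * s)) (1 : ℝ)
  rw [sub_self, sub_zero] at this
  rw [← this]
  refine intervalIntegral.integral_congr fun s _ => ?_
  congr 1; ring

theorem abs_integral_sub_le {F G : ℝ → ℝ} {C : ℝ} (hF : ContinuousOn F (Icc 0 1))
    (hG : ContinuousOn G (Icc 0 1)) (h : ∀ s ∈ Icc (0 : ℝ) 1, |F s - G s| ≤ C) :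
    |(∫ s in (0 : ℝ)..1, F s) - ∫ s in (0 : ℝ)..1, G s| ≤ C := by
  rw [← intervalIntegral.integral_sub (hF.intervalIntegrable_of_Icc zero_le_one)
    (hG.intervalIntegrable_of_Icc zero_le_one)]
  have := intervalIntegral.norm_integral_le_of_norm_le_const (a := (0 : ℝ)) (b := 1) (C := C)
    (f := fun s => F s - G s) (fun s hs => by
      rw [uIoc_of_le zero_le_one] at hs
      exact h s ⟨hs.1.le, hs.2⟩)
  simpa using this

theorem mem_cell {c h s : ℝ} (hc : c ∈ Icc (0 : ℝ) 1) (hh : c + h ∈ Icc (0 : ℝ) 1)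
    (hs : s ∈ Icc (0 : ℝ) 1) : c + h * s ∈ Icc (0 : ℝ) 1 := by
  have := (convex_Icc (0 : ℝ) 1) hc hh (by linarith [hs.2] : 0 ≤ 1 - s) hs.1 (by ring)
  convert this using 1
  simp only [smul_eq_mul]; ring

theorem integral_quadratic (a b c : ℝ) :
    ∫ s in (0 : ℝ)..1, (a + b * s + c * s ^ 2) = a + b / 2 + c / 3 := by
  have h2 : ∀ s ∈ uIcc (0 : ℝ) 1, HasDerivAt (fun s : ℝ => a * s + b * (s ^ 2 / 2) +
      c * (s ^ 3 / 3))
      (a + b * s + c * s ^ 2) s := fun s _ =>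
    ((((hasDerivAt_id s).const_mul a).fun_add (((hasDerivAt_pow 2 s).div_const 2).const_mul b)).fun_add
      (((hasDerivAt_pow 3 s).div_const 3).const_mul c)).congr_deriv (by push_cast; ring)
  rw [intervalIntegral.integral_eq_sub_of_hasDerivAt h2
    (Continuous.intervalIntegrable (by fun_prop) _ _)]
  ring

namespace Profile

variable {ρ f : ℝ → ℝ} {ε m M : ℝ}

theorem differentiable (h : Profile ρ f ε m M) : Differentiable ℝ f :=
  h.reg.differentiable (by norm_num)

theorem taylor_two (H : Profile ρ f ε m M) {x y : ℝ} (hx : x ∈ Icc (0 : ℝ) 1)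
    (hy : y ∈ Icc (0 : ℝ) 1) :
    |f y - f x - deriv f x * (y - x) - deriv (deriv f) x / 2 * (y - x) ^ 2| ≤ M * |y - x| ^ 3 :=
  abs_taylor_two_le (convex_Icc 0 1) (fun z _ => (H.differentiable z).hasDerivAt)
    (fun z _ => (H.reg.differentiable_deriv_two z).hasDerivAt)
    (fun z hz => H.curv_lip z hz x hx) (by linarith [H.one_le]) hx hy

theorem taylor_one (H : Profile ρ f ε m M) {x y : ℝ} (hx : x ∈ Icc (0 : ℝ) 1)
    (hy : y ∈ Icc (0 : ℝ) 1) : |f y - f x - deriv f x * (y - x)| ≤ M * |y - x| ^ 2 :=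
  abs_taylor_one_le (convex_Icc 0 1) (fun z _ => (H.differentiable z).hasDerivAt)
    (fun _ hz => abs_sub_le_of_abs_deriv_le_Icc H.reg.differentiable_deriv_two H.curv hz hx)
    (by linarith [H.one_le]) hx hy

theorem cellMean_taylor (H : Profile ρ f ε m M) {c h : ℝ} (hc : c ∈ Icc (0 : ℝ) 1)
    (hh : c + h ∈ Icc (0 : ℝ) 1) :
    |cellMean f h c - (f c + deriv f c * h / 2 + deriv (deriv f) c * h ^ 2 / 6)| ≤ M * |h| ^ 3 := by
  have hcont := H.differentiable.continuous
  have hM : 0 ≤ M := by linarith [H.one_le]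
  have e := integral_quadratic (f c) (deriv f c * h) (deriv (deriv f) c / 2 * h ^ 2)
  rw [show f c + deriv f c * h / 2 + deriv (deriv f) c * h ^ 2 / 6 =
    f c + deriv f c * h / 2 + deriv (deriv f) c / 2 * h ^ 2 / 3 by ring, ← e]
  refine abs_integral_sub_le (by fun_prop) (by fun_prop) fun s hs => ?_
  have := H.taylor_two hc (mem_cell hc hh hs)
  rw [add_sub_cancel_left, abs_mul, abs_of_nonneg hs.1] at this
  rw [show f (c + h * s) - (f c + deriv f c * h * s + deriv (deriv f) c / 2 * h ^ 2 * s ^ 2) =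
    f (c + h * s) - f c - deriv f c * (h * s) - deriv (deriv f) c / 2 * (h * s) ^ 2 by ring]
  refine this.trans ?_
  gcongr
  · exact mul_nonneg (abs_nonneg h) hs.1
  · exact mul_le_of_le_one_right (abs_nonneg h) hs.2

end Profile

/-- Coefficient of the boundary correction. -/
noncomputable def corrCoeff (ρ : ℝ → ℝ) (y : ℝ) : ℝ := - deriv ρ y / (18 * ρ y)

/-- Correction compensating the curvature of the profile at the end points. -/
noncomputable def corr (ρ f : ℝ → ℝ) (h θ : ℝ) : ℝ :=
  corrCoeff ρ 0 * (f h / h) ^ 2 * (1 - θ) + corrCoeff ρ 1 * ((1 - f (1 - h)) / h) ^ 2 * θ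

theorem NiceDensity.abs_corrCoeff_le {ρ : ℝ → ℝ} {ε K : ℝ} (h : NiceDensity ρ ε K) (hε : ε ≤ 1)
    (y : ℝ) : |corrCoeff ρ y| ≤ 1 := by
  have h1 := h.lower y
  have h2 := (h.d1 y).trans hε
  unfold corrCoeff
  rw [abs_div, abs_neg, abs_of_pos (by linarith : 0 < 18 * ρ y), div_le_one (by linarith)]
  linarith

namespace Profile

variable {ρ f : ℝ → ℝ} {ε m M h : ℝ}

theorem abs_secant_left (H : Profile ρ f ε m M) (h0 : 0 < h) (h1 : h ≤ 1) :
    |f h / h| ≤ M ∧ |f h / h - deriv f 0| ≤ M * h := by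
  have hm0 : (0 : ℝ) ∈ Icc (0 : ℝ) 1 := by simp
  have hmh : h ∈ Icc (0 : ℝ) 1 := ⟨h0.le, h1⟩
  have k1 := abs_sub_le_of_abs_deriv_le_Icc H.differentiable H.deriv_le hmh hm0
  have k2 := H.taylor_one hm0 hmh
  rw [H.left, sub_zero, sub_zero, abs_of_pos h0] at k1 k2
  constructor
  · rw [abs_div, abs_of_pos h0, div_le_iff₀ h0]; exact k1
  · rw [show f h / h - deriv f 0 = (f h - deriv f 0 * h) / h by field_simp, abs_div, abs_of_pos h0,
      div_le_iff₀ h0]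
    linarith

theorem abs_secant_right (H : Profile ρ f ε m M) (h0 : 0 < h) (h1 : h ≤ 1) :
    |(1 - f (1 - h)) / h| ≤ M ∧ |(1 - f (1 - h)) / h - deriv f 1| ≤ M * h := by
  have hm0 : (1 : ℝ) ∈ Icc (0 : ℝ) 1 := by simp
  have hmh : 1 - h ∈ Icc (0 : ℝ) 1 := ⟨by linarith, by linarith⟩
  have k1 := abs_sub_le_of_abs_deriv_le_Icc H.differentiable H.deriv_le hm0 hmh
  have k2 := H.taylor_one hm0 hmh
  rw [H.right, show 1 - (1 - h) = h by ring, abs_of_pos h0] at k1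
  rw [H.right, show 1 - h - 1 = -h by ring, abs_neg, abs_of_pos h0] at k2
  constructor
  · rw [abs_div, abs_of_pos h0, div_le_iff₀ h0]; exact k1
  · rw [show (1 - f (1 - h)) / h - deriv f 1 = -((f (1 - h) - 1 - deriv f 1 * -h) / h) by
      field_simp; ring, abs_neg, abs_div, abs_of_pos h0, div_le_iff₀ h0]
    linarith

theorem abs_coeff_sq_le (H : Profile ρ f ε m M) (y : ℝ) {q : ℝ} (hq : |q| ≤ M) :
    |corrCoeff ρ y * q ^ 2| ≤ M ^ 2 := by
  have := abs_mul_le_mul (H.density.abs_corrCoeff_le H.eps_le y) (B := M ^ 2) (b := q ^ 2)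
    (by rw [abs_pow]; gcongr)
  simpa using this

theorem abs_corr_le (H : Profile ρ f ε m M) (h0 : 0 < h) (h1 : h ≤ 1) {θ : ℝ}
    (hθ : θ ∈ Icc (0 : ℝ) 1) : |corr ρ f h θ| ≤ M ^ 2 := by
  have k1 := abs_le.1 (H.abs_coeff_sq_le 0 (H.abs_secant_left h0 h1).1)
  have k2 := abs_le.1 (H.abs_coeff_sq_le 1 (H.abs_secant_right h0 h1).1)
  unfold corr
  rw [abs_le]
  constructor <;> nlinarith [hθ.1, hθ.2, k1.1, k1.2, k2.1, k2.2,
    mul_le_mul_of_nonneg_right k1.1 (sub_nonneg.2 hθ.2),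
    mul_le_mul_of_nonneg_right k1.2 (sub_nonneg.2 hθ.2),
    mul_le_mul_of_nonneg_right k2.1 hθ.1, mul_le_mul_of_nonneg_right k2.2 hθ.1]

theorem abs_corr_sub_le (H : Profile ρ f ε m M) (h0 : 0 < h) (h1 : h ≤ 1) (θ θ' : ℝ) :
    |corr ρ f h θ - corr ρ f h θ'| ≤ 2 * M ^ 2 * |θ - θ'| := by
  have k1 := H.abs_coeff_sq_le 0 (H.abs_secant_left h0 h1).1
  have k2 := H.abs_coeff_sq_le 1 (H.abs_secant_right h0 h1).1
  have e : corr ρ f h θ - corr ρ f h θ' = (corrCoeff ρ 1 * ((1 - f (1 - h)) / h) ^ 2 -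
    corrCoeff ρ 0 * (f h / h) ^ 2) * (θ - θ') := by unfold corr; ring
  rw [e]
  refine abs_mul_le_mul ?_ le_rfl
  have := abs_sub (corrCoeff ρ 1 * ((1 - f (1 - h)) / h) ^ 2) (corrCoeff ρ 0 * (f h / h) ^ 2)
  linarith

theorem abs_coeff_sq_sub_le (H : Profile ρ f ε m M) (y : ℝ) {q q' : ℝ} (hq : |q| ≤ M)
    (hq' : |q'| ≤ M) (hqq : |q - q'| ≤ M * h) :
    |corrCoeff ρ y * q ^ 2 - corrCoeff ρ y * q' ^ 2| ≤ 2 * M ^ 2 * h := by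
  have h3 : |q + q'| ≤ 2 * M := (abs_add_le q q').trans (by linarith)
  have := abs_mul_le_mul (H.density.abs_corrCoeff_le H.eps_le y) (abs_mul_le_mul h3 hqq)
  rw [show corrCoeff ρ y * q ^ 2 - corrCoeff ρ y * q' ^ 2 = corrCoeff ρ y * ((q + q') * (q - q')) by
    ring]
  linarith

theorem abs_corr_left (H : Profile ρ f ε m M) (h0 : 0 < h) (h1 : h ≤ 1) :
    |corr ρ f h (h / 2) - deriv (deriv f) 0 / 6| ≤ 3 * M ^ 2 * h := by
  have hs := H.abs_secant_left h0 h1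
  have k0 := H.abs_coeff_sq_sub_le 0 hs.1 (H.deriv_le 0 (by simp)) hs.2
  have k1 := H.abs_corr_sub_le h0 h1 (h / 2) 0
  have e : deriv (deriv f) 0 / 6 = corrCoeff ρ 0 * deriv f 0 ^ 2 := by
    have := H.density.pos 0
    rw [H.bdry_left, corrCoeff]; field_simp; ring
  rw [sub_zero, abs_of_pos (by linarith : 0 < h / 2)] at k1
  have e2 : corr ρ f h 0 = corrCoeff ρ 0 * (f h / h) ^ 2 := by unfold corr; ring
  rw [e2] at k1
  rw [e]
  have := abs_sub_le (corr ρ f h (h / 2)) (corrCoeff ρ 0 * (f h / h) ^ 2)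
    (corrCoeff ρ 0 * deriv f 0 ^ 2)
  linarith

theorem abs_corr_right (H : Profile ρ f ε m M) (h0 : 0 < h) (h1 : h ≤ 1) :
    |corr ρ f h (1 - h / 2) - deriv (deriv f) 1 / 6| ≤ 3 * M ^ 2 * h := by
  have hs := H.abs_secant_right h0 h1
  have k0 := H.abs_coeff_sq_sub_le 1 hs.1 (H.deriv_le 1 (by simp)) hs.2
  have k1 := H.abs_corr_sub_le h0 h1 (1 - h / 2) 1
  have e : deriv (deriv f) 1 / 6 = corrCoeff ρ 1 * deriv f 1 ^ 2 := by
    have := H.density.pos 1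
    rw [H.bdry_right, corrCoeff]; field_simp; ring
  rw [show 1 - h / 2 - 1 = -(h / 2) by ring, abs_neg, abs_of_pos (by linarith : 0 < h / 2)] at k1
  have e2 : corr ρ f h 1 = corrCoeff ρ 1 * ((1 - f (1 - h)) / h) ^ 2 := by unfold corr; ring
  rw [e2] at k1
  rw [e]
  have := abs_sub_le (corr ρ f h (1 - h / 2)) (corrCoeff ρ 1 * ((1 - f (1 - h)) / h) ^ 2)
    (corrCoeff ρ 1 * deriv f 1 ^ 2)
  linarith

end Profile

/-- The comparison configuration: corrected cell means of the profile. -/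
noncomputable def comparator (ρ f : ℝ → ℝ) (N i : ℕ) : ℝ :=
  cellMean f (1 / N) ((i - 1) / N) - (1 / N) ^ 2 * corr ρ f (1 / N) (grid N i)

theorem pad_mid {N i : ℕ} (v : ℕ → ℝ) (hi : i ∈ Finset.Icc 1 N) : pad N v i = v i := by
  rw [Finset.mem_Icc] at hi
  rw [pad, if_neg (by lia), if_neg (by lia)]

theorem pad_zero (N : ℕ) (v : ℕ → ℝ) : pad N v 0 = - v 1 := by simp [pad]

theorem pad_last (N : ℕ) (v : ℕ → ℝ) : pad N v (N + 1) = 2 - v N := by simp [pad]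

namespace Profile

variable {ρ f : ℝ → ℝ} {ε m M : ℝ} {N : ℕ}

theorem abs_comparator_sub_right (H : Profile ρ f ε m M) {i : ℕ} (hi : i ∈ Finset.Icc 1 N) :
    |comparator ρ f N i - (f (i / N) - deriv f (i / N) * (1 / N) / 2
      + deriv (deriv f) (i / N) * (1 / N) ^ 2 / 6 - (1 / N) ^ 2 * corr ρ f (1 / N) (grid N i))| ≤
      M * (1 / N) ^ 3 := by
  rw [Finset.mem_Icc] at hi
  have hN : (0 : ℝ) < N := by exact_mod_cast (by lia : 0 < N)
  have h1 : (1 : ℝ) ≤ i := by exact_mod_cast hi.1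
  have h2 : (i : ℝ) ≤ N := by exact_mod_cast hi.2
  have hc : (i / N : ℝ) ∈ Icc (0 : ℝ) 1 := ⟨by positivity, (div_le_one hN).2 h2⟩
  have hc' : (i / N : ℝ) + -(1 / N) ∈ Icc (0 : ℝ) 1 := by
    rw [← sub_eq_add_neg, ← sub_div]
    exact ⟨div_nonneg (by linarith) hN.le, (div_le_one hN).2 (by linarith)⟩
  have key := H.cellMean_taylor hc hc'
  rw [abs_neg, abs_of_pos (by positivity : (0 : ℝ) < 1 / N), ← cellMean_reflect] at key
  rw [comparator, sub_div]
  convert key using 2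
  ring

theorem abs_comparator_sub_left (H : Profile ρ f ε m M) {i : ℕ} (hi : i + 1 ∈ Finset.Icc 1 N) :
    |comparator ρ f N (i + 1) - (f (i / N) + deriv f (i / N) * (1 / N) / 2
      + deriv (deriv f) (i / N) * (1 / N) ^ 2 / 6 - (1 / N) ^ 2 *
        corr ρ f (1 / N) (grid N (i + 1)))| ≤
      M * (1 / N) ^ 3 := by
  rw [Finset.mem_Icc] at hi
  have hN : (0 : ℝ) < N := by exact_mod_cast (by lia : 0 < N)
  have h1 : (0 : ℝ) ≤ i := by positivity
  have h2 : (i + 1 : ℝ) ≤ N := by exact_mod_cast hi.2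
  have hc : (i / N : ℝ) ∈ Icc (0 : ℝ) 1 := ⟨by positivity, (div_le_one hN).2 (by linarith)⟩
  have hc' : (i / N : ℝ) + (1 / N) ∈ Icc (0 : ℝ) 1 := by
    rw [← add_div]
    exact ⟨by positivity, (div_le_one hN).2 (by linarith)⟩
  have key := H.cellMean_taylor hc hc'
  rw [abs_of_pos (by positivity : (0 : ℝ) < 1 / N)] at key
  rw [comparator]
  convert key using 2
  push_cast
  rw [add_sub_cancel_right]
  ring

theorem grid_mem {i : ℕ} (hi : i ∈ Finset.Icc 1 N) : grid N i ∈ Icc (0 : ℝ) 1 := by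
  rw [Finset.mem_Icc] at hi
  have hN : (0 : ℝ) < N := by exact_mod_cast (by lia : 0 < N)
  have h1 : (1 : ℝ) ≤ i := by exact_mod_cast hi.1
  have h2 : (i : ℝ) ≤ N := by exact_mod_cast hi.2
  exact ⟨div_nonneg (by linarith) hN.le, (div_le_one hN).2 (by linarith)⟩

/-- Consistency of the gaps and midpoints of the comparison configuration. -/
theorem comparator_face (H : Profile ρ f ε m M) {j : ℕ} (hN : 1 ≤ N) (hj : j ≤ N) :
    |pad N (comparator ρ f N) (j + 1) - pad N (comparator ρ f N) j - 1 / N * deriv f (j / N)| ≤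
        8 * M ^ 2 * (1 / N) ^ 3 ∧
      |(pad N (comparator ρ f N) j + pad N (comparator ρ f N) (j + 1)) / 2 - f (j / N)| ≤
        4 * M ^ 2 * (1 / N) ^ 2 := by
  have hN0 : (0 : ℝ) < N := by exact_mod_cast (by lia : 0 < N)
  have hN1 : (1 : ℝ) ≤ N := by exact_mod_cast hN
  have hh0 : (0 : ℝ) < 1 / N := by positivity
  have hh1 : (1 : ℝ) / N ≤ 1 := (div_le_one hN0).2 hN1
  have hM := H.one_le
  have hMM : M ≤ M ^ 2 := by nlinarith
  have hMh3 : M * (1 / N : ℝ) ^ 3 ≤ M ^ 2 * (1 / N) ^ 3 := by gcongr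
  have hh3 : M ^ 2 * (1 / N : ℝ) ^ 3 ≤ M ^ 2 * (1 / N) ^ 2 := by
    gcongr ?_ * ?_
    exact pow_le_pow_of_le_one hh0.le hh1 (by norm_num)
  have hp3 : 0 ≤ M ^ 2 * (1 / N : ℝ) ^ 3 := by positivity
  have hp2 : 0 ≤ M ^ 2 * (1 / N : ℝ) ^ 2 := by positivity
  rcases Nat.eq_zero_or_pos j with rfl | hj0
  · have k := abs_le.1 (H.abs_comparator_sub_left (i := 0) (N := N) (by simpa using hN))
    have g : grid N (0 + 1) = 1 / N / 2 := by unfold grid; push_cast; ring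
    have c := abs_le.1 (H.abs_corr_left hh0 hh1)
    have c1 := mul_le_mul_of_nonneg_left c.1 (sq_nonneg (1 / N : ℝ))
    have c2 := mul_le_mul_of_nonneg_left c.2 (sq_nonneg (1 / N : ℝ))
    rw [g] at k
    rw [pad_zero, pad_mid _ (by simpa using hN)]
    simp only [Nat.cast_zero, zero_div, zero_add, H.left] at k ⊢
    constructor
    · rw [abs_le]
      constructor <;> nlinarith [k.1, k.2]
    · rw [neg_add_cancel, zero_div, sub_zero, abs_zero]
      linarith
  rcases hj.eq_or_lt with rfl | hjN
  · have hmem : j ∈ Finset.Icc 1 j := by simpa using hN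
    have k := abs_le.1 (H.abs_comparator_sub_right hmem)
    have g : grid j j = 1 - 1 / j / 2 := by unfold grid; field_simp
    have c := abs_le.1 (H.abs_corr_right hh0 hh1)
    have c1 := mul_le_mul_of_nonneg_left c.1 (sq_nonneg (1 / j : ℝ))
    have c2 := mul_le_mul_of_nonneg_left c.2 (sq_nonneg (1 / j : ℝ))
    rw [g] at k
    rw [pad_last, pad_mid _ hmem]
    rw [div_self hN0.ne', H.right] at k ⊢
    constructor
    · rw [abs_le]
      constructor <;> nlinarith [k.1, k.2]
    · rw [show (comparator ρ f j j + (2 - comparator ρ f j j)) / 2 - 1 = 0 by ring, abs_zero]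
      linarith
  · have hmem : j ∈ Finset.Icc 1 N := Finset.mem_Icc.2 ⟨hj0, hj⟩
    have hmem' : j + 1 ∈ Finset.Icc 1 N := Finset.mem_Icc.2 ⟨by lia, hjN⟩
    have k := abs_le.1 (H.abs_comparator_sub_right hmem)
    have k' := abs_le.1 (H.abs_comparator_sub_left hmem')
    have c := H.abs_corr_sub_le hh0 hh1 (grid N (j + 1)) (grid N j)
    have g : grid N (j + 1) - grid N j = 1 / N := by unfold grid; push_cast; ring
    rw [g, abs_of_pos hh0] at c
    have c := abs_le.1 c
    have d := abs_le.1 (H.abs_corr_le hh0 hh1 (grid_mem hmem))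
    have d' := abs_le.1 (H.abs_corr_le hh0 hh1 (grid_mem hmem'))
    have hr := abs_le.1 (H.curv (j / N) ⟨by positivity, (div_le_one hN0).2 (by exact_mod_cast hj)⟩)
    have hsq := sq_nonneg (1 / N : ℝ)
    have c1 := mul_le_mul_of_nonneg_left c.1 hsq
    have c2 := mul_le_mul_of_nonneg_left c.2 hsq
    have d1 := mul_le_mul_of_nonneg_left d.1 hsq
    have d2 := mul_le_mul_of_nonneg_left d.2 hsq
    have d1' := mul_le_mul_of_nonneg_left d'.1 hsq
    have d2' := mul_le_mul_of_nonneg_left d'.2 hsq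
    have r1 := mul_le_mul_of_nonneg_left hr.1 hsq
    have r2 := mul_le_mul_of_nonneg_left hr.2 hsq
    have hMh2 := mul_le_mul_of_nonneg_left hMM hsq
    rw [pad_mid _ hmem, pad_mid _ hmem']
    constructor
    · rw [abs_le]
      constructor <;> linarith [k.1, k.2, k'.1, k'.2]
    · rw [abs_le]
      constructor <;> linarith [k.1, k.2, k'.1, k'.2]

/-- Closeness of the comparison configuration to the sampled profile. -/
theorem abs_comparator_sub_grid (H : Profile ρ f ε m M) {i : ℕ} (hi : i ∈ Finset.Icc 1 N) :
    |comparator ρ f N i - f (grid N i)| ≤ 4 * M ^ 2 * (1 / N) ^ 2 := by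
  have hi' := Finset.mem_Icc.1 hi
  have hN0 : (0 : ℝ) < N := by exact_mod_cast (by lia : 0 < N)
  have hN1 : (1 : ℝ) ≤ N := by exact_mod_cast (by lia : 1 ≤ N)
  have hh0 : (0 : ℝ) < 1 / N := by positivity
  have hh1 : (1 : ℝ) / N ≤ 1 := (div_le_one hN0).2 hN1
  have hM := H.one_le
  have hMM : M ≤ M ^ 2 := by nlinarith
  have hi1 : (1 : ℝ) ≤ i := by exact_mod_cast hi'.1
  have hi2 : (i : ℝ) ≤ N := by exact_mod_cast hi'.2
  have hc : (i / N : ℝ) ∈ Icc (0 : ℝ) 1 := ⟨by positivity, (div_le_one hN0).2 hi2⟩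
  have k := abs_le.1 (H.abs_comparator_sub_right hi)
  have t := H.taylor_one hc (grid_mem hi)
  have g : grid N i - i / N = -(1 / N / 2) := by unfold grid; ring
  rw [g, sq_abs] at t
  have t := abs_le.1 t
  have hsq := sq_nonneg (1 / N : ℝ)
  have d := abs_le.1 (H.abs_corr_le hh0 hh1 (grid_mem hi))
  have hr := abs_le.1 (H.curv (i / N) hc)
  have d1 := mul_le_mul_of_nonneg_left d.1 hsq
  have d2 := mul_le_mul_of_nonneg_left d.2 hsq
  have r1 := mul_le_mul_of_nonneg_left hr.1 hsq
  have r2 := mul_le_mul_of_nonneg_left hr.2 hsq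
  have hMh2 := mul_le_mul_of_nonneg_left hMM hsq
  have hM0 : 0 ≤ M * (1 / N : ℝ) ^ 2 := by positivity
  have hMh3 : M * (1 / N : ℝ) ^ 3 ≤ M * (1 / N : ℝ) ^ 2 := by
    gcongr ?_ * ?_
    exact pow_le_pow_of_le_one hh0.le hh1 (by norm_num)
  rw [abs_le]
  constructor <;> linarith [k.1, k.2, t.1, t.2]

end Profile

theorem abs_sub_mul_le {a b a' b' δ A' B δ' : ℝ} (h1 : |a - a'| ≤ δ) (hb : |b| ≤ B)
    (ha' : |a'| ≤ A') (h2 : |b - b'| ≤ δ') : |a * b - a' * b'| ≤ δ * B + A' * δ' := by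
  rw [show a * b - a' * b' = (a - a') * b + a' * (b - b') by ring]
  exact (abs_add_le _ _).trans (add_le_add (abs_mul_le_mul h1 hb) (abs_mul_le_mul ha' h2))

/-- Consistency of the symmetric and antisymmetric parts of the discrete flux at a face. -/
theorem NiceDensity.face_consistency {ρ : ℝ → ℝ} {ε M B h p q V P : ℝ} (H : NiceDensity ρ ε M)
    (hε : ε ≤ 1) (hB : 1 ≤ B) (hMB : M ≤ B) (h0 : 0 < h) (hP : |P| ≤ B)
    (hd : |q - p| ≤ B * h) (h1 : |q - p - h * P| ≤ B * h ^ 3)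
    (h2 : |(p + q) / 2 - V| ≤ B * h ^ 2) :
    |(q - p) ^ 2 * (kern ρ p q + kern ρ q p) - h ^ 2 * (ρ V * P ^ 2 / 4)| ≤ 3 * B ^ 4 * h ^ 4 ∧
      |(q - p) ^ 2 * (kern ρ p q - kern ρ q p) + h ^ 3 * (deriv ρ V * P ^ 3) / 24| ≤
        B ^ 6 * h ^ 5 := by
  have hB0 : 0 ≤ B := by linarith
  have hd2 : |(q - p) ^ 2| ≤ (B * h) ^ 2 := by rw [abs_pow]; gcongr
  have hhP : |h * P| ≤ B * h := by
    rw [abs_mul, abs_of_pos h0, mul_comm]; gcongr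
  have hρ' : |deriv ρ V| ≤ 1 := (H.d1 V).trans hε
  have e1 : |ρ ((p + q) / 2) - ρ V| ≤ B * h ^ 2 :=
    (H.abs_sub_le _ _).trans ((mul_le_of_le_one_left (abs_nonneg _) hε).trans h2)
  have e2 : |deriv ρ ((p + q) / 2) - deriv ρ V| ≤ B * h ^ 2 :=
    (H.abs_deriv_sub_le _ _).trans ((mul_le_of_le_one_left (abs_nonneg _) hε).trans h2)
  have s2 : |(q - p) ^ 2 - (h * P) ^ 2| ≤ B * h ^ 3 * (B * h) + B * h * (B * h ^ 3) := by
    rw [sq, sq]; exact abs_sub_mul_le h1 hd hhP h1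
  have hP2 : |(h * P) ^ 2| ≤ (B * h) ^ 2 := by rw [abs_pow]; gcongr
  have s3 : |(q - p) ^ 3 - (h * P) ^ 3| ≤
      (B * h ^ 3 * (B * h) + B * h * (B * h ^ 3)) * (B * h) + (B * h) ^ 2 * (B * h ^ 3) := by
    rw [pow_succ, pow_succ (h * P)]; exact abs_sub_mul_le s2 hd hP2 h1
  have hP3 : |(h * P) ^ 3| ≤ (B * h) ^ 3 := by rw [abs_pow]; gcongr
  have b2 : B ^ 2 ≤ B ^ 4 := pow_le_pow_right₀ hB (by norm_num)
  have b3 : B ^ 3 ≤ B ^ 4 := pow_le_pow_right₀ hB (by norm_num)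
  have b36 : B ^ 3 ≤ B ^ 6 := pow_le_pow_right₀ hB (by norm_num)
  have b46 : B ^ 4 ≤ B ^ 6 := pow_le_pow_right₀ hB (by norm_num)
  constructor
  · have k1 : |(kern ρ p q + kern ρ q p) - ρ ((p + q) / 2) / 4| ≤ (B * h) ^ 2 / 8 := by
      refine (H.abs_kern_add_sub_le p q).trans ?_
      rw [div_le_div_iff_of_pos_right (by norm_num), ← sq_abs (q - p)]
      calc ε * |q - p| ^ 2 ≤ 1 * |q - p| ^ 2 := by gcongr
        _ ≤ (B * h) ^ 2 := by rw [one_mul]; gcongr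
    have m1 := abs_le.1 (abs_mul_le_mul hd2 k1)
    have m2 := abs_le.1 (abs_mul_le_mul hd2 e1)
    have m3 := abs_le.1 (abs_mul_le_mul s2 (H.abs_apply_le V))
    have hh : 0 ≤ h ^ 4 := by positivity
    have c2 := mul_le_mul_of_nonneg_right b2 hh
    have c3 := mul_le_mul_of_nonneg_right b3 hh
    have c4 : 0 ≤ B ^ 4 * h ^ 4 := by positivity
    rw [abs_le]
    constructor <;> linarith [m1.1, m1.2, m2.1, m2.2, m3.1, m3.2]
  · have k1 : |(kern ρ p q - kern ρ q p) + deriv ρ ((p + q) / 2) * (q - p) / 24| ≤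
        B * (B * h) ^ 3 / 8 := by
      refine (H.abs_kern_antisymm_add_le p q).trans ?_
      gcongr
    have m1 := abs_le.1 (abs_mul_le_mul hd2 k1)
    have hd3 : |(q - p) ^ 3| ≤ (B * h) ^ 3 := by rw [abs_pow]; gcongr
    have m2 := abs_le.1 (abs_mul_le_mul hd3 e2)
    have m3 := abs_le.1 (abs_mul_le_mul s3 hρ')
    have hh : 0 ≤ h ^ 5 := by positivity
    have c2 := mul_le_mul_of_nonneg_right b36 hh
    have c3 := mul_le_mul_of_nonneg_right b46 hh
    have c4 : 0 ≤ B ^ 6 * h ^ 5 := by positivity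
    rw [abs_le]
    constructor <;> linarith [m1.1, m1.2, m2.1, m2.2, m3.1, m3.2]

namespace Profile

variable {ρ f : ℝ → ℝ} {ε m M : ℝ}

/-- The symmetric part of the limiting flux. -/
noncomputable def symmFlux (ρ f : ℝ → ℝ) (θ : ℝ) : ℝ := ρ (f θ) * deriv f θ ^ 2 / 4

/-- The antisymmetric part of the limiting flux. -/
noncomputable def skewFlux (ρ f : ℝ → ℝ) (θ : ℝ) : ℝ := deriv ρ (f θ) * deriv f θ ^ 3

theorem hasDerivAt (H : Profile ρ f ε m M) (θ : ℝ) : HasDerivAt f (deriv f θ) θ :=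
  (H.differentiable θ).hasDerivAt

theorem hasDerivAt_deriv (H : Profile ρ f ε m M) (θ : ℝ) :
    HasDerivAt (deriv f) (deriv (deriv f) θ) θ :=
  (H.reg.differentiable_deriv_two θ).hasDerivAt

theorem hasDerivAt_symmFlux (H : Profile ρ f ε m M) (θ : ℝ) :
    HasDerivAt (symmFlux ρ f)
      (flux ρ (f θ) (deriv f θ) (deriv (deriv f) θ) + skewFlux ρ f θ / 12) θ := by
  have h1 := (H.density.differentiable (f θ)).hasDerivAt.comp θ (H.hasDerivAt θ)
  refine ((h1.fun_mul ((H.hasDerivAt_deriv θ).fun_pow 2)).div_const 4).congr_deriv ?_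
  simp only [flux, skewFlux, Function.comp]
  push_cast
  ring

theorem hasDerivAt_skewFlux (H : Profile ρ f ε m M) (θ : ℝ) :
    HasDerivAt (skewFlux ρ f) (deriv (deriv ρ) (f θ) * deriv f θ ^ 4
      + 3 * (deriv ρ (f θ) * (deriv f θ ^ 2 * deriv (deriv f) θ))) θ := by
  have h1 := ((H.density.contDiff_deriv.differentiable (by norm_num)) (f θ)).hasDerivAt.comp θ
    (H.hasDerivAt θ)
  refine (h1.fun_mul ((H.hasDerivAt_deriv θ).fun_pow 3)).congr_deriv ?_
  simp only [Function.comp]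
  push_cast
  ring

theorem skewFlux_deriv_lip (H : Profile ρ f ε m M) {x y : ℝ} (hx : x ∈ Icc (0 : ℝ) 1)
    (hy : y ∈ Icc (0 : ℝ) 1) :
    |(deriv (deriv ρ) (f x) * deriv f x ^ 4
      + 3 * (deriv ρ (f x) * (deriv f x ^ 2 * deriv (deriv f) x)))
      - (deriv (deriv ρ) (f y) * deriv f y ^ 4
      + 3 * (deriv ρ (f y) * (deriv f y ^ 2 * deriv (deriv f) y)))| ≤ 20 * M ^ 6 * |x - y| := by
  have hM := H.one_le
  have hM0 : 0 ≤ M := by linarith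
  set D := |x - y| with hD
  have hD0 : 0 ≤ D := abs_nonneg _
  have f0 : |f x - f y| ≤ M * D := abs_sub_le_of_abs_deriv_le_Icc H.differentiable H.deriv_le hx hy
  have f1 : |deriv f x - deriv f y| ≤ M * D :=
    abs_sub_le_of_abs_deriv_le_Icc H.reg.differentiable_deriv_two H.curv hx hy
  have f2 : |deriv (deriv f) x - deriv (deriv f) y| ≤ M * D := H.curv_lip x hx y hy
  have px := H.deriv_le x hx
  have py := H.deriv_le y hy
  have rx := H.curv x hx
  have ry := H.curv y hy
  have r0 : |deriv ρ (f x) - deriv ρ (f y)| ≤ M * D :=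
    (H.density.abs_deriv_sub_le _ _).trans
      ((mul_le_of_le_one_left (abs_nonneg _) H.eps_le).trans f0)
  have r1 : |deriv (deriv ρ) (f x) - deriv (deriv ρ) (f y)| ≤ M * (M * D) :=
    (H.density.abs_deriv_deriv_sub_le _ _).trans (by gcongr)
  have b1 := (H.density.d1 (f y)).trans H.eps_le
  have b2 := (H.density.d2 (f y)).trans H.eps_le
  have s2 := abs_sub_mul_le f1 px py f1
  rw [← sq, ← sq] at s2
  have qx : |deriv f x ^ 2| ≤ M ^ 2 := by rw [abs_pow]; gcongr
  have qy : |deriv f y ^ 2| ≤ M ^ 2 := by rw [abs_pow]; gcongr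
  have s4 := abs_sub_mul_le s2 qx qy s2
  rw [← pow_add, ← pow_add] at s4
  norm_num only at s4
  have qx4 : |deriv f x ^ 4| ≤ M ^ 4 := by rw [abs_pow]; gcongr
  have t1 := abs_sub_mul_le r1 qx4 b2 s4
  have u1 := abs_sub_mul_le s2 rx qy f2
  have t2 := abs_sub_mul_le r0 (abs_mul_le_mul qx rx) b1 u1
  have c3 := mul_le_mul_of_nonneg_right (pow_le_pow_right₀ hM (by norm_num : 3 ≤ 6)) hD0
  have c4 := mul_le_mul_of_nonneg_right (pow_le_pow_right₀ hM (by norm_num : 4 ≤ 6)) hD0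
  have t1 := abs_le.1 t1
  have t2 := abs_le.1 t2
  rw [abs_le]
  constructor <;> linarith [t1.1, t1.2, t2.1, t2.2]

theorem continuous_flux (H : Profile ρ f ε m M) :
    Continuous fun θ => flux ρ (f θ) (deriv f θ) (deriv (deriv f) θ) := by
  have h1 := H.density.continuous
  have h2 := H.density.contDiff_deriv.continuous
  have h3 := H.differentiable.continuous
  have h4 := H.reg.differentiable_deriv_two.continuous
  have h5 : Continuous (deriv (deriv f)) := by
    have := ((contDiff_succ_iff_deriv (n := 1)).1 H.reg).2.2
    exact this.continuous_deriv le_rfl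
  unfold flux
  fun_prop

/-- The mean of the limiting speed over a cell in terms of the fluxes at its faces. -/
theorem cellMean_flux (H : Profile ρ f ε m M) {c h : ℝ} (hc : c ∈ Icc (0 : ℝ) 1)
    (h0 : 0 < h) (hh : c + h ∈ Icc (0 : ℝ) 1) :
    |cellMean (fun θ => flux ρ (f θ) (deriv f θ) (deriv (deriv f) θ)) h c
      - ((symmFlux ρ f (c + h) - symmFlux ρ f c) / h
        - (skewFlux ρ f c + skewFlux ρ f (c + h)) / 24)| ≤ 3 * M ^ 6 * h ^ 2 := by
  have hφ : Continuous (skewFlux ρ f) :=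
    continuous_iff_continuousAt.2 fun θ => (H.hasDerivAt_skewFlux θ).continuousAt
  have hF : Continuous fun s => flux ρ (f (c + h * s)) (deriv f (c + h * s))
      (deriv (deriv f) (c + h * s)) :=
    H.continuous_flux.comp (by fun_prop : Continuous fun s : ℝ => c + h * s)
  have hftc : ∫ s in (0 : ℝ)..1, (flux ρ (f (c + h * s)) (deriv f (c + h * s))
      (deriv (deriv f) (c + h * s)) + skewFlux ρ f (c + h * s) / 12) =
      (symmFlux ρ f (c + h) - symmFlux ρ f c) / h := by
    have hd : ∀ s ∈ uIcc (0 : ℝ) 1, HasDerivAt (fun s => symmFlux ρ f (c + h * s) / h)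
        (flux ρ (f (c + h * s)) (deriv f (c + h * s))
          (deriv (deriv f) (c + h * s)) + skewFlux ρ f (c + h * s) / 12) s := fun s _ => by
      have := (H.hasDerivAt_symmFlux (c + h * s)).comp s
        (((hasDerivAt_id s).const_mul h).const_add c)
      exact (this.div_const h).congr_deriv (by field_simp)
    rw [intervalIntegral.integral_eq_sub_of_hasDerivAt hd
      (Continuous.intervalIntegrable (hF.add (by fun_prop)) _ _)]
    simp [sub_div]
  rw [intervalIntegral.integral_add (hF.intervalIntegrable _ _)
    (Continuous.intervalIntegrable (by fun_prop) _ _), intervalIntegral.integral_div] at hftc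
  set d := deriv (deriv ρ) (f c) * deriv f c ^ 4
      + 3 * (deriv ρ (f c) * (deriv f c ^ 2 * deriv (deriv f) c)) with hd
  have htay : ∀ y ∈ Icc (0 : ℝ) 1, |skewFlux ρ f y - skewFlux ρ f c - d * (y - c)| ≤
      20 * M ^ 6 * |y - c| ^ 2 := fun y hy =>
    abs_taylor_one_le (convex_Icc 0 1) (fun z _ => H.hasDerivAt_skewFlux z)
      (fun z hz => H.skewFlux_deriv_lip hz hc) (by positivity) hc hy
  have e := integral_quadratic (skewFlux ρ f c) (d * h) 0
  have k1 : |(∫ s in (0 : ℝ)..1, skewFlux ρ f (c + h * s)) - (skewFlux ρ f c + d * h / 2 + 0 / 3)| ≤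
      20 * M ^ 6 * h ^ 2 := by
    rw [← e]
    refine abs_integral_sub_le (by fun_prop) (by fun_prop) fun s hs => ?_
    have := htay _ (mem_cell hc hh hs)
    rw [add_sub_cancel_left, abs_mul, abs_of_nonneg hs.1, abs_of_pos h0] at this
    rw [show skewFlux ρ f (c + h * s) - (skewFlux ρ f c + d * h * s + 0 * s ^ 2) =
      skewFlux ρ f (c + h * s) - skewFlux ρ f c - d * (h * s) by ring]
    refine this.trans ?_
    gcongr
    · exact mul_nonneg h0.le hs.1
    · exact mul_le_of_le_one_right h0.le hs.2
  have k2 := htay _ hh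
  rw [add_sub_cancel_left, abs_of_pos h0] at k2
  have k1 := abs_le.1 k1
  have k2 := abs_le.1 k2
  have hp : 0 ≤ M ^ 6 * h ^ 2 := by positivity
  unfold cellMean
  rw [← hftc, abs_le]
  constructor <;> linarith [k1.1, k1.2, k2.1, k2.2]

end Profile

theorem NiceDensity.mono {ρ : ℝ → ℝ} {ε K K' : ℝ} (h : NiceDensity ρ ε K) (hK : K ≤ K') :
    NiceDensity ρ ε K' :=
  ⟨h.smooth, h.lower, h.upper, h.d1, h.d2, fun y => (h.d3 y).trans hK⟩

namespace RegularFlow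

variable {ρ : ℝ → ℝ} {X : ℝ → ℝ → ℝ} {ε K a A B : ℝ}

/-- Bound for the regularity of all the time slices of a regular flow. -/
noncomputable def profileBound (K a A B : ℝ) : ℝ := 1 + K + 3 * A + curvBound a A B + curvLip a A B

theorem profile (h : RegularFlow ρ X ε K a A B) {t : ℝ} (ht : 0 ≤ t) :
    Profile ρ (X t) ε (a / 3) (profileBound K a A B) := by
  have hK := h.density.const_nonneg
  have hA := h.A_pos
  have hc := h.curvBound_nonneg
  have hl := h.curvLip_nonneg
  have ha := h.a_pos
  refine ⟨h.density.mono (by unfold profileBound; linarith), h.eps_le, by linarith,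
    by unfold profileBound; linarith, h.flow.reg t ht, h.flow.left t ht, h.flow.right t ht,
    fun θ hθ => (h.deriv_mem ht hθ).1, fun θ hθ => (h.abs_deriv_le ht hθ).trans
      (by unfold profileBound; linarith), fun θ hθ => (h.abs_curv_le ht hθ).trans
      (by unfold profileBound; linarith), fun x hx y hy => (h.abs_curv_sub_le ht hx hy).trans ?_,
      ?_, ?_⟩
  · gcongr
    unfold profileBound; linarith
  · have h0 := h.speed_left ht
    have hp := (h.deriv_mem ht (θ := 0) (by simp)).1
    have hp0 : 0 < deriv (X t) 0 := by linarith
    have hρ := h.density.pos 0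
    rw [speed, flux, h.flow.left t ht] at h0
    have h1 : deriv (X t) 0 * (3 * ρ 0 * deriv (deriv (X t)) 0 + deriv ρ 0 * deriv (X t) 0 ^ 2) =
        0 := by
      linarith
    rw [eq_div_iff (by positivity)]
    linarith [(mul_eq_zero.1 h1).resolve_left hp0.ne']
  · have h0 := h.speed_right ht
    have hp := (h.deriv_mem ht (θ := 1) (by simp)).1
    have hp0 : 0 < deriv (X t) 1 := by linarith
    have hρ := h.density.pos 1
    rw [speed, flux, h.flow.right t ht] at h0
    have h1 : deriv (X t) 1 * (3 * ρ 1 * deriv (deriv (X t)) 1 + deriv ρ 1 * deriv (X t) 1 ^ 2) =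
        0 := by
      linarith
    rw [eq_div_iff (by positivity)]
    linarith [(mul_eq_zero.1 h1).resolve_left hp0.ne']

theorem continuous_speed (h : RegularFlow ρ X ε K a A B) {t : ℝ} (ht : 0 ≤ t) :
    Continuous (speed ρ X t) := (h.profile ht).continuous_flux

theorem continuous_slice (h : RegularFlow ρ X ε K a A B) {t : ℝ} (ht : 0 ≤ t) :
    Continuous (X t) := (h.flow.reg t ht).continuous

theorem hasDerivAt_cellMean (h : RegularFlow ρ X ε K a A B) {t c w : ℝ} (ht : 0 < t)
    (hc : c ∈ Icc (0 : ℝ) 1) (hw : c + w ∈ Icc (0 : ℝ) 1) :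
    HasDerivAt (fun s => cellMean (X s) w c) (cellMean (speed ρ X t) w c) t := by
  refine (intervalIntegral.hasDerivAt_integral_of_dominated_loc_of_deriv_le
    (F := fun s σ => X s (c + w * σ)) (F' := fun s σ => speed ρ X s (c + w * σ))
    (bound := fun _ => speedBound a A B) (s := Ioi 0) (Ioi_mem_nhds ht) ?_ ?_ ?_ ?_ ?_ ?_).2
  · filter_upwards [Ioi_mem_nhds ht] with s hs
    have := h.continuous_slice (le_of_lt hs)
    exact (by fun_prop : Continuous fun σ => X s (c + w * σ)).aestronglyMeasurable
  · have := h.continuous_slice ht.le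
    exact Continuous.intervalIntegrable (by fun_prop) _ _
  · have := h.continuous_speed ht.le
    exact (by fun_prop : Continuous fun σ => speed ρ X t (c + w * σ)).aestronglyMeasurable
  · refine ae_of_all _ fun σ hσ s hs => ?_
    rw [uIoc_of_le zero_le_one] at hσ
    exact h.abs_flux_le (le_of_lt hs) (mem_cell hc hw ⟨hσ.1.le, hσ.2⟩)
  · exact intervalIntegrable_const
  · refine ae_of_all _ fun σ hσ s hs => ?_
    rw [uIoc_of_le zero_le_one] at hσ
    exact h.hasDerivAt_time (le_of_lt hs) (mem_cell hc hw ⟨hσ.1.le, hσ.2⟩)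

theorem abs_time_sub_le_abs (h : RegularFlow ρ X ε K a A B) {s t θ : ℝ} (hs : 0 ≤ s) (ht : 0 ≤ t)
    (hθ : θ ∈ Icc (0 : ℝ) 1) : |X s θ - X t θ| ≤ speedBound a A B * |s - t| := by
  rcases le_total s t with hst | hst
  · have := h.abs_time_sub_le hs (sub_nonneg.2 hst) hθ
    rw [add_sub_cancel] at this
    rwa [abs_sub_comm, abs_sub_comm s t, abs_of_nonneg (sub_nonneg.2 hst)]
  · have := h.abs_time_sub_le ht (sub_nonneg.2 hst) hθ
    rw [add_sub_cancel] at this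
    rwa [abs_of_nonneg (sub_nonneg.2 hst)]

theorem continuousOn_cellMean (h : RegularFlow ρ X ε K a A B) {c w : ℝ}
    (hc : c ∈ Icc (0 : ℝ) 1) (hw : c + w ∈ Icc (0 : ℝ) 1) :
    ContinuousOn (fun s => cellMean (X s) w c) (Ici 0) := by
  refine (LipschitzOnWith.of_dist_le_mul (K := ⟨speedBound a A B, h.speedBound_nonneg⟩)
    fun s hs t ht => ?_).continuousOn
  rw [Real.dist_eq, Real.dist_eq]
  have hs' := h.continuous_slice hs
  have ht' := h.continuous_slice ht
  exact abs_integral_sub_le (by fun_prop) (by fun_prop) fun σ hσ =>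
    h.abs_time_sub_le_abs hs ht (mem_cell hc hw hσ)

theorem hasDerivAt_corr (h : RegularFlow ρ X ε K a A B) {t w θ : ℝ} (ht : 0 ≤ t) (h0 : 0 < w)
    (h1 : w ≤ 1) (hθ : θ ∈ Icc (0 : ℝ) 1) :
    ∃ v, |v| ≤ 2 * (3 * A * speedLip a A B) ∧ HasDerivAt (fun s => corr ρ (X s) w θ) v t := by
  have hw : w ∈ Icc (0 : ℝ) 1 := ⟨h0.le, h1⟩
  have hw' : 1 - w ∈ Icc (0 : ℝ) 1 := ⟨by linarith, by linarith⟩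
  have d0 := (h.hasDerivAt_time ht hw).div_const w
  have d1 := ((h.hasDerivAt_time ht hw').const_sub 1).div_const w
  have hd := (((d0.fun_pow 2).const_mul (corrCoeff ρ 0)).mul_const (1 - θ)).fun_add
    (((d1.fun_pow 2).const_mul (corrCoeff ρ 1)).mul_const θ)
  have hA := h.A_pos
  have hL := h.speedLip_nonneg
  have s0 := h.abs_speed_sub_le ht hw (y := 0) (by simp)
  have s1 := h.abs_speed_sub_le ht hw' (y := 1) (by simp)
  have x0 := h.abs_space_sub_le ht hw (y := 0) (by simp)
  have x1 := h.abs_space_sub_le ht (x := 1) (by simp) hw'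
  rw [h.speed_left ht, sub_zero, sub_zero, abs_of_pos h0] at s0
  rw [h.speed_right ht, sub_zero, show 1 - w - 1 = -w by ring, abs_neg, abs_of_pos h0] at s1
  rw [h.flow.left t ht, sub_zero, sub_zero, abs_of_pos h0] at x0
  rw [h.flow.right t ht, show 1 - (1 - w) = w by ring, abs_of_pos h0] at x1
  have b0 : |X t w / w * (speed ρ X t w / w)| ≤ 3 * A * speedLip a A B := by
    apply abs_mul_le_mul <;> rwa [abs_div, abs_of_pos h0, div_le_iff₀ h0]
  have b1 : |(1 - X t (1 - w)) / w * (-speed ρ X t (1 - w) / w)| ≤ 3 * A * speedLip a A B := by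
    apply abs_mul_le_mul <;> rw [abs_div, abs_of_pos h0, div_le_iff₀ h0]
    · exact x1
    · rwa [abs_neg]
  have c0 := abs_mul_le_mul (h.density.abs_corrCoeff_le h.eps_le 0) b0
  have c1 := abs_mul_le_mul (h.density.abs_corrCoeff_le h.eps_le 1) b1
  rw [one_mul] at c0 c1
  refine ⟨_, ?_, hd⟩
  have e : ∀ (α β x v y u : ℝ), α * ((2 : ℕ) * (x ^ (2 - 1)) * v) * (1 - θ) + β * ((2 : ℕ) *
      (y ^ (2 - 1)) * u) * θ = 2 * ((α * (x * v)) * (1 - θ) + (β * (y * u)) * θ) := by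
    intros; norm_num; ring
  rw [e, abs_mul, abs_two]
  refine mul_le_mul_of_nonneg_left ?_ (by norm_num)
  refine (abs_add_le _ _).trans ?_
  rw [abs_mul _ (1 - θ), abs_mul _ θ, abs_of_nonneg hθ.1, abs_of_nonneg (sub_nonneg.2 hθ.2)]
  nlinarith [mul_le_mul_of_nonneg_right c0 (sub_nonneg.2 hθ.2), mul_le_mul_of_nonneg_right c1 hθ.1]

/-- Consistency constant for the velocity of the comparison configuration. -/
noncomputable def velocityBound (K a A B : ℝ) : ℝ :=
  3 * profileBound K a A B ^ 6 + 2 * (3 * A * speedLip a A B)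

theorem cell_mem {N i : ℕ} (hi : i ∈ Finset.Icc 1 N) :
    ((i - 1) / N : ℝ) ∈ Icc (0 : ℝ) 1 ∧ ((i - 1) / N + 1 / N : ℝ) ∈ Icc (0 : ℝ) 1 := by
  rw [Finset.mem_Icc] at hi
  have hN : (0 : ℝ) < N := by exact_mod_cast (by lia : 0 < N)
  have h1 : (1 : ℝ) ≤ i := by exact_mod_cast hi.1
  have h2 : (i : ℝ) ≤ N := by exact_mod_cast hi.2
  rw [← add_div, sub_add_cancel]
  exact ⟨⟨div_nonneg (by linarith) hN.le, (div_le_one hN).2 (by linarith)⟩,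
    ⟨by positivity, (div_le_one hN).2 h2⟩⟩

theorem continuousOn_comparator (h : RegularFlow ρ X ε K a A B) {N i : ℕ}
    (hi : i ∈ Finset.Icc 1 N) : ContinuousOn (fun s => comparator ρ (X s) N i) (Ici 0) := by
  have hi' := Finset.mem_Icc.1 hi
  have hN1 : (1 : ℝ) ≤ N := by exact_mod_cast (by lia : 1 ≤ N)
  have hh1 : (1 : ℝ) / N ≤ 1 := (div_le_one (by linarith)).2 hN1
  have hc : ContinuousOn (fun s => corr ρ (X s) (1 / N) (grid N i)) (Ici 0) := fun s hs => by
    obtain ⟨v, -, hv⟩ := h.hasDerivAt_corr hs (w := 1 / N) (by positivity) hh1 (Profile.grid_mem hi)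
    exact hv.continuousAt.continuousWithinAt
  exact (h.continuousOn_cellMean (cell_mem hi).1 (cell_mem hi).2).sub (hc.const_mul _)

/-- The comparison configuration solves the discrete equation up to a small error. -/
theorem hasDerivAt_comparator (h : RegularFlow ρ X ε K a A B) {t : ℝ} (ht : 0 < t) {N i : ℕ}
    (hi : i + 1 ∈ Finset.Icc 1 N) :
    ∃ v, HasDerivAt (fun s => comparator ρ (X s) N (i + 1)) v t ∧
      |v - (N * (Profile.symmFlux ρ (X t) ((i + 1 : ℕ) / N) - Profile.symmFlux ρ (X t) (i / N))
        - (Profile.skewFlux ρ (X t) (i / N) + Profile.skewFlux ρ (X t) ((i + 1 : ℕ) / N)) / 24)| ≤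
        velocityBound K a A B * (1 / N) ^ 2 := by
  have hi' := Finset.mem_Icc.1 hi
  have hN1 : (1 : ℝ) ≤ N := by exact_mod_cast (by lia : 1 ≤ N)
  have hN0 : (0 : ℝ) < N := by linarith
  have hh1 : (1 : ℝ) / N ≤ 1 := (div_le_one (by linarith)).2 hN1
  obtain ⟨v, hv1, hv2⟩ := h.hasDerivAt_corr ht.le (w := 1 / N) (by positivity) hh1
    (Profile.grid_mem hi)
  obtain ⟨hc, hc'⟩ := cell_mem hi
  have hd := (h.hasDerivAt_cellMean ht hc hc').fun_sub (hv2.const_mul ((1 / N : ℝ) ^ 2))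
  refine ⟨_, hd, ?_⟩
  have key := (h.profile ht.le).cellMean_flux hc (by positivity) hc'
  have e1 : ((i + 1 : ℕ) - 1 : ℝ) / N = i / N := by push_cast; rw [add_sub_cancel_right]
  have e2 : (i : ℝ) / N + 1 / N = (i + 1 : ℕ) / N := by push_cast; rw [add_div]
  rw [e1, e2, div_div_eq_mul_div, div_one, mul_comm _ (N : ℝ)] at key
  rw [e1]
  have hv3 := abs_mul_le_mul (le_of_eq (abs_of_nonneg (by positivity : 0 ≤ (1 / N : ℝ) ^ 2))) hv1
  have hv3 := abs_le.1 hv3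
  have key := abs_le.1 key
  unfold velocityBound
  change |cellMean (fun θ => flux ρ (X t θ) (deriv (X t) θ) (deriv (deriv (X t)) θ)) _ _ - _ - _| ≤ _
  rw [abs_le]
  constructor <;> linarith [key.1, key.2, hv3.1, hv3.2]

end RegularFlow

/-- Coercivity of the symmetric part of the discrete flux and smallness of the antisymmetric
part, for the difference of two configurations. -/
theorem NiceDensity.face_difference {ρ : ℝ → ℝ} {ε M m B h p q p' q' : ℝ} (H : NiceDensity ρ ε M)
    (h0 : 0 < h) (hm : 0 < m) (hmB : m ≤ B) (hd1 : h * m / 2 ≤ q' - p')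
    (hd2 : |q' - p'| ≤ B * h) (hp : |p - p'| ≤ h * m / 8) (hq : |q - q'| ≤ h * m / 8) :
    m * h / 16 * ((q - p) - (q' - p')) ^ 2
        - B ^ 2 * h ^ 2 * ε / 4 * (|p - p'| + |q - q'|) * |(q - p) - (q' - p')| ≤
      ((q - p) ^ 2 * (kern ρ p q + kern ρ q p) - (q' - p') ^ 2 * (kern ρ p' q' + kern ρ q' p'))
        * ((q - p) - (q' - p')) ∧
    |(q - p) ^ 2 * (kern ρ p q - kern ρ q p) - (q' - p') ^ 2 * (kern ρ p' q' - kern ρ q' p')| ≤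
      ε * (B ^ 2 * h ^ 2 * |(q - p) - (q' - p')| + B ^ 3 * h ^ 3 * (|p - p'| + |q - q'|)) := by
  have hε := H.eps_nonneg
  have hB : 0 < B := hm.trans_le hmB
  set δ := (q - p) - (q' - p') with hδ
  set a := |p - p'| + |q - q'| with ha
  have ha0 : 0 ≤ a := by positivity
  have hδa : |δ| ≤ a := by
    rw [show δ = -(p - p') + (q - q') by rw [hδ]; ring, ha, ← abs_neg (p - p')]
    exact abs_add_le _ _
  have hδ1 := abs_le.1 (hδa.trans (by linarith : a ≤ h * m / 4))
  have hmBh : h * m ≤ B * h := by rw [mul_comm]; gcongr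
  have hsum : h * m / 2 ≤ (q - p) + (q' - p') := by linarith [hδ1.1]
  have hdd : |q - p| ≤ 2 * B * h := by
    have : |q - p| ≤ |δ| + |q' - p'| := by
      rw [show q - p = δ + (q' - p') by rw [hδ]; ring]; exact abs_add_le _ _
    linarith
  have hd2' : |(q' - p') ^ 2| ≤ (B * h) ^ 2 := by rw [abs_pow]; gcongr
  constructor
  · have k1 := (H.kern_bounds p q).1
    have k2 := (H.kern_bounds q p).1
    have k3 := H.abs_kern_sub_le p q p' q'
    have k4 := H.abs_kern_sub_le q p q' p'
    have k5 : |(kern ρ p q + kern ρ q p) - (kern ρ p' q' + kern ρ q' p')| ≤ ε * a / 4 := by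
      rw [add_sub_add_comm]
      refine (abs_add_le _ _).trans ?_
      rw [ha]; linarith
    have k6 := (abs_le.1 (abs_mul_le_mul (abs_mul_le_mul hd2' k5) (le_refl |δ|))).1
    have e : ((q - p) ^ 2 * (kern ρ p q + kern ρ q p) - (q' - p') ^ 2 * (kern ρ p' q' +
        kern ρ q' p'))
        * δ = δ ^ 2 * (((q - p) + (q' - p')) * (kern ρ p q + kern ρ q p)) +
        (q' - p') ^ 2 * ((kern ρ p q + kern ρ q p) - (kern ρ p' q' + kern ρ q' p')) * δ := by
      rw [hδ]; ring
    have k7 : h * m / 2 * (1 / 8) ≤ ((q - p) + (q' - p')) * (kern ρ p q + kern ρ q p) :=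
      mul_le_mul hsum (by linarith) (by norm_num) (le_trans (by positivity) hsum)
    have k8 := mul_le_mul_of_nonneg_left k7 (sq_nonneg δ)
    rw [e]
    linarith
  · have k1 := H.abs_kern_antisymm_le p q
    have k2 := H.abs_kern_antisymm_sub_le p q p' q'
    have hmid : |(p + q) / 2 - (p' + q') / 2| ≤ a / 2 := by
      rw [show (p + q) / 2 - (p' + q') / 2 = ((p - p') + (q - q')) / 2 by ring, abs_div, abs_two,
          ha]
      gcongr; exact abs_add_le _ _
    have hss : |(q - p) + (q' - p')| ≤ 3 * B * h := (abs_add_le _ _).trans (by linarith)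
    have k3 : |kern ρ p q - kern ρ q p| ≤ ε * (2 * B * h) / 8 := k1.trans (by gcongr)
    have k4 : |(kern ρ p q - kern ρ q p) - (kern ρ p' q' - kern ρ q' p')| ≤
        ε * (|δ| + (B * h) * (a / 2)) / 8 := k2.trans (by rw [← hδ]; gcongr)
    have k5 := abs_mul_le_mul (abs_mul_le_mul (le_refl |δ|) hss) k3
    have k6 := abs_mul_le_mul hd2' k4
    have e : (q - p) ^ 2 * (kern ρ p q - kern ρ q p) - (q' - p') ^ 2 * (kern ρ p' q' - kern ρ q' p')
        = δ * ((q - p) + (q' - p')) * (kern ρ p q - kern ρ q p) + (q' - p') ^ 2 *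
        ((kern ρ p q - kern ρ q p) - (kern ρ p' q' - kern ρ q' p')) := by rw [hδ]; ring
    rw [e]
    refine (abs_add_le _ _).trans ?_
    have p1 : 0 ≤ ε * (B ^ 2 * h ^ 2 * |δ|) := by positivity
    have p2 : 0 ≤ ε * (B ^ 3 * h ^ 3 * a) := by positivity
    linarith

/-- Discrete symmetric flux at a face. -/
noncomputable def symmDiscrete (ρ : ℝ → ℝ) (h p q : ℝ) : ℝ :=
  (q - p) ^ 2 * (kern ρ p q + kern ρ q p) / h ^ 3

/-- Discrete antisymmetric flux at a face. -/
noncomputable def skewDiscrete (ρ : ℝ → ℝ) (h p q : ℝ) : ℝ :=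
  (q - p) ^ 2 * (kern ρ p q - kern ρ q p) / h ^ 3

/-- Flux estimates at one face, for a configuration close to a consistent one. -/
theorem Profile.face_estimate {ρ f : ℝ → ℝ} {ε m M h θ p q p' q' : ℝ} (H : Profile ρ f ε m M)
    (h0 : 0 < h) (h1 : h ≤ 1) (hsmall : 8 * M ^ 2 * h ^ 2 ≤ m / 2) (hθ : θ ∈ Icc (0 : ℝ) 1)
    (hgap : |q' - p' - h * deriv f θ| ≤ 8 * M ^ 2 * h ^ 3)
    (hmid : |(p' + q') / 2 - f θ| ≤ 4 * M ^ 2 * h ^ 2)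
    (hp : |p - p'| ≤ h * m / 8) (hq : |q - q'| ≤ h * m / 8) :
    m / 16 * (((q - q') - (p - p')) / h) ^ 2
        - (9 * M ^ 2) ^ 2 * ε / 4 * (|p - p'| + |q - q'|) * |((q - q') - (p - p')) / h|
        - 3 * (9 * M ^ 2) ^ 4 * h ^ 2 * |((q - q') - (p - p')) / h| ≤
      (symmDiscrete ρ h p q - symmFlux ρ f θ / h) * ((q - q') - (p - p')) ∧
    |skewDiscrete ρ h p q + skewFlux ρ f θ / 24| ≤
      ε * ((9 * M ^ 2) ^ 2 * |((q - q') - (p - p')) / h|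
        + (9 * M ^ 2) ^ 3 * (|p - p'| + |q - q'|)) + (9 * M ^ 2) ^ 6 * h ^ 2 := by
  have hM := H.one_le
  have hm := H.m_pos
  have hmp := H.deriv_ge θ hθ
  have hP := H.deriv_le θ hθ
  have hmM : m ≤ M := (hmp.trans (le_abs_self _)).trans hP
  set B := 9 * M ^ 2 with hB
  have hMM : M ≤ M ^ 2 := by nlinarith
  have hMB : M ≤ B := by linarith
  have hB1 : 1 ≤ B := by linarith
  have h32 : 8 * M ^ 2 * h ^ 3 ≤ m / 2 * h := by
    linarith [mul_le_mul_of_nonneg_right hsmall h0.le]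
  have hlow : h * m / 2 ≤ q' - p' := by
    have := (abs_le.1 hgap).1
    have := mul_le_mul_of_nonneg_left hmp h0.le
    linarith
  have hh3 : h ^ 3 ≤ h := by simpa using pow_le_pow_of_le_one h0.le h1 (by norm_num : 1 ≤ 3)
  have hup : |q' - p'| ≤ B * h := by
    have e : |q' - p'| ≤ |q' - p' - h * deriv f θ| + |h * deriv f θ| := by
      simpa using abs_add_le (q' - p' - h * deriv f θ) (h * deriv f θ)
    have e2 : |h * deriv f θ| ≤ h * M := by rw [abs_mul, abs_of_pos h0]; gcongr
    have e3 : 8 * M ^ 2 * h ^ 3 ≤ 8 * M ^ 2 * h := by gcongr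
    have e4 : h * M ≤ h * M ^ 2 := by gcongr
    rw [hB]; linarith
  have hh2 : 0 ≤ M ^ 2 * h ^ 2 := by positivity
  have hh3' : 0 ≤ M ^ 2 * h ^ 3 := by positivity
  obtain ⟨c1, c2⟩ := H.density.face_consistency H.eps_le hB1 hMB h0 (hP.trans hMB) hup
    (hgap.trans (by rw [hB]; linarith)) (hmid.trans (by rw [hB]; linarith))
  obtain ⟨d1, d2⟩ := H.density.face_difference h0 hm (hmM.trans hMB) hlow hup hp hq
  rw [show (q - p) - (q' - p') = (q - q') - (p - p') by ring] at d1 d2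
  set δ := (q - q') - (p - p') with hδ
  set a := |p - p'| + |q - q'| with ha
  have hh : (0 : ℝ) < h ^ 3 := by positivity
  have eδ : δ = δ / h * h := by field_simp
  set D := δ / h with hD
  have eabs : |δ| = |D| * h := by rw [eδ, abs_mul, abs_of_pos h0]
  constructor
  · have k := (abs_le.1 (abs_mul_le_mul c1 (le_refl |δ|))).1
    have key : (m / 16 * D ^ 2 - B ^ 2 * ε / 4 * a * |D| - 3 * B ^ 4 * h ^ 2 * |D|) * h ^ 3 ≤
        ((q - p) ^ 2 * (kern ρ p q + kern ρ q p) - h ^ 2 * (ρ (f θ) * deriv f θ ^ 2 / 4)) * δ := by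
      rw [eabs] at d1 k
      have : δ ^ 2 = D ^ 2 * h ^ 2 := by rw [eδ]; ring
      rw [this] at d1
      linarith
    have e : (symmDiscrete ρ h p q - symmFlux ρ f θ / h) * δ =
        ((q - p) ^ 2 * (kern ρ p q + kern ρ q p) -
            h ^ 2 * (ρ (f θ) * deriv f θ ^ 2 / 4)) * δ / h ^ 3 := by
      unfold symmDiscrete symmFlux; field_simp
    rw [e, le_div_iff₀ hh]
    exact key
  · have e : skewDiscrete ρ h p q + skewFlux ρ f θ / 24 =
        ((q - p) ^ 2 * (kern ρ p q - kern ρ q p) +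
            h ^ 3 * (deriv ρ (f θ) * deriv f θ ^ 3) / 24) / h ^ 3 := by
      unfold skewDiscrete skewFlux; field_simp
    rw [e, abs_div, abs_of_pos hh, div_le_iff₀ hh]
    rw [eabs] at d2
    have d2 := abs_le.1 d2
    have c2 := abs_le.1 c2
    rw [abs_le]
    constructor <;> linarith [c2.1, c2.2, d2.1, d2.2]

theorem mul_le_weighted {a b c : ℝ} (hc : 0 < c) : a * b ≤ c * a ^ 2 + b ^ 2 / (4 * c) := by
  have h : c * a ^ 2 + b ^ 2 / (4 * c) - a * b = (2 * c * a - b) ^ 2 / (4 * c) := by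
    field_simp; ring
  have : 0 ≤ (2 * c * a - b) ^ 2 / (4 * c) := by positivity
  linarith

/-- Discrete Poincaré inequality for sequences extended by odd reflection. -/
theorem discrete_poincare {N : ℕ} {E : ℕ → ℝ} (hE : E 0 = -E 1) :
    ∑ i ∈ Finset.range N, E (i + 1) ^ 2 ≤ ∑ j ∈ Finset.range N, (N * (E (j + 1) - E j)) ^ 2 := by
  have h1 : ∀ i, |E (i + 1)| ≤ ∑ j ∈ Finset.range (i + 1), |E (j + 1) - E j| := by
    intro i
    induction i with
    | zero =>
      rw [zero_add, Finset.sum_range_one, hE, show E 1 - -E 1 = 2 * E 1 by ring, abs_mul, abs_two]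
      linarith [abs_nonneg (E 1)]
    | succ i ih =>
      rw [Finset.sum_range_succ]
      have := abs_add_le (E (i + 1)) (E (i + 1 + 1) - E (i + 1))
      rw [add_sub_cancel] at this
      linarith
  have h2 : ∀ i ∈ Finset.range N, E (i + 1) ^ 2 ≤
      N * ∑ j ∈ Finset.range N, (E (j + 1) - E j) ^ 2 := by
    intro i hi
    rw [Finset.mem_range] at hi
    have h3 : |E (i + 1)| ≤ ∑ j ∈ Finset.range N, |E (j + 1) - E j| :=
      (h1 i).trans (Finset.sum_le_sum_of_subset_of_nonneg
        (Finset.range_subset_range.2 hi) fun _ _ _ => abs_nonneg _)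
    have h4 := sq_sum_le_card_mul_sum_sq (s := Finset.range N) (f := fun j => |E (j + 1) - E j|)
    simp only [sq_abs, Finset.card_range] at h4
    rw [← sq_abs]
    exact (pow_le_pow_left₀ (abs_nonneg _) h3 2).trans h4
  have h5 := Finset.sum_le_sum h2
  rw [Finset.sum_const, Finset.card_range, nsmul_eq_mul] at h5
  simp only [mul_pow, ← Finset.mul_sum]
  linarith

/-- Remainder constant of the discrete energy inequality. -/
noncomputable def energyConst (m B T : ℝ) : ℝ :=
  (144 * B ^ 8 + 1024 * B ^ 12 + 256 * T ^ 2) / m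

theorem sum_reflected_sq_le {N : ℕ} {E : ℕ → ℝ} (hN : 1 ≤ N) (hE : E 0 = -E 1)
    (hE' : E (N + 1) = -E N) :
    ∑ i ∈ Finset.range N, (E i ^ 2 + 2 * E (i + 1) ^ 2 + E (i + 2) ^ 2) ≤
      6 * ∑ i ∈ Finset.range N, E (i + 1) ^ 2 := by
  have h1 := Finset.sum_range_succ' (fun i => E i ^ 2) N
  have h2 := Finset.sum_range_succ (fun i => E i ^ 2) N
  have h3 := Finset.sum_range_succ' (fun i => E (i + 1) ^ 2) N
  have h4 := Finset.sum_range_succ (fun i => E (i + 1) ^ 2) N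
  have h5 : E 1 ^ 2 ≤ ∑ i ∈ Finset.range N, E (i + 1) ^ 2 :=
    Finset.single_le_sum (f := fun i => E (i + 1) ^ 2) (fun _ _ => sq_nonneg _)
      (Finset.mem_range.2 hN)
  have h6 : E N ^ 2 ≤ ∑ i ∈ Finset.range N, E (i + 1) ^ 2 := by
    have := Finset.single_le_sum (f := fun i => E (i + 1) ^ 2) (s := Finset.range N)
      (fun _ _ => sq_nonneg _) (Finset.mem_range.2 (by lia : N - 1 < N))
    simpa [Nat.sub_add_cancel hN] using this
  rw [hE, neg_sq] at h1
  rw [hE', neg_sq] at h4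
  simp only [zero_add] at h3
  rw [Finset.sum_add_distrib, Finset.sum_add_distrib, ← Finset.mul_sum]
  nlinarith [sq_nonneg (E N), sq_nonneg (E 1)]

theorem discrete_energy {N : ℕ} (hN : 1 ≤ N) {m B ε T : ℝ} {E s l τ : ℕ → ℝ} (hm : 0 < m)
    (hB : 1 ≤ B) (hε0 : 0 ≤ ε) (hε : 9 * B ^ 3 * ε ≤ m / 256) (hE : E 0 = -E 1)
    (hE' : E (N + 1) = -E N)
    (hs : ∀ j ≤ N, m / 16 * (N * (E (j + 1) - E j)) ^ 2
        - B ^ 2 * ε / 4 * (|E j| + |E (j + 1)|) * |N * (E (j + 1) - E j)|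
        - 3 * B ^ 4 * (1 / N : ℝ) ^ 2 * |N * (E (j + 1) - E j)| ≤ s j * (E (j + 1) - E j))
    (hl : ∀ j ≤ N, |l j| ≤ ε * (B ^ 2 * |N * (E (j + 1) - E j)| + B ^ 3 * (|E j| + |E (j + 1)|))
        + B ^ 6 * (1 / N : ℝ) ^ 2)
    (hτ : ∀ i < N, |τ i| ≤ T * (1 / N : ℝ) ^ 2) :
    ∑ i ∈ Finset.range N, E (i + 1) * (s (i + 1) - s i + (l (i + 1) + l i) - τ i) ≤
      -(m / 128) * ∑ i ∈ Finset.range N, E (i + 1) ^ 2 + energyConst m B T * (1 / N : ℝ) ^ 3 := by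
  have hN0 : (0 : ℝ) < N := by exact_mod_cast (by lia : 0 < N)
  set h : ℝ := 1 / N with hh
  have h0 : 0 < h := by positivity
  set D : ℕ → ℝ := fun j => N * (E (j + 1) - E j) with hD
  set z : ℕ → ℝ := fun j => s j * (E j + E (j + 1)) / 2 with hz
  have hB23 : B ^ 2 ≤ B ^ 3 := pow_le_pow_right₀ hB (by norm_num)
  have hεB : B ^ 2 * ε ≤ B ^ 3 * ε := by gcongr
  have hsq : ∀ j, (|E j| + |E (j + 1)|) ^ 2 ≤ 2 * (E j ^ 2 + E (j + 1) ^ 2) := fun j => by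
    rw [← sq_abs (E j), ← sq_abs (E (j + 1))]
    linarith [sq_nonneg (|E j| - |E (j + 1)|)]
  have hs' : ∀ j ≤ N, (3 * m / 64 - B ^ 3 * ε / 8) * D j ^ 2
      - B ^ 3 * ε / 4 * (E j ^ 2 + E (j + 1) ^ 2) - 144 * B ^ 8 / m * h ^ 4 ≤
      s j * (E (j + 1) - E j) := by
    intro j hj
    have k := hs j hj
    have k1 := mul_le_weighted (a := |D j|) (b := 3 * B ^ 4 * h ^ 2) (c := m / 64) (by positivity)
    rw [sq_abs] at k1
    have k2 : |D j| * (|E j| + |E (j + 1)|) ≤ (D j ^ 2 + 2 * (E j ^ 2 + E (j + 1) ^ 2)) / 2 := by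
      have := sq_nonneg (|D j| - (|E j| + |E (j + 1)|))
      have := hsq j
      rw [← sq_abs (D j)]
      linarith
    have k3 := mul_le_mul_of_nonneg_left k2 (by positivity : 0 ≤ B ^ 2 * ε / 4)
    have k4 := mul_le_mul_of_nonneg_right hεB
      (by positivity : 0 ≤ D j ^ 2 + 2 * (E j ^ 2 + E (j + 1) ^ 2))
    have e : (3 * B ^ 4 * h ^ 2) ^ 2 / (4 * (m / 64)) = 144 * B ^ 8 / m * h ^ 4 := by
      field_simp; ring
    rw [e] at k1
    change m / 16 * D j ^ 2 - B ^ 2 * ε / 4 * (|E j| + |E (j + 1)|) * |D j| -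
      3 * B ^ 4 * h ^ 2 * |D j| ≤ _ at k
    linarith
  have hl' : ∀ j ≤ N, ∀ e : ℝ, e * l j ≤ B ^ 3 * ε / 2 * (2 * e ^ 2 + D j ^ 2
      + 2 * (E j ^ 2 + E (j + 1) ^ 2)) + m / 2048 * e ^ 2 + 512 * B ^ 12 / m * h ^ 4 := by
    intro j hj e
    have k := mul_le_mul_of_nonneg_left (hl j hj) (abs_nonneg e)
    rw [← abs_mul] at k
    have k0 := (le_abs_self _).trans k
    have k1 := mul_le_weighted (a := |e|) (b := B ^ 6 * h ^ 2) (c := m / 2048) (by positivity)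
    rw [sq_abs] at k1
    have e1 : (B ^ 6 * h ^ 2) ^ 2 / (4 * (m / 2048)) = 512 * B ^ 12 / m * h ^ 4 := by
      field_simp; ring
    rw [e1] at k1
    have k2 : |e| * |D j| ≤ (e ^ 2 + D j ^ 2) / 2 := by
      rw [← sq_abs e, ← sq_abs (D j)]; linarith [sq_nonneg (|e| - |D j|)]
    have k3 : |e| * (|E j| + |E (j + 1)|) ≤ (e ^ 2 + 2 * (E j ^ 2 + E (j + 1) ^ 2)) / 2 := by
      have := hsq j
      rw [← sq_abs e]; linarith [sq_nonneg (|e| - (|E j| + |E (j + 1)|))]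
    have k4 := mul_le_mul_of_nonneg_left k2 (by positivity : 0 ≤ B ^ 2 * ε)
    have k5 := mul_le_mul_of_nonneg_left k3 (by positivity : 0 ≤ B ^ 3 * ε)
    have k6 := mul_le_mul_of_nonneg_right hεB (by positivity : 0 ≤ (e ^ 2 + D j ^ 2))
    change e * l j ≤ |e| * (ε * (B ^ 2 * |D j| + B ^ 3 * (|E j| + |E (j + 1)|)) +
        B ^ 6 * h ^ 2) at k0
    linarith
  have hcell : ∀ i ∈ Finset.range N, E (i + 1) * (s (i + 1) - s i + (l (i + 1) + l i) - τ i) ≤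
      (z (i + 1) - z i) - m / 64 * D i ^ 2
        + 9 / 8 * (B ^ 3 * ε) * (E i ^ 2 + 2 * E (i + 1) ^ 2 + E (i + 2) ^ 2)
        + (2 * (B ^ 3 * ε) + m / 512) * E (i + 1) ^ 2 + energyConst m B T * h ^ 4 := by
    intro i hi
    rw [Finset.mem_range] at hi
    have a1 := hs' i hi.le
    have a2 := hs' (i + 1) hi
    have b1 := hl' i hi.le (E (i + 1))
    have b2 := hl' (i + 1) hi (E (i + 1))
    have c1 := mul_le_mul_of_nonneg_left (hτ i hi) (abs_nonneg (E (i + 1)))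
    rw [← abs_mul] at c1
    have c1 := (abs_le.1 c1).1
    have c2 := mul_le_weighted (a := |E (i + 1)|) (b := T * h ^ 2) (c := m / 1024) (by positivity)
    rw [sq_abs] at c2
    have e1 : (T * h ^ 2) ^ 2 / (4 * (m / 1024)) = 256 * T ^ 2 / m * h ^ 4 := by
      field_simp; ring
    rw [e1] at c2
    have ez : E (i + 1) * (s (i + 1) - s i) = z (i + 1) - z i
        - (s i * (E (i + 1) - E i) + s (i + 1) * (E (i + 1 + 1) - E (i + 1))) / 2 := by
      simp only [hz]; ring
    have hK : energyConst m B T * h ^ 4 = 144 * B ^ 8 / m * h ^ 4 + 2 * (512 * B ^ 12 / m * h ^ 4)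
        + 256 * T ^ 2 / m * h ^ 4 := by unfold energyConst; ring
    rw [hK]
    have d1 := mul_le_mul_of_nonneg_right (by linarith : 9 / 8 * (B ^ 3 * ε) ≤ m / 64)
      (sq_nonneg (D i))
    have d2 := mul_le_mul_of_nonneg_right (by linarith : 9 / 8 * (B ^ 3 * ε) ≤ m / 64)
      (sq_nonneg (D (i + 1)))
    have d3 : 0 ≤ m * D (i + 1) ^ 2 := by positivity
    change -(|E (i + 1)| * (T * h ^ 2)) ≤ _ at c1
    rw [show i + 2 = i + 1 + 1 from rfl]
    linarith
  refine (Finset.sum_le_sum hcell).trans ?_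
  rw [Finset.sum_add_distrib, Finset.sum_add_distrib, Finset.sum_add_distrib,
    Finset.sum_sub_distrib, Finset.sum_range_sub z, ← Finset.mul_sum, ← Finset.mul_sum,
    ← Finset.mul_sum, Finset.sum_const, Finset.card_range, nsmul_eq_mul]
  have hz0 : z 0 = 0 := by simp [hz, hE]
  have hzN : z N = 0 := by simp [hz, hE']
  have hp := discrete_poincare (N := N) hE
  have hr := sum_reflected_sq_le hN hE hE'
  have hS : 0 ≤ ∑ i ∈ Finset.range N, E (i + 1) ^ 2 := Finset.sum_nonneg fun _ _ => sq_nonneg _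
  have hK : N * (energyConst m B T * h ^ 4) = energyConst m B T * h ^ 3 := by
    rw [hh]; field_simp
  rw [hK, hz0, hzN]
  have q1 := mul_le_mul_of_nonneg_left hp (by positivity : 0 ≤ m / 64)
  have q2 := mul_le_mul_of_nonneg_left hr (by positivity : 0 ≤ 9 / 8 * (B ^ 3 * ε))
  have q3 := mul_le_mul_of_nonneg_right hε hS
  change m / 64 * _ ≤ m / 64 * ∑ j ∈ Finset.range N, D j ^ 2 at q1
  have q4 : 0 ≤ m * ∑ i ∈ Finset.range N, E (i + 1) ^ 2 := by positivity
  have q5 : 0 ≤ B ^ 3 * ε * ∑ i ∈ Finset.range N, E (i + 1) ^ 2 := by positivity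
  linarith

/-- Trajectories of the rescaled discrete quantization flow. -/
def DiscreteFlow (ρ : ℝ → ℝ) (N : ℕ) (x : ℝ → ℕ → ℝ) : Prop :=
  ∀ t, 0 ≤ t → ∀ i ∈ Finset.Icc 1 N, HasDerivAt (fun s => x s i)
    (2 * (N : ℝ) ^ 3 * ∫ z in ((x t i + pad N (x t) (i - 1)) / 2)..(
      (x t i + pad N (x t) (i + 1)) / 2), (z - x t i) * ρ z) t

theorem cell_force_eq {ρ : ℝ → ℝ} (hρ : Continuous ρ) (p u q : ℝ) :
    ∫ z in ((u + p) / 2)..((u + q) / 2), (z - u) * ρ z =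
      (q - u) ^ 2 * kern ρ u q - (p - u) ^ 2 * kern ρ u p := by
  have hi : ∀ a b, IntervalIntegrable (fun z => (z - u) * ρ z) volume a b := fun a b =>
    Continuous.intervalIntegrable (by fun_prop) _ _
  rw [← halfCell_eq, ← halfCell_eq,
    ← intervalIntegral.integral_interval_sub_left (hi u _) (hi u _)]

theorem DiscreteFlow.velocity {ρ : ℝ → ℝ} (hρ : Continuous ρ) {N : ℕ} {x : ℝ → ℕ → ℝ}
    (hx : DiscreteFlow ρ N x) {t : ℝ} (ht : 0 ≤ t) {i : ℕ} (hi : i < N) :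
    HasDerivAt (fun s => x s (i + 1))
      (symmDiscrete ρ (1 / N) (pad N (x t) (i + 1)) (pad N (x t) (i + 2))
        + skewDiscrete ρ (1 / N) (pad N (x t) (i + 1)) (pad N (x t) (i + 2))
        - symmDiscrete ρ (1 / N) (pad N (x t) i) (pad N (x t) (i + 1))
        + skewDiscrete ρ (1 / N) (pad N (x t) i) (pad N (x t) (i + 1))) t := by
  have hmem : i + 1 ∈ Finset.Icc 1 N := Finset.mem_Icc.2 ⟨by lia, by lia⟩
  have hN : (N : ℝ) ≠ 0 := by exact_mod_cast (by lia : N ≠ 0)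
  refine (hx t ht (i + 1) hmem).congr_deriv ?_
  rw [cell_force_eq hρ, pad_mid _ hmem, Nat.add_sub_cancel]
  unfold symmDiscrete skewDiscrete
  field_simp
  ring

/-- Discrete energy estimate for the distance to the comparison configuration. -/
theorem RegularFlow.hasDerivAt_energy {ρ : ℝ → ℝ} {X : ℝ → ℝ → ℝ} {ε K a A B : ℝ}
    (h : RegularFlow ρ X ε K a A B) {N : ℕ} (hN : 1 ≤ N) {x : ℝ → ℕ → ℝ}
    (hx : DiscreteFlow ρ N x) {m M : ℝ} (hm : m = a / 3) (hM : M = profileBound K a A B)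
    (hε : 9 * (9 * M ^ 2) ^ 3 * ε ≤ m / 256) (hsmall : 8 * M ^ 2 * (1 / N : ℝ) ^ 2 ≤ m / 2)
    {t : ℝ} (ht : 0 < t)
    (hS : ∑ i ∈ Finset.range N, (x t (i + 1) - comparator ρ (X t) N (i + 1)) ^ 2 ≤
      (1 / N * m / 8 : ℝ) ^ 2) :
    ∃ d, d ≤ -(m / 64) * ∑ i ∈ Finset.range N, (x t (i + 1) - comparator ρ (X t) N (i + 1)) ^ 2
        + 2 * energyConst m (9 * M ^ 2) (velocityBound K a A B) * (1 / N : ℝ) ^ 3 ∧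
      HasDerivAt (fun s => ∑ i ∈ Finset.range N,
        (x s (i + 1) - comparator ρ (X s) N (i + 1)) ^ 2) d t := by
  have H : Profile ρ (X t) ε m M := hm ▸ hM ▸ h.profile ht.le
  have hM1 := H.one_le
  have hm0 := H.m_pos
  have hN0 : (0 : ℝ) < N := by exact_mod_cast (by lia : 0 < N)
  have hh1 : (1 : ℝ) / N ≤ 1 := (div_le_one hN0).2 (by exact_mod_cast hN)
  set w : ℝ := 1 / N with hw
  have hw0 : 0 < w := by positivity
  have hNw : (N : ℝ) = 1 / w := by rw [hw]; simp
  set Y := comparator ρ (X t) N with hY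
  set p := pad N (x t) with hp
  set q := pad N Y with hq
  set E : ℕ → ℝ := fun j => p j - q j with hE
  have hmid : ∀ i < N, p (i + 1) = x t (i + 1) ∧ q (i + 1) = Y (i + 1) := fun i hi =>
    have : i + 1 ∈ Finset.Icc 1 N := Finset.mem_Icc.2 ⟨by lia, by lia⟩
    ⟨pad_mid _ this, pad_mid _ this⟩
  have hN' : N - 1 + 1 = N := by lia
  have hE0 : E 0 = - E 1 := by
    have h1 := hmid 0 (by lia)
    have h2 := pad_zero N (x t)
    have h3 := pad_zero N Y
    rw [← h1.1] at h2
    rw [← h1.2] at h3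
    change p 0 - q 0 = -(p 1 - q 1)
    linarith
  have hEN : E (N + 1) = - E N := by
    have h1 := hmid (N - 1) (by lia)
    rw [hN'] at h1
    have h2 := pad_last N (x t)
    have h3 := pad_last N Y
    rw [← h1.1] at h2
    rw [← h1.2] at h3
    change p (N + 1) - q (N + 1) = -(p N - q N)
    linarith
  have hsum : ∑ i ∈ Finset.range N, E (i + 1) ^ 2 =
      ∑ i ∈ Finset.range N, (x t (i + 1) - Y (i + 1)) ^ 2 :=
    Finset.sum_congr rfl fun i hi => by
      have := hmid i (Finset.mem_range.1 hi)
      simp only [hE, this.1, this.2]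
  have hEi : ∀ i < N, |E (i + 1)| ≤ w * m / 8 := fun i hi => by
    refine _root_.abs_le_of_sq_le_sq ?_ (by positivity)
    refine le_trans ?_ (hsum.trans_le hS)
    exact Finset.single_le_sum (f := fun i => E (i + 1) ^ 2) (fun _ _ => sq_nonneg _)
      (Finset.mem_range.2 hi)
  have hEj : ∀ j ≤ N + 1, |E j| ≤ w * m / 8 := fun j hj => by
    rcases Nat.eq_zero_or_pos j with rfl | hj0
    · rw [hE0, abs_neg]; exact hEi 0 (by lia)
    · rcases hj.eq_or_lt with rfl | hj1
      · rw [hEN, abs_neg, ← hN']; exact hEi (N - 1) (by lia)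
      · have := hEi (j - 1) (by lia)
        rwa [Nat.sub_add_cancel hj0] at this
  set s : ℕ → ℝ := fun j => symmDiscrete ρ w (p j) (p (j + 1))
    - Profile.symmFlux ρ (X t) (j / N) / w with hs
  set l : ℕ → ℝ := fun j => skewDiscrete ρ w (p j) (p (j + 1))
    + Profile.skewFlux ρ (X t) (j / N) / 24 with hl
  have hv : ∀ i, ∃ v, i < N → HasDerivAt (fun s => comparator ρ (X s) N (i + 1)) v t ∧
      |v - (N * (Profile.symmFlux ρ (X t) ((i + 1 : ℕ) / N) - Profile.symmFlux ρ (X t) (i / N))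
        - (Profile.skewFlux ρ (X t) (i / N) + Profile.skewFlux ρ (X t) ((i + 1 : ℕ) / N)) / 24)| ≤
        velocityBound K a A B * w ^ 2 := fun i => by
    by_cases hi : i < N
    · obtain ⟨v, hv⟩ := h.hasDerivAt_comparator ht (Finset.mem_Icc.2 ⟨by lia, hi⟩ :
        i + 1 ∈ Finset.Icc 1 N)
      exact ⟨v, fun _ => hv⟩
    · exact ⟨0, fun h' => (hi h').elim⟩
  choose v hv using hv
  set τ : ℕ → ℝ := fun i => v i -
    (N * (Profile.symmFlux ρ (X t) ((i + 1 : ℕ) / N) - Profile.symmFlux ρ (X t) (i / N))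
        - (Profile.skewFlux ρ (X t) (i / N) + Profile.skewFlux ρ (X t) ((i + 1 : ℕ) / N)) / 24)
    with hτ
  have hface : ∀ j ≤ N, m / 16 * (N * (E (j + 1) - E j)) ^ 2
        - (9 * M ^ 2) ^ 2 * ε / 4 * (|E j| + |E (j + 1)|) * |N * (E (j + 1) - E j)|
        - 3 * (9 * M ^ 2) ^ 4 * w ^ 2 * |N * (E (j + 1) - E j)| ≤ s j * (E (j + 1) - E j) ∧
      |l j| ≤ ε * ((9 * M ^ 2) ^ 2 * |N * (E (j + 1) - E j)|
        + (9 * M ^ 2) ^ 3 * (|E j| + |E (j + 1)|)) + (9 * M ^ 2) ^ 6 * w ^ 2 := fun j hj => by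
    have hθ : (j / N : ℝ) ∈ Icc (0 : ℝ) 1 :=
      ⟨by positivity, (div_le_one hN0).2 (by exact_mod_cast hj)⟩
    obtain ⟨hg, hmd⟩ := H.comparator_face hN hj
    have key := H.face_estimate hw0 hh1 hsmall hθ hg hmd (hEj j (by lia)) (hEj (j + 1) (by lia))
    have e : N * (E (j + 1) - E j) =
        (p (j + 1) - q (j + 1) - (p j - q j)) / w := by
      rw [hNw]; simp only [hE]; ring
    rw [e]
    exact key
  have main := discrete_energy hN hm0 (by nlinarith : 1 ≤ 9 * M ^ 2) H.density.eps_nonneg hε hE0 hEN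
    (fun j hj => (hface j hj).1) (fun j hj => (hface j hj).2) (τ := τ) (fun i hi => (hv i hi).2)
  refine ⟨_, ?_, HasDerivAt.fun_sum fun i hi =>
    ((hx.velocity H.density.continuous ht.le (Finset.mem_range.1 hi)).fun_sub
      (hv i (Finset.mem_range.1 hi)).1).fun_pow 2⟩
  rw [hsum] at main
  refine le_trans (le_of_eq ?_) (by linarith [mul_le_mul_of_nonneg_left main zero_le_two] :
    2 * ∑ i ∈ Finset.range N, E (i + 1) * (s (i + 1) - s i + (l (i + 1) + l i) - τ i) ≤ _)
  rw [Finset.mul_sum]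
  refine Finset.sum_congr rfl fun i hi => ?_
  have hi' := hmid i (Finset.mem_range.1 hi)
  have hc : comparator ρ (X t) N (i + 1) = q (i + 1) := hi'.2.symm
  have hdiv : ∀ y : ℝ, y / w = N * y := fun y => by rw [hw]; field_simp
  rw [hc, ← hi'.1]
  simp only [hE, hs, hl, hτ, hdiv, ← hp]
  push_cast
  ring

theorem sum_Icc_one_eq (N : ℕ) (f : ℕ → ℝ) :
    ∑ i ∈ Finset.Icc 1 N, f i = ∑ i ∈ Finset.range N, f (i + 1) := by
  rw [← Finset.Ico_add_one_right_eq_Icc, Finset.sum_Ico_eq_sum_range]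
  simp [add_comm]

theorem energyConst_nonneg {m B T : ℝ} (hm : 0 < m) : 0 ≤ energyConst m B T := by
  unfold energyConst; positivity

/-- Uniform closeness on fine grids. -/
theorem RegularFlow.closeness_of_fine {ρ : ℝ → ℝ} {X : ℝ → ℝ → ℝ} {ε K a A B : ℝ}
    (h : RegularFlow ρ X ε K a A B) {N : ℕ} (hN : 1 ≤ N) {x : ℝ → ℕ → ℝ}
    (hx : DiscreteFlow ρ N x) {m M C C' : ℝ} (hm : m = a / 3) (hM : M = profileBound K a A B)
    (hε : 9 * (9 * M ^ 2) ^ 3 * ε ≤ m / 256) (hsmall : 8 * M ^ 2 * (1 / N : ℝ) ^ 2 ≤ m / 2)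
    (hC' : 0 < C') (hC1 : (C' + 4 * M ^ 2) ^ 2 ≤ C)
    (hC2 : 128 * energyConst m (9 * M ^ 2) (velocityBound K a A B) ≤ m * C)
    (hbig : 2 * C * (1 / N : ℝ) ^ 3 ≤ (1 / N * m / 8 : ℝ) ^ 2)
    (h0 : ∀ i ∈ Finset.Icc 1 N, |X 0 (grid N i) - x 0 i| ≤ C' / (N : ℝ) ^ 2) {t : ℝ} (ht : 0 ≤ t) :
    (1 / (N : ℝ)) * ∑ i ∈ Finset.Icc 1 N, (x t i - X t (grid N i)) ^ 2 ≤
      (2 * C + 32 * M ^ 4) / (N : ℝ) ^ 4 := by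
  have hP : ∀ t, 0 ≤ t → Profile ρ (X t) ε m M := fun t ht => hm ▸ hM ▸ h.profile ht
  have hM1 := (hP 0 le_rfl).one_le
  have hm0 := (hP 0 le_rfl).m_pos
  have hN0 : (0 : ℝ) < N := by exact_mod_cast (by lia : 0 < N)
  have hmem : ∀ i ∈ Finset.range N, i + 1 ∈ Finset.Icc 1 N := fun i hi =>
    Finset.mem_Icc.2 ⟨by lia, Finset.mem_range.1 hi⟩
  have hC0 : 0 < C := lt_of_lt_of_le (by positivity) hC1
  set w : ℝ := 1 / N with hw
  have hw0 : 0 < w := by positivity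
  have hNw : (N : ℝ) * w = 1 := by rw [hw]; field_simp
  set S : ℝ → ℝ := fun s => ∑ i ∈ Finset.range N,
    (x s (i + 1) - comparator ρ (X s) N (i + 1)) ^ 2 with hS
  have hcont : ContinuousOn (fun s => S s - C * w ^ 3) (Ici 0) := by
    refine ContinuousOn.sub (continuousOn_finsetSum _ fun i hi => ?_) continuousOn_const
    refine ContinuousOn.pow (ContinuousOn.sub (fun s hs => ?_) (h.continuousOn_comparator (hmem i hi))) 2
    exact (hx s hs (i + 1) (hmem i hi)).continuousAt.continuousWithinAt
  have hinit : S 0 - C * w ^ 3 ≤ 0 := by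
    have : ∀ i ∈ Finset.range N, (x 0 (i + 1) - comparator ρ (X 0) N (i + 1)) ^ 2 ≤ C * w ^ 4 := by
      intro i hi
      have h1 := (hP 0 le_rfl).abs_comparator_sub_grid (hmem i hi)
      have h2 := h0 (i + 1) (hmem i hi)
      have e : C' / (N : ℝ) ^ 2 = C' * w ^ 2 := by rw [hw]; field_simp
      rw [e] at h2
      have h3 : |x 0 (i + 1) - comparator ρ (X 0) N (i + 1)| ≤ (C' + 4 * M ^ 2) * w ^ 2 := by
        have k1 := _root_.abs_le.1 h1
        have k2 := _root_.abs_le.1 h2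
        rw [_root_.abs_le]
        constructor <;> linarith [k1.1, k1.2, k2.1, k2.2]
      calc _ = |x 0 (i + 1) - comparator ρ (X 0) N (i + 1)| ^ 2 := (sq_abs _).symm
        _ ≤ ((C' + 4 * M ^ 2) * w ^ 2) ^ 2 := by gcongr
        _ = (C' + 4 * M ^ 2) ^ 2 * w ^ 4 := by ring
        _ ≤ C * w ^ 4 := by gcongr
    have h1 := Finset.sum_le_sum this
    rw [Finset.sum_const, Finset.card_range, nsmul_eq_mul] at h1
    have e : (N : ℝ) * (C * w ^ 4) = C * w ^ 3 := by linear_combination C * w ^ 3 * hNw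
    simp only [hS]
    linarith
  have hstay := stays_below (η := C * w ^ 3) (by positivity) hcont hinit (fun t ht h1 h2 => by
    obtain ⟨d, hd, hd'⟩ := h.hasDerivAt_energy hN hx hm hM hε hsmall ht
      (le_trans (by linarith [show S t < 2 * C * w ^ 3 by linarith]) hbig)
    refine ⟨d, hd.trans ?_, hd'.sub_const _⟩
    have h3 : m * (C * w ^ 3) ≤ m * S t := by gcongr; linarith
    have h4 := mul_le_mul_of_nonneg_right hC2 (by positivity : 0 ≤ w ^ 3)
    change -(m / 64) * S t + 2 * _ * w ^ 3 ≤ 0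
    linarith)
  have hfin := hstay t ht
  have hpt : ∀ i ∈ Finset.range N, (x t (i + 1) - X t (grid N (i + 1))) ^ 2 ≤
      2 * (x t (i + 1) - comparator ρ (X t) N (i + 1)) ^ 2 + 32 * M ^ 4 * w ^ 4 := by
    intro i hi
    have h1 := (hP t ht).abs_comparator_sub_grid (hmem i hi)
    have h2 : (comparator ρ (X t) N (i + 1) - X t (grid N (i + 1))) ^ 2 ≤ 16 * M ^ 4 * w ^ 4 := by
      calc _ = |comparator ρ (X t) N (i + 1) - X t (grid N (i + 1))| ^ 2 := (sq_abs _).symm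
        _ ≤ (4 * M ^ 2 * w ^ 2) ^ 2 := by gcongr
        _ = _ := by ring
    linarith [sq_nonneg ((x t (i + 1) - comparator ρ (X t) N (i + 1)) -
      (comparator ρ (X t) N (i + 1) - X t (grid N (i + 1))))]
  have hsum := Finset.sum_le_sum hpt
  rw [Finset.sum_add_distrib, ← Finset.mul_sum, Finset.sum_const, Finset.card_range,
    nsmul_eq_mul] at hsum
  have e : (N : ℝ) * (32 * M ^ 4 * w ^ 4) = 32 * M ^ 4 * w ^ 3 := by
    linear_combination 32 * M ^ 4 * w ^ 3 * hNw
  have e2 : (2 * C + 32 * M ^ 4) / (N : ℝ) ^ 4 = w * ((2 * C + 32 * M ^ 4) * w ^ 3) := by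
    rw [hw]; field_simp
  rw [sum_Icc_one_eq N fun i => (x t i - X t (grid N i)) ^ 2, e2]
  refine mul_le_mul_of_nonneg_left ?_ hw0.le
  change S t - _ ≤ 0 at hfin
  change _ ≤ 2 * S t + _ at hsum
  linarith

theorem le_of_deriv_nonpos {f f' : ℝ → ℝ} {s : ℝ} (hf : ∀ t, s ≤ t → HasDerivAt f (f' t) t)
    (h : ∀ t, s ≤ t → f' t ≤ 0) : ∀ t, s ≤ t → f t ≤ f s := fun t ht => by
  have := stays_below (f := fun t => f t - f s) (t0 := s) (η := 1) one_pos
    (fun u hu => ((hf u hu).continuousAt.sub continuousAt_const).continuousWithinAt) (by simp)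
    (fun u hu _ _ => ⟨f' u, h u hu.le, (hf u hu.le).sub_const _⟩) t ht
  linarith

/-- A global solution of a superlinear differential inequality cannot become large. -/
theorem ratio_lt_of_global {Y E V Γ : ℝ → ℝ} {ν C : ℝ} (hν : 0 < ν) (hC : 0 ≤ C)
    (hY : ∀ t, 0 ≤ t → HasDerivAt Y (2 * ν * V t) t) (hE : ∀ t, 0 ≤ t → HasDerivAt E (ν * Γ t) t)
    (hY1 : ∀ t, 0 ≤ t → 1 ≤ Y t) (hV : ∀ t, 0 ≤ t → |V t - 3 * E t| ≤ C * Y t)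
    (hΓ : ∀ t, 0 ≤ t → V t ^ 2 ≤ Y t * Γ t) {t : ℝ} (ht : 0 ≤ t) : E t < (4 * C + 1) * Y t := by
  by_contra! hcon
  set L : ℝ → ℝ := fun s => E s / Y s with hL
  have hLd : ∀ s, 0 ≤ s → HasDerivAt L ((ν * Γ s * Y s - E s * (2 * ν * V s)) / Y s ^ 2) s :=
    fun s hs => (hE s hs).fun_div (hY s hs) (by linarith [hY1 s hs])
  have hgrow : ∀ s, 0 ≤ s → 4 * C ≤ L s → ν * L s ^ 2 ≤
      (ν * Γ s * Y s - E s * (2 * ν * V s)) / Y s ^ 2 := by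
    intro s hs h1
    have h0 : 0 < Y s := by linarith [hY1 s hs]
    have hEL : E s = L s * Y s := by simp only [hL]; field_simp
    have h2 := (abs_le.1 (hV s hs)).1
    have h3 := hΓ s hs
    rw [hEL] at h2 ⊢
    rw [le_div_iff₀ (by positivity)]
    have h4 : 4 * C * Y s ≤ L s * Y s := by gcongr
    have h7 : 0 ≤ C * Y s := by positivity
    have h5 : (L s * Y s) * (L s * Y s) ≤ (2 * (L s * Y s)) * (V s - 2 * (L s * Y s)) := by
      have h8 : 0 ≤ L s * Y s := by linarith
      have h9 : L s * Y s / 2 ≤ V s - 2 * (L s * Y s) := by linarith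
      linarith [mul_le_mul_of_nonneg_left h9 h8]
    have h6 : (2 * (L s * Y s)) * (V s - 2 * (L s * Y s)) ≤ V s * (V s - 2 * (L s * Y s)) := by
      apply mul_le_mul_of_nonneg_right <;> linarith
    have h8 : (L s * Y s) * (L s * Y s) ≤ Y s * Γ s - L s * Y s * (2 * V s) := by linarith
    linarith [mul_le_mul_of_nonneg_left h8 hν.le]
  have hstart : 4 * C + 1 ≤ L t := by
    simp only [hL]
    rwa [le_div_iff₀ (by linarith [hY1 t ht])]
  have hstay : ∀ s, t ≤ s → 4 * C + 1 ≤ L s := fun s hs => by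
    have := stays_below (f := fun s => 4 * C + 1 - L s) (t0 := t) (η := 1) one_pos
      (fun u hu => (continuousAt_const.sub (hLd u (ht.trans hu)).continuousAt).continuousWithinAt)
      (by linarith) (fun u hu h1 h2 => ⟨_, ?_, (hLd u (ht.trans hu.le)).const_sub _⟩) s hs
    · linarith
    · have := hgrow u (ht.trans hu.le) (by linarith)
      have : 0 ≤ ν * L u ^ 2 := by positivity
      linarith
  have hpos : ∀ s, t ≤ s → 0 < L s := fun s hs => by linarith [hstay s hs]
  have hdec := le_of_deriv_nonpos (f := fun s => (L s)⁻¹ + ν * s)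
    (fun s hs => ((hLd s (ht.trans hs)).fun_inv (hpos s hs).ne').fun_add
      ((hasDerivAt_id s).const_mul ν)) (s := t) (fun s hs => by
      have h1 := hgrow s (ht.trans hs) (by linarith [hstay s hs])
      have h2 := hpos s hs
      rw [mul_one, neg_div]
      have : ν ≤ (ν * Γ s * Y s - E s * (2 * ν * V s)) / Y s ^ 2 / L s ^ 2 := by
        rwa [le_div_iff₀ (by positivity)]
      linarith) (t + (L t)⁻¹ / ν) (by
      have := inv_pos.2 (hpos t le_rfl)
      have : 0 < (L t)⁻¹ / ν := by positivity
      linarith)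
  have h1 := inv_pos.2 (hpos (t + (L t)⁻¹ / ν) (by
    have := inv_pos.2 (hpos t le_rfl)
    have : 0 < (L t)⁻¹ / ν := by positivity
    linarith))
  have h2 : ν * (t + (L t)⁻¹ / ν) = ν * t + (L t)⁻¹ := by field_simp
  simp only [h2] at hdec
  linarith

/-- Growth rate of the moment of inertia along a global solution. -/
noncomputable def growthRate (ν C C1 : ℝ) : ℝ := 2 * ν * (3 * (4 * C + 1 + C1) + C)

/-- Global solutions with coercive dissipation are bounded. -/
theorem bounded_of_global {Y E V Γ : ℝ → ℝ} {ν C C1 Λ R : ℝ} (hν : 0 < ν) (hC : 0 ≤ C)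
    (hC1 : 0 ≤ C1)
    (hY : ∀ t, 0 ≤ t → HasDerivAt Y (2 * ν * V t) t) (hE : ∀ t, 0 ≤ t → HasDerivAt E (ν * Γ t) t)
    (hY1 : ∀ t, 0 ≤ t → 1 ≤ Y t) (hV : ∀ t, 0 ≤ t → |V t - 3 * E t| ≤ C * Y t)
    (hΓ : ∀ t, 0 ≤ t → V t ^ 2 ≤ Y t * Γ t) (hE0 : -C1 ≤ E 0)
    (hΛ : ((4 * C + 1) * Real.exp (growthRate ν C C1) + C1) * Real.exp (growthRate ν C C1) ≤ ν * Λ)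
    (hcoer : ∀ t, 0 ≤ t → R ≤ Y t → -C1 ≤ E t → Λ * Y t ≤ Γ t) {t : ℝ} (ht : 0 ≤ t) :
    Y t ≤ R * Real.exp (growthRate ν C C1) := by
  set β := growthRate ν C C1 with hβ
  by_contra! hcon
  have hK : ∀ s, 0 ≤ s → E s < (4 * C + 1) * Y s := fun s hs =>
    ratio_lt_of_global hν hC hY hE hY1 hV hΓ hs
  have hΓ0 : ∀ s, 0 ≤ s → 0 ≤ Γ s := fun s hs =>
    nonneg_of_mul_nonneg_right ((sq_nonneg _).trans (hΓ s hs)) (by linarith [hY1 s hs])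
  have hElow : ∀ s, 0 ≤ s → -C1 ≤ E s := fun s hs => by
    have := le_of_deriv_nonpos (fun u hu => (hE u hu).fun_neg)
      (fun u hu => by have := hΓ0 u hu; have : 0 ≤ ν * Γ u := by positivity
                      linarith) s hs
    linarith
  have hVb : ∀ s, 0 ≤ s → |2 * ν * V s| ≤ β * Y s := fun s hs => by
    have h1 := abs_le.1 (hV s hs)
    have h2 := hK s hs
    have h3 := hElow s hs
    have h4 := hY1 s hs
    have h5 : C1 ≤ C1 * Y s := le_mul_of_one_le_right hC1 h4
    have h6 : 0 ≤ C * Y s := by positivity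
    rw [abs_mul, abs_of_pos (by positivity : 0 < 2 * ν), hβ, growthRate, mul_assoc (2 * ν)]
    refine mul_le_mul_of_nonneg_left ?_ (by positivity)
    rw [abs_le]
    constructor <;> linarith [h1.1, h1.2]
  have hup : Y (t + 1) ≤ Real.exp β * Y t := by
    have := le_of_deriv_nonpos (f := fun s => Real.exp (-(β * s)) * Y s) (s := t)
      (fun s hs => (((hasDerivAt_id s).const_mul β).fun_neg.exp).fun_mul (hY s (ht.trans hs)))
      (fun s hs => by
        have h1 := (abs_le.1 (hVb s (ht.trans hs))).2
        have h2 := mul_le_mul_of_nonneg_left h1 (Real.exp_pos (-(β * s))).le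
        simp only [id]
        linarith) (t + 1) (by linarith)
    have h2 := mul_le_mul_of_nonneg_left this (Real.exp_pos (β * (t + 1))).le
    rw [← mul_assoc, ← mul_assoc, ← Real.exp_add, ← Real.exp_add] at h2
    simpa [show β * (t + 1) + -(β * t) = β by ring] using h2
  have hβ0 : 0 ≤ β := by
    rw [hβ, growthRate]; positivity
  have hdown : ∀ s, t ≤ s → s ≤ t + 1 → Y t ≤ Real.exp β * Y s := fun s hs hs1 => by
    have := le_of_deriv_nonpos (f := fun s => -(Real.exp (β * s) * Y s)) (s := t)
      (fun s hs => ((((hasDerivAt_id s).const_mul β).exp).fun_mul (hY s (ht.trans hs))).fun_neg)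
      (fun s hs => by
        have h1 := (abs_le.1 (hVb s (ht.trans hs))).1
        have h2 := mul_le_mul_of_nonneg_left h1 (Real.exp_pos (β * s)).le
        simp only [id]
        linarith) s hs
    have h2 := mul_le_mul_of_nonneg_left (neg_le_neg this) (Real.exp_pos (-(β * t))).le
    rw [neg_neg, neg_neg, ← mul_assoc, ← mul_assoc, ← Real.exp_add, ← Real.exp_add] at h2
    rw [neg_add_cancel, Real.exp_zero, one_mul] at h2
    refine h2.trans (mul_le_mul_of_nonneg_right (Real.exp_le_exp.2 ?_)
      (by linarith [hY1 s (ht.trans hs)]))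
    linarith [mul_le_mul_of_nonneg_left hs1 hβ0]
  have hYt := hY1 t ht
  have he := Real.exp_pos β
  set P := (4 * C + 1) * Real.exp β + C1 with hP
  have hΛ0 : 0 ≤ P := by positivity
  have hrate : ∀ s, t ≤ s → s ≤ t + 1 → P * Y t ≤ ν * Γ s := fun s hs hs1 => by
    have h1 := hdown s hs hs1
    have h2 : R ≤ Y s := by
      by_contra! h3
      have := mul_le_mul_of_nonneg_left h3.le he.le
      linarith
    have h3 := hcoer s (ht.trans hs) h2 (hElow s (ht.trans hs))
    have h4 := mul_le_mul_of_nonneg_left h3 hν.le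
    have h5 := mul_le_mul_of_nonneg_right hΛ (by linarith [hY1 s (ht.trans hs)] : 0 ≤ Y s)
    have h6 := mul_le_mul_of_nonneg_left h1 hΛ0
    linarith
  have hgain : E t + P * Y t ≤ E (t + 1) := by
    have hmono : MonotoneOn (fun s => E s - P * Y t * s) (Icc t (t + 1)) := by
      refine monotoneOn_of_hasDerivWithinAt_nonneg (convex_Icc _ _)
        (f' := fun s => ν * Γ s - P * Y t)
        (fun s hs => ?_) (fun s hs => ?_) (fun s hs => ?_)
      · exact ((hE s (ht.trans hs.1)).continuousAt.sub (by fun_prop)).continuousWithinAt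
      · rw [interior_Icc] at hs
        exact ((hE s (ht.trans hs.1.le)).fun_sub (by
          simpa using (hasDerivAt_id s).const_mul (P * Y t))).hasDerivWithinAt
      · rw [interior_Icc] at hs
        linarith [hrate s hs.1.le hs.2.le]
    have := hmono (left_mem_Icc.2 (by linarith)) (right_mem_Icc.2 (by linarith)) (by linarith : t ≤ t + 1)
    simp only at this
    linarith
  have h1 := hK (t + 1) (by linarith)
  have h2 := hElow t ht
  have h3 := mul_le_mul_of_nonneg_left hup (by linarith : 0 ≤ 4 * C + 1)
  have h4 : C1 ≤ C1 * Y t := le_mul_of_one_le_right hC1 hYt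
  rw [hP] at hgain
  linarith

theorem exists_periodic_primitive {φ : ℝ → ℝ} {c : ℝ} (hφ : Continuous φ)
    (hper : Function.Periodic φ 1) (hmean : ∫ y in (0 : ℝ)..1, φ y = 0) (hb : ∀ y, |φ y| ≤ c) :
    ∃ Ψ : ℝ → ℝ, (∀ y, HasDerivAt Ψ (φ y) y) ∧ Function.Periodic Ψ 1 ∧
      ∫ y in (0 : ℝ)..1, Ψ y = 0 ∧ ∀ y, |Ψ y| ≤ 2 * c := by
  set P : ℝ → ℝ := fun y => ∫ s in (0 : ℝ)..y, φ s with hP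
  have hPd : ∀ y, HasDerivAt P (φ y) y := fun y => hφ.integral_hasStrictDerivAt 0 y |>.hasDerivAt
  have hPc : Continuous P := continuous_iff_continuousAt.2 fun y => (hPd y).continuousAt
  have hi : ∀ a b, IntervalIntegrable φ volume a b := fun a b => hφ.intervalIntegrable a b
  have hPper : Function.Periodic P 1 := fun y => by
    simp only [hP]
    rw [← intervalIntegral.integral_add_adjacent_intervals (hi 0 y) (hi y (y + 1)),
      hper.intervalIntegral_add_eq y 0, zero_add, hmean, add_zero]
  have hPb : ∀ y ∈ Icc (0 : ℝ) 1, |P y| ≤ c := fun y hy => by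
    have := intervalIntegral.norm_integral_le_of_norm_le_const (a := (0 : ℝ)) (b := y) (C := c)
      (f := φ) (fun s _ => hb s)
    rw [sub_zero, Real.norm_eq_abs] at this
    have hc : 0 ≤ c := (abs_nonneg _).trans (hb 0)
    refine this.trans (mul_le_of_le_one_right hc ?_)
    rw [abs_of_nonneg hy.1]; exact hy.2
  have hPb' : ∀ y, |P y| ≤ c := fun y => by
    obtain ⟨z, hz, hzy⟩ := hPper.exists_mem_Ico₀ one_pos y
    rw [hzy]; exact hPb z ⟨hz.1, hz.2.le⟩
  have hμ : |∫ y in (0 : ℝ)..1, P y| ≤ c := by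
    simpa using intervalIntegral.norm_integral_le_of_norm_le_const (a := (0 : ℝ)) (b := 1) (C := c)
      (f := P) (fun s _ => hPb' s)
  refine ⟨fun y => P y - ∫ y in (0 : ℝ)..1, P y, fun y => (hPd y).sub_const _, fun y => ?_, ?_,
    fun y => ?_⟩
  · simp only [hPper y]
  · rw [intervalIntegral.integral_sub (hPc.intervalIntegrable _ _) (by simp)]
    simp
  · linarith [_root_.abs_sub (P y) (∫ y in (0 : ℝ)..1, P y), hPb' y]

/-- Bounded first and second primitives of the fluctuation of a density. -/
structure Primitives (ρ Φ Ψ : ℝ → ℝ) : Prop where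
  d1 : ∀ y, HasDerivAt Φ (ρ y - 1) y
  d2 : ∀ y, HasDerivAt Ψ (Φ y) y
  b1 : ∀ y, |Φ y| ≤ 1
  b2 : ∀ y, |Ψ y| ≤ 2
  ends : Φ 1 = Φ 0

theorem exists_primitives {ρ : ℝ → ℝ} (hρ : Continuous ρ) (hper : Function.Periodic ρ 1)
    (hint : ∫ y in (0 : ℝ)..1, ρ y = 1) (hb : ∀ y, |ρ y - 1| ≤ 1 / 2) :
    ∃ Φ Ψ, Primitives ρ Φ Ψ := by
  obtain ⟨Φ, h1, h2, h3, h4⟩ := exists_periodic_primitive (φ := fun y => ρ y - 1) (c := 1 / 2)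
    (by fun_prop) (fun y => by simp only [hper y]) (by
      rw [intervalIntegral.integral_sub (hρ.intervalIntegrable _ _) (by simp), hint]
      simp) hb
  have hΦ : Continuous Φ := continuous_iff_continuousAt.2 fun y => (h1 y).continuousAt
  obtain ⟨Ψ, k1, k2, k3, k4⟩ := exists_periodic_primitive hΦ h2 h3 h4
  exact ⟨Φ, Ψ, h1, k1, fun y => (h4 y).trans (by norm_num), fun y => (k4 y).trans (by norm_num),
    by simpa using h2 0⟩

/-- Gap between neighbouring particles. -/
noncomputable def gap (N : ℕ) (v : ℕ → ℝ) (j : ℕ) : ℝ := pad N v (j + 1) - pad N v j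

/-- Midpoint of neighbouring particles. -/
noncomputable def face (N : ℕ) (v : ℕ → ℝ) (j : ℕ) : ℝ := (pad N v j + pad N v (j + 1)) / 2

/-- The force acting on a particle. -/
noncomputable def force (Φ Ψ : ℝ → ℝ) (N : ℕ) (v : ℕ → ℝ) (i : ℕ) : ℝ :=
  (gap N v (i + 1) ^ 2 - gap N v i ^ 2) / 4
    + (gap N v (i + 1) * Φ (face N v (i + 1)) + gap N v i * Φ (face N v i))
    - 2 * (Ψ (face N v (i + 1)) - Ψ (face N v i))

/-- The potential energy of one cell. -/
noncomputable def cellPotential (Φ Ψ : ℝ → ℝ) (N : ℕ) (v : ℕ → ℝ) (i : ℕ) : ℝ :=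
  (gap N v (i + 1) ^ 3 + gap N v i ^ 3) / 24
    + (gap N v (i + 1) ^ 2 * Φ (face N v (i + 1)) - gap N v i ^ 2 * Φ (face N v i)) / 4
    - (gap N v (i + 1) * Ψ (face N v (i + 1)) + gap N v i * Ψ (face N v i))

/-- The potential energy of a configuration. -/
noncomputable def potential (Φ Ψ : ℝ → ℝ) (N : ℕ) (v : ℕ → ℝ) : ℝ :=
  ∑ i ∈ Finset.range N, cellPotential Φ Ψ N v i

theorem DiscreteFlow.hasDerivAt_force {ρ Φ Ψ : ℝ → ℝ} (hρ : Continuous ρ)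
    (hP : Primitives ρ Φ Ψ) {N : ℕ} {x : ℝ → ℕ → ℝ} (hx : DiscreteFlow ρ N x) {t : ℝ} (ht : 0 ≤ t)
    {i : ℕ} (hi : i < N) :
    HasDerivAt (fun s => x s (i + 1)) ((N : ℝ) ^ 3 * force Φ Ψ N (x t) i) t := by
  have hmem : i + 1 ∈ Finset.Icc 1 N := Finset.mem_Icc.2 ⟨by lia, by lia⟩
  refine (hx t ht (i + 1) hmem).congr_deriv ?_
  have h2 : ∀ z, HasDerivAt (fun z => (z - x t (i + 1)) ^ 2 / 2 + (z - x t (i + 1)) * Φ z - Ψ z)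
      ((z - x t (i + 1)) * ρ z) z := fun z => by
    have h1 : HasDerivAt (fun z => z - x t (i + 1)) 1 z := (hasDerivAt_id z).sub_const _
    exact ((((h1.fun_pow 2).div_const 2).fun_add (h1.fun_mul (hP.d1 z))).fun_sub
      (hP.d2 z)).congr_deriv (by simp; ring)
  rw [intervalIntegral.integral_eq_sub_of_hasDerivAt (fun z _ => h2 z)
    (Continuous.intervalIntegrable (by fun_prop) _ _), Nat.add_sub_cancel]
  have e := pad_mid (x t) hmem
  have e1 : (x t (i + 1) + pad N (x t) i) / 2 = face N (x t) i := by rw [face, e, add_comm]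
  have e2 : (x t (i + 1) + pad N (x t) (i + 1 + 1)) / 2 = face N (x t) (i + 1) := by rw [face, e]
  have g1 : gap N (x t) (i + 1) = 2 * (face N (x t) (i + 1) - x t (i + 1)) := by
    rw [gap, face, e]; ring
  have g2 : gap N (x t) i = 2 * (x t (i + 1) - face N (x t) i) := by
    rw [gap, face, e]; ring
  rw [e1, e2, force, g1, g2]
  ring

theorem DiscreteFlow.hasDerivAt_pad {N : ℕ} (hN : 1 ≤ N) {x : ℝ → ℕ → ℝ} {w : ℕ → ℝ} {t : ℝ}
    (hw : ∀ i ∈ Finset.Icc 1 N, HasDerivAt (fun s => x s i) (w i) t) {j : ℕ} (hj : j ≤ N + 1) :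
    HasDerivAt (fun s => pad N (x s) j)
      (if j = 0 then -w 1 else if j = N + 1 then -w N else w j) t := by
  rcases Nat.eq_zero_or_pos j with rfl | hj0
  · simp only [pad_zero, if_true]
    exact (hw 1 (Finset.mem_Icc.2 ⟨le_rfl, hN⟩)).fun_neg
  · rcases hj.eq_or_lt with rfl | hj1
    · simp only [pad_last, if_true, if_neg hj0.ne']
      exact (hw N (Finset.mem_Icc.2 ⟨hN, le_rfl⟩)).const_sub 2
    · have hm : j ∈ Finset.Icc 1 N := Finset.mem_Icc.2 ⟨hj0, by lia⟩
      simp only [pad_mid _ hm, if_neg hj0.ne', if_neg hj1.ne]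
      exact hw j hm

/-- The potential energy dissipates along the flow. -/
theorem DiscreteFlow.hasDerivAt_potential {ρ Φ Ψ : ℝ → ℝ} (hρ : Continuous ρ)
    (hP : Primitives ρ Φ Ψ) {N : ℕ} (hN : 1 ≤ N) {x : ℝ → ℕ → ℝ} (hx : DiscreteFlow ρ N x) {t : ℝ}
    (ht : 0 ≤ t) :
    HasDerivAt (fun s => potential Φ Ψ N (x s))
      (-((N : ℝ) ^ 3 * ∑ i ∈ Finset.range N, force Φ Ψ N (x t) i ^ 2)) t := by
  set w : ℕ → ℝ := fun i => (N : ℝ) ^ 3 * force Φ Ψ N (x t) (i - 1) with hw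
  have hwd : ∀ i ∈ Finset.Icc 1 N, HasDerivAt (fun s => x s i) (w i) t := fun i hi => by
    have h1 := Finset.mem_Icc.1 hi
    have := hx.hasDerivAt_force hρ hP ht (by lia : i - 1 < N)
    rwa [Nat.sub_add_cancel h1.1] at this
  set p' : ℕ → ℝ := fun j => if j = 0 then -w 1 else if j = N + 1 then -w N else w j with hp'
  have hpd : ∀ j ≤ N + 1, HasDerivAt (fun s => pad N (x s) j) (p' j) t := fun j hj =>
    hasDerivAt_pad hN hwd hj
  have hg : ∀ j ≤ N, HasDerivAt (fun s => gap N (x s) j) (p' (j + 1) - p' j) t := fun j hj =>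
    (hpd (j + 1) (by lia)).fun_sub (hpd j (by lia))
  have hf : ∀ j ≤ N, HasDerivAt (fun s => face N (x s) j) ((p' j + p' (j + 1)) / 2) t := fun j hj =>
    ((hpd j (by lia)).fun_add (hpd (j + 1) (by lia))).div_const 2
  set Q : ℕ → ℝ := fun j => (gap N (x t) j ^ 2 / 4 * ρ (face N (x t) j) - 2 * Ψ (face N (x t) j))
    * ((p' j + p' (j + 1)) / 2) with hQ
  have hcell : ∀ i ∈ Finset.range N, HasDerivAt (fun s => cellPotential Φ Ψ N (x s) i)
      (Q (i + 1) - Q i - p' (i + 1) * force Φ Ψ N (x t) i) t := fun i hi => by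
    rw [Finset.mem_range] at hi
    have ga := hg (i + 1) hi
    have gb := hg i hi.le
    have Φa := HasDerivAt.comp t (hP.d1 _) (hf (i + 1) hi)
    have Φb := HasDerivAt.comp t (hP.d1 _) (hf i hi.le)
    have Ψa := HasDerivAt.comp t (hP.d2 _) (hf (i + 1) hi)
    have Ψb := HasDerivAt.comp t (hP.d2 _) (hf i hi.le)
    refine (((((ga.fun_pow 3).fun_add (gb.fun_pow 3)).div_const 24).fun_add
      ((((ga.fun_pow 2).fun_mul Φa).fun_sub ((gb.fun_pow 2).fun_mul Φb)).div_const 4)).fun_sub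
      ((ga.fun_mul Ψa).fun_add (gb.fun_mul Ψb))).congr_deriv ?_
    simp only [hQ, force, Function.comp]
    push_cast
    ring
  refine (HasDerivAt.fun_sum hcell).congr_deriv ?_
  rw [Finset.sum_sub_distrib, Finset.sum_range_sub]
  have hQ0 : Q 0 = 0 := by
    simp only [hQ, hp', if_true, zero_add, if_neg one_ne_zero, if_neg (by lia : ¬ 1 = N + 1)]
    ring
  have hQN : Q N = 0 := by
    simp only [hQ, hp', if_true, if_neg (by lia : ¬ N = 0), if_neg (by lia : ¬ N = N + 1),
      if_neg (by lia : ¬ N + 1 = 0)]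
    ring
  rw [hQ0, hQN, Finset.mul_sum, sub_zero, zero_sub]
  congr 1
  refine Finset.sum_congr rfl fun i hi => ?_
  rw [Finset.mem_range] at hi
  simp only [hp', hw, if_neg (by lia : ¬ i + 1 = 0), if_neg (by lia : ¬ i + 1 = N + 1),
    Nat.add_sub_cancel]
  ring

/-- Gaps of almost equal size with prescribed sum have a large cubic moment. -/
theorem cubic_moment_ge {N : ℕ} {d : ℕ → ℝ} {c δ : ℝ} (hc : 0 ≤ c) (hδ : 2 + 2 * N * c < δ)
    (hd : ∀ j ≤ N, |(|d j| - δ)| ≤ c) (hsum : ∑ i ∈ Finset.range N, (d (i + 1) + d i) = 2) :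
    6 * δ ^ 2 - 6 * N * c ^ 2 * δ - 2 * N * c ^ 3 ≤
      ∑ i ∈ Finset.range N, (d (i + 1) ^ 3 + d i ^ 3) := by
  have hδ0 : 0 < δ := lt_of_le_of_lt (by positivity) hδ
  set s : ℕ → ℤ := fun j => if 0 ≤ d j then 1 else -1 with hs
  set e : ℕ → ℝ := fun j => d j - s j * δ with he
  have hsd : ∀ j ≤ N, |e j| ≤ c ∧ s j * δ ^ 3 + 3 * δ ^ 2 * e j - 3 * δ * c ^ 2 - c ^ 3 ≤
      d j ^ 3 := by
    intro j hj
    have h1 := hd j hj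
    have hs2 : (s j : ℝ) ^ 2 = 1 := by
      simp only [hs]; split_ifs <;> norm_num
    have h2 : |e j| ≤ c := by
      simp only [he, hs]
      split_ifs with h
      · rw [abs_of_nonneg h] at h1; simpa using h1
      · rw [abs_of_neg (not_le.1 h)] at h1
        rw [← abs_neg]
        convert h1 using 2
        push_cast; ring
    refine ⟨h2, ?_⟩
    have h3 : (e j) ^ 2 ≤ c ^ 2 := by rw [← sq_abs]; gcongr
    have h4 : |e j ^ 3| ≤ c ^ 3 := by rw [abs_pow]; gcongr
    have h5 : |(s j : ℝ) * (3 * δ * e j ^ 2)| ≤ 3 * δ * c ^ 2 := by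
      have : |(s j : ℝ)| = 1 := by
        rw [← sq_abs] at hs2
        nlinarith [abs_nonneg (s j : ℝ)]
      rw [abs_mul, this, one_mul, abs_of_nonneg (by positivity)]
      gcongr
    have hdj : d j = e j + s j * δ := by simp only [he]; ring
    have e3 : d j ^ 3 = s j * δ ^ 3 + 3 * δ ^ 2 * e j + s j * (3 * δ * e j ^ 2) + e j ^ 3 := by
      rw [hdj]; linear_combination (s j * δ ^ 3 + 3 * δ ^ 2 * e j) * hs2
    linarith [(abs_le.1 h4).1, (abs_le.1 h5).1]
  set σ : ℤ := ∑ i ∈ Finset.range N, (s (i + 1) + s i) with hσ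
  have hσ' : (σ : ℝ) * δ + ∑ i ∈ Finset.range N, (e (i + 1) + e i) = 2 := by
    rw [← hsum, hσ]
    push_cast
    rw [Finset.sum_mul, ← Finset.sum_add_distrib]
    refine Finset.sum_congr rfl fun i _ => ?_
    simp only [he]; ring
  have hsmall : |∑ i ∈ Finset.range N, (e (i + 1) + e i)| ≤ 2 * N * c := by
    refine (Finset.abs_sum_le_sum_abs _ _).trans ?_
    have : ∀ i ∈ Finset.range N, |e (i + 1) + e i| ≤ 2 * c := fun i hi => by
      have hi := Finset.mem_range.1 hi
      have := abs_add_le (e (i + 1)) (e i)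
      linarith [(hsd (i + 1) hi).1, (hsd i hi.le).1]
    refine (Finset.sum_le_sum this).trans (le_of_eq ?_)
    rw [Finset.sum_const, Finset.card_range, nsmul_eq_mul]; ring
  have hσ0 : σ = 0 := by
    have h1 := abs_le.1 hsmall
    have h2 : (σ : ℝ) < 1 := by
      by_contra! h
      have := mul_le_mul_of_nonneg_right h hδ0.le
      linarith
    have h3 : (-1 : ℝ) < σ := by
      by_contra! h
      have := mul_le_mul_of_nonneg_right h hδ0.le
      linarith
    have h2' : σ < 1 := by exact_mod_cast h2
    have h3' : -1 < σ := by exact_mod_cast h3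
    lia
  rw [hσ0] at hσ'
  have hσr : ∑ i ∈ Finset.range N, ((s (i + 1) : ℝ) + s i) = 0 := by
    have : ((σ : ℤ) : ℝ) = 0 := by rw [hσ0]; simp
    rw [hσ] at this; push_cast at this; exact this
  calc 6 * δ ^ 2 - 6 * N * c ^ 2 * δ - 2 * N * c ^ 3
      = ∑ i ∈ Finset.range N, (((s (i + 1) : ℝ) + s i) * δ ^ 3 + 3 * δ ^ 2 * (e (i + 1) + e i)
          - (6 * δ * c ^ 2 + 2 * c ^ 3)) := by
        rw [Finset.sum_sub_distrib, Finset.sum_add_distrib, ← Finset.sum_mul, ← Finset.mul_sum,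
          hσr, Finset.sum_const, Finset.card_range, nsmul_eq_mul]
        have : ∑ i ∈ Finset.range N, (e (i + 1) + e i) = 2 := by simpa using hσ'
        rw [this]; ring
    _ ≤ _ := Finset.sum_le_sum fun i hi => by
        have hi := Finset.mem_range.1 hi
        linarith [(hsd (i + 1) hi).2, (hsd i hi.le).2]

section Configuration

variable {ρ Φ Ψ : ℝ → ℝ} {N : ℕ} {v : ℕ → ℝ}

/-- Moment of inertia of a configuration. -/
noncomputable def inertia (N : ℕ) (v : ℕ → ℝ) : ℝ := 1 + ∑ i ∈ Finset.range N, v (i + 1) ^ 2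

theorem one_le_inertia (N : ℕ) (v : ℕ → ℝ) : 1 ≤ inertia N v := by
  have : 0 ≤ ∑ i ∈ Finset.range N, v (i + 1) ^ 2 := Finset.sum_nonneg fun _ _ => sq_nonneg _
  unfold inertia; linarith

theorem pad_succ_of_lt (v : ℕ → ℝ) {i : ℕ} (hi : i < N) : pad N v (i + 1) = v (i + 1) :=
  pad_mid v (Finset.mem_Icc.2 ⟨by lia, hi⟩)

theorem face_zero (hN : 1 ≤ N) : face N v 0 = 0 := by
  rw [face, pad_zero, pad_succ_of_lt v (by lia : 0 < N)]; simp

theorem face_last (hN : 1 ≤ N) : face N v N = 1 := by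
  rw [face, pad_last, pad_mid v (Finset.mem_Icc.2 ⟨hN, le_rfl⟩)]; ring

theorem abs_apply_le_sqrt_inertia {i : ℕ} (hi : i < N) : |v (i + 1)| ≤ √(inertia N v) := by
  refine Real.abs_le_sqrt ?_
  have := Finset.single_le_sum (f := fun i => v (i + 1) ^ 2) (fun _ _ => sq_nonneg _)
    (Finset.mem_range.2 hi)
  unfold inertia
  linarith

theorem one_le_sqrt_inertia (N : ℕ) (v : ℕ → ℝ) : 1 ≤ √(inertia N v) :=
  Real.one_le_sqrt.2 (one_le_inertia N v)

theorem abs_pad_le (hN : 1 ≤ N) {j : ℕ} (hj : j ≤ N + 1) : |pad N v j| ≤ 3 * √(inertia N v) := by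
  have h1 := one_le_sqrt_inertia N v
  rcases Nat.eq_zero_or_pos j with rfl | hj0
  · rw [pad_zero, abs_neg]
    linarith [abs_apply_le_sqrt_inertia (v := v) (by lia : 0 < N)]
  · rcases hj.eq_or_lt with rfl | hj1
    · have h2 := abs_apply_le_sqrt_inertia (v := v) (by lia : N - 1 < N)
      rw [Nat.sub_add_cancel hN] at h2
      rw [pad_last, abs_le]
      constructor <;> linarith [(abs_le.1 h2).1, (abs_le.1 h2).2]
    · have h2 := abs_apply_le_sqrt_inertia (v := v) (by lia : j - 1 < N)
      rw [Nat.sub_add_cancel hj0] at h2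
      rw [pad_mid v (Finset.mem_Icc.2 ⟨hj0, by lia⟩)]
      linarith

theorem abs_gap_le (hN : 1 ≤ N) {j : ℕ} (hj : j ≤ N) : |gap N v j| ≤ 6 * √(inertia N v) := by
  have h1 := abs_sub (pad N v (j + 1)) (pad N v j)
  have h2 := abs_pad_le (v := v) hN (by lia : j + 1 ≤ N + 1)
  have h3 := abs_pad_le (v := v) hN (by lia : j ≤ N + 1)
  unfold gap; linarith

theorem sum_gap (hN : 1 ≤ N) : ∑ i ∈ Finset.range N, (gap N v (i + 1) + gap N v i) = 2 := by
  have : ∀ i ∈ Finset.range N, gap N v (i + 1) + gap N v i =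
      2 * face N v (i + 1) - 2 * face N v i := fun i _ => by unfold gap face; ring
  rw [Finset.sum_congr rfl this, Finset.sum_range_sub (fun i => 2 * face N v i), face_zero hN,
    face_last hN]
  norm_num

/-- Approximate virial identity. -/
theorem Primitives.virial (hP : Primitives ρ Φ Ψ) (hN : 1 ≤ N) :
    |∑ i ∈ Finset.range N, v (i + 1) * force Φ Ψ N v i + 3 * potential Φ Ψ N v| ≤
      155 * N * inertia N v := by
  set r := √(inertia N v) with hr
  have hr1 : 1 ≤ r := one_le_sqrt_inertia N v
  have hr2 : r ^ 2 = inertia N v := Real.sq_sqrt (by linarith [one_le_inertia N v])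
  set q : ℕ → ℝ := fun j => gap N v j ^ 2 * (face N v j / 4 + 3 / 4 * Φ (face N v j)) with hq
  set e : ℕ → ℝ := fun i =>
    v (i + 1) * (gap N v (i + 1) * Φ (face N v (i + 1)) + gap N v i * Φ (face N v i))
    - 2 * (v (i + 1) * (Ψ (face N v (i + 1)) - Ψ (face N v i)))
    - 3 * (gap N v (i + 1) * Ψ (face N v (i + 1)) + gap N v i * Ψ (face N v i)) with he
  have hcell : ∀ i ∈ Finset.range N, v (i + 1) * force Φ Ψ N v i + 3 * cellPotential Φ Ψ N v i =
      q (i + 1) - q i + e i := fun i hi => by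
    have h1 := pad_succ_of_lt v (Finset.mem_range.1 hi)
    have h2 : face N v (i + 1) = v (i + 1) + gap N v (i + 1) / 2 := by
      rw [face, gap, h1]; ring
    have h3 : face N v i = v (i + 1) - gap N v i / 2 := by rw [face, gap, h1]; ring
    simp only [force, cellPotential, hq, he]
    generalize Φ (face N v (i + 1)) = a1 at *
    generalize Φ (face N v i) = a2 at *
    generalize Ψ (face N v (i + 1)) = a3 at *
    generalize Ψ (face N v i) = a4 at *
    rw [h2, h3]; ring
  have hee : ∀ i ∈ Finset.range N, |e i| ≤ 92 * r ^ 2 := fun i hi => by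
    have hi := Finset.mem_range.1 hi
    have hv : |v (i + 1)| ≤ r := abs_apply_le_sqrt_inertia hi
    have ga : |gap N v (i + 1)| ≤ 6 * r := abs_gap_le hN hi
    have gb : |gap N v i| ≤ 6 * r := abs_gap_le hN hi.le
    have m1 := abs_mul_le_mul ga (hP.b1 (face N v (i + 1)))
    have m2 := abs_mul_le_mul gb (hP.b1 (face N v i))
    have m3 := abs_mul_le_mul ga (hP.b2 (face N v (i + 1)))
    have m4 := abs_mul_le_mul gb (hP.b2 (face N v i))
    have m5 : |gap N v (i + 1) * Φ (face N v (i + 1)) + gap N v i * Φ (face N v i)| ≤ 12 * r :=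
      (abs_add_le _ _).trans (by linarith)
    have m6 : |Ψ (face N v (i + 1)) - Ψ (face N v i)| ≤ 4 :=
      (abs_sub _ _).trans (by linarith [hP.b2 (face N v (i + 1)), hP.b2 (face N v i)])
    have m7 := abs_le.1 (abs_mul_le_mul hv m5)
    have m8 := abs_le.1 (abs_mul_le_mul hv m6)
    have m3 := abs_le.1 m3
    have m4 := abs_le.1 m4
    have hrr : r ≤ r ^ 2 := by nlinarith
    simp only [he]
    rw [abs_le]
    constructor <;> linarith [m7.1, m7.2, m8.1, m8.2, m3.1, m3.2, m4.1, m4.2]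
  have hsum : |∑ i ∈ Finset.range N, e i| ≤ 92 * N * r ^ 2 := by
    refine (Finset.abs_sum_le_sum_abs _ _).trans ((Finset.sum_le_sum hee).trans (le_of_eq ?_))
    rw [Finset.sum_const, Finset.card_range, nsmul_eq_mul]; ring
  have hq0 : |q 0| ≤ 27 * r ^ 2 := by
    have ga : |gap N v 0| ≤ 6 * r := abs_gap_le hN (Nat.zero_le _)
    have h1 : |gap N v 0 ^ 2| ≤ (6 * r) ^ 2 := by rw [abs_pow]; gcongr
    have h2 : |face N v 0 / 4 + 3 / 4 * Φ (face N v 0)| ≤ 3 / 4 := by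
      have := abs_le.1 (hP.b1 (face N v 0))
      rw [abs_le, face_zero hN] at *
      constructor <;> linarith [this.1, this.2]
    refine (abs_mul_le_mul h1 h2).trans (le_of_eq (by ring))
  have hqN : |q N| ≤ 36 * r ^ 2 := by
    have ga : |gap N v N| ≤ 6 * r := abs_gap_le hN le_rfl
    have h1 : |gap N v N ^ 2| ≤ (6 * r) ^ 2 := by rw [abs_pow]; gcongr
    have h2 : |face N v N / 4 + 3 / 4 * Φ (face N v N)| ≤ 1 := by
      have := abs_le.1 (hP.b1 (face N v N))
      rw [abs_le, face_last hN] at *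
      constructor <;> linarith [this.1, this.2]
    refine (abs_mul_le_mul h1 h2).trans (le_of_eq (by ring))
  have hN1 : (1 : ℝ) ≤ N := by exact_mod_cast hN
  have hNr : r ^ 2 ≤ N * r ^ 2 := le_mul_of_one_le_left (sq_nonneg _) hN1
  rw [potential, Finset.mul_sum, ← Finset.sum_add_distrib, Finset.sum_congr rfl hcell,
    Finset.sum_add_distrib, Finset.sum_range_sub, ← hr2]
  have k1 := abs_le.1 hsum
  have k2 := abs_le.1 hq0
  have k3 := abs_le.1 hqN
  rw [abs_le]
  constructor <;> linarith [k1.1, k1.2, k2.1, k2.2, k3.1, k3.2]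

theorem sq_sum_mul_force_le : (∑ i ∈ Finset.range N, v (i + 1) * force Φ Ψ N v i) ^ 2 ≤
    inertia N v * ∑ i ∈ Finset.range N, force Φ Ψ N v i ^ 2 := by
  refine (Finset.sum_mul_sq_le_sq_mul_sq _ _ _).trans ?_
  refine mul_le_mul_of_nonneg_right ?_ (Finset.sum_nonneg fun _ _ => sq_nonneg _)
  unfold inertia; linarith

/-- Crude upper bound for the potential. -/
theorem Primitives.abs_potential_le (hP : Primitives ρ Φ Ψ) (hN : 1 ≤ N) :
    |potential Φ Ψ N v| ≤ 60 * N * √(inertia N v) ^ 3 := by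
  set r := √(inertia N v) with hr
  have hr1 : 1 ≤ r := one_le_sqrt_inertia N v
  have hr13 : r ≤ r ^ 3 := le_self_pow₀ hr1 (by norm_num)
  have hr23 : r ^ 2 ≤ r ^ 3 := pow_le_pow_right₀ hr1 (by norm_num)
  have hcell : ∀ i ∈ Finset.range N, |cellPotential Φ Ψ N v i| ≤ 60 * r ^ 3 := fun i hi => by
    have hi := Finset.mem_range.1 hi
    have ga : |gap N v (i + 1)| ≤ 6 * r := abs_gap_le hN hi
    have gb : |gap N v i| ≤ 6 * r := abs_gap_le hN hi.le
    have a3 : |gap N v (i + 1) ^ 3| ≤ (6 * r) ^ 3 := by rw [abs_pow]; gcongr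
    have b3 : |gap N v i ^ 3| ≤ (6 * r) ^ 3 := by rw [abs_pow]; gcongr
    have a2 : |gap N v (i + 1) ^ 2| ≤ (6 * r) ^ 2 := by rw [abs_pow]; gcongr
    have b2 : |gap N v i ^ 2| ≤ (6 * r) ^ 2 := by rw [abs_pow]; gcongr
    have m1 := abs_le.1 (abs_mul_le_mul a2 (hP.b1 (face N v (i + 1))))
    have m2 := abs_le.1 (abs_mul_le_mul b2 (hP.b1 (face N v i)))
    have m3 := abs_le.1 (abs_mul_le_mul ga (hP.b2 (face N v (i + 1))))
    have m4 := abs_le.1 (abs_mul_le_mul gb (hP.b2 (face N v i)))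
    have a3 := abs_le.1 a3
    have b3 := abs_le.1 b3
    unfold cellPotential
    rw [abs_le]
    constructor <;> linarith [m1.1, m1.2, m2.1, m2.2, m3.1, m3.2, m4.1, m4.2, a3.1, a3.2, b3.1,
        b3.2]
  refine (Finset.abs_sum_le_sum_abs _ _).trans ((Finset.sum_le_sum hcell).trans (le_of_eq ?_))
  rw [Finset.sum_const, Finset.card_range, nsmul_eq_mul]; ring

end Configuration

/-- If all gaps have comparable squares, the first gap controls the moment of inertia. -/
theorem inertia_le_of_gap {N : ℕ} {v : ℕ → ℝ} {D : ℝ} (hN : 1 ≤ N)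
    (hD : ∀ j ≤ N, |gap N v j| ≤ D) : inertia N v ≤ 1 + (N : ℝ) ^ 3 * D ^ 2 := by
  have hD0 : 0 ≤ D := (abs_nonneg _).trans (hD 0 (Nat.zero_le _))
  have hpad : ∀ j ≤ N, |pad N v (j + 1)| ≤ (j + 1) * D := by
    intro j
    induction j with
    | zero =>
      intro _
      have h1 := hD 0 (Nat.zero_le _)
      have h2 := pad_succ_of_lt v (by lia : 0 < N)
      rw [gap, pad_zero, ← zero_add 1, ← h2] at h1
      have e : |pad N v (0 + 1) - -pad N v (0 + 1)| = 2 * |pad N v (0 + 1)| := by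
        rw [sub_neg_eq_add, ← two_mul, abs_mul, abs_two]
      rw [e] at h1
      push_cast
      linarith [abs_nonneg (pad N v (0 + 1))]
    | succ j ih =>
      intro hj
      have h1 := ih (by lia)
      have h2 := hD (j + 1) hj
      have h3 := abs_add_le (pad N v (j + 1)) (gap N v (j + 1))
      have e : pad N v (j + 1) + gap N v (j + 1) = pad N v (j + 1 + 1) := by unfold gap; ring
      rw [e] at h3
      push_cast
      linarith
  have hv : ∀ i ∈ Finset.range N, v (i + 1) ^ 2 ≤ (N * D) ^ 2 := fun i hi => by
    have hi := Finset.mem_range.1 hi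
    have h1 := hpad i hi.le
    rw [pad_succ_of_lt v hi] at h1
    have h2 : (i : ℝ) + 1 ≤ N := by exact_mod_cast hi
    rw [← sq_abs]
    have h3 : |v (i + 1)| ≤ N * D := h1.trans (by gcongr)
    gcongr
  have := Finset.sum_le_sum hv
  rw [Finset.sum_const, Finset.card_range, nsmul_eq_mul] at this
  unfold inertia
  linarith

theorem Primitives.abs_gap_sq_sub_le {ρ Φ Ψ : ℝ → ℝ} (hP : Primitives ρ Φ Ψ) {N : ℕ} {v : ℕ → ℝ}
    {F : ℝ} (hN : 1 ≤ N) (hF : ∀ i < N, |force Φ Ψ N v i| ≤ F) {j : ℕ} (hj : j ≤ N) :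
    |gap N v j ^ 2 - gap N v 0 ^ 2| ≤ N * (4 * F + 80 * √(inertia N v)) := by
  set r := √(inertia N v) with hr
  have hr1 : 1 ≤ r := one_le_sqrt_inertia N v
  have hF0 : 0 ≤ F := (abs_nonneg _).trans (hF 0 hN)
  have hstep : ∀ j ≤ N, |gap N v j ^ 2 - gap N v 0 ^ 2| ≤ j * (4 * F + 80 * r) := by
    intro j
    induction j with
    | zero => simp
    | succ j ih =>
      intro hj
      have h1 := abs_le.1 (ih (by lia))
      have h2 := abs_le.1 (hF j hj)
      have m1 := abs_le.1 (abs_mul_le_mul (abs_gap_le (v := v) hN hj) (hP.b1 (face N v (j + 1))))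
      have m2 := abs_le.1 (abs_mul_le_mul (abs_gap_le (v := v) hN (by lia : j ≤ N))
        (hP.b1 (face N v j)))
      have m3 := abs_le.1 (hP.b2 (face N v (j + 1)))
      have m4 := abs_le.1 (hP.b2 (face N v j))
      unfold force at h2
      rw [abs_le]
      push_cast
      constructor <;> linarith [h1.1, h1.2, h2.1, h2.2, m1.1, m1.2, m2.1, m2.2, m3.1, m3.2, m4.1,
        m4.2]
  refine (hstep j hj).trans ?_
  gcongr

/-- Lower bound for the potential of a configuration with almost equal gaps. -/
theorem Primitives.potential_ge {ρ Φ Ψ : ℝ → ℝ} (hP : Primitives ρ Φ Ψ) {N : ℕ} {v : ℕ → ℝ}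
    {c δ : ℝ} (hN : 1 ≤ N) (hc : 0 ≤ c) (hδ : 2 + 2 * N * c < δ)
    (hd : ∀ j ≤ N, |(|gap N v j| - δ)| ≤ c) (hsq : |gap N v N ^ 2 - gap N v 0 ^ 2| ≤ c * δ) :
    δ ^ 2 / 4 - (N * c ^ 2 / 4 + c / 4 + 4 * N) * δ - (N * c ^ 3 / 12 + 4 * N * c) ≤
      potential Φ Ψ N v := by
  have h1 := cubic_moment_ge hc hδ hd (sum_gap hN)
  have h2 : ∀ i ∈ Finset.range N, (gap N v (i + 1) ^ 3 + gap N v i ^ 3) / 24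
      + (gap N v (i + 1) ^ 2 / 4 * Φ (face N v (i + 1)) - gap N v i ^ 2 / 4 * Φ (face N v i))
      - 4 * (δ + c) ≤ cellPotential Φ Ψ N v i := fun i hi => by
    have hi := Finset.mem_range.1 hi
    have ga : |gap N v (i + 1)| ≤ δ + c := by linarith [(abs_le.1 (hd (i + 1) hi)).2]
    have gb : |gap N v i| ≤ δ + c := by linarith [(abs_le.1 (hd i hi.le)).2]
    have m3 := abs_le.1 (abs_mul_le_mul ga (hP.b2 (face N v (i + 1))))
    have m4 := abs_le.1 (abs_mul_le_mul gb (hP.b2 (face N v i)))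
    unfold cellPotential
    linarith [m3.2, m4.2]
  have h3 := Finset.sum_le_sum h2
  rw [Finset.sum_sub_distrib, Finset.sum_add_distrib, ← Finset.sum_div,
    Finset.sum_range_sub (fun i => gap N v i ^ 2 / 4 * Φ (face N v i)), Finset.sum_const,
    Finset.card_range, nsmul_eq_mul, face_zero hN, face_last hN, hP.ends] at h3
  have h4 := (abs_le.1 (abs_mul_le_mul hsq (hP.b1 0))).1
  unfold potential
  linarith

/-- The force is coercive on configurations of bounded potential energy. -/
theorem exists_coercivity_radius {N : ℕ} (hN : 1 ≤ N) (Λ C1 : ℝ) :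
    ∃ R : ℝ, ∀ ρ Φ Ψ : ℝ → ℝ, Primitives ρ Φ Ψ → ∀ v : ℕ → ℝ, R ≤ inertia N v →
      potential Φ Ψ N v ≤ C1 →
      Λ * inertia N v ≤ ∑ i ∈ Finset.range N, force Φ Ψ N v i ^ 2 := by
  have hN1 : (1 : ℝ) ≤ N := by exact_mod_cast hN
  set lam : ℝ := 1 + |Λ| with hlam
  have hlam0 : 0 ≤ |Λ| := abs_nonneg _
  have hlamΛ : Λ ≤ lam ^ 2 := by nlinarith [le_abs_self Λ]
  set a : ℝ := 4 * lam + 80 with ha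
  have ha0 : 0 ≤ a := by positivity
  set c : ℝ := 2 * (N : ℝ) ^ 4 * a with hc
  have hc0 : 0 ≤ c := by positivity
  set b : ℝ := N * c ^ 2 / 4 + c / 4 + 4 * N with hb
  set e : ℝ := N * c ^ 3 / 12 + 4 * N * c with he
  have hb0 : 0 ≤ b := by positivity
  have he0 : 0 ≤ e := by positivity
  set δ0 : ℝ := 3 + 2 * N * c + 4 * b + 4 * (e + |C1| + 1) with hδ0
  have hC10 : 0 ≤ |C1| := abs_nonneg _
  have hNc : 0 ≤ N * c := by positivity
  have hδ00 : 0 < δ0 := by linarith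
  set r0 : ℝ := 2 * (1 + (N : ℝ) ^ 4 * a) + 2 * (N : ℝ) ^ 3 * δ0 with hr0
  have hr00 : 0 ≤ r0 := by positivity
  refine ⟨r0 ^ 2, fun ρ Φ Ψ hP v hR hG => ?_⟩
  by_contra! hcon
  set r := √(inertia N v) with hr
  have hr1 : 1 ≤ r := one_le_sqrt_inertia N v
  have hr2 : r ^ 2 = inertia N v := Real.sq_sqrt (by linarith [one_le_inertia N v])
  have hrr0 : r0 ≤ r := Real.le_sqrt_of_sq_le hR
  have hF : ∀ i < N, |force Φ Ψ N v i| ≤ lam * r := fun i hi => by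
    refine abs_le_of_sq_le_sq ?_ (by positivity)
    have h1 := Finset.single_le_sum (f := fun i => force Φ Ψ N v i ^ 2) (fun _ _ => sq_nonneg _)
      (Finset.mem_range.2 hi)
    have h2 := mul_le_mul_of_nonneg_right hlamΛ (sq_nonneg r)
    rw [mul_pow]
    rw [← hr2] at hcon
    linarith
  have hgap : ∀ j ≤ N, |gap N v j ^ 2 - gap N v 0 ^ 2| ≤ N * a * r := fun j hj =>
    (hP.abs_gap_sq_sub_le hN hF hj).trans (le_of_eq (by rw [ha]; ring))
  set δ := |gap N v 0| with hδ
  have hδsq : δ ^ 2 = gap N v 0 ^ 2 := sq_abs _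
  have hin : r ^ 2 ≤ 1 + (N : ℝ) ^ 3 * (δ ^ 2 + N * a * r) := by
    have h0 : 0 ≤ δ ^ 2 + N * a * r := by positivity
    rw [hr2]
    refine (inertia_le_of_gap (D := √(δ ^ 2 + N * a * r)) hN fun j hj => ?_).trans (le_of_eq ?_)
    · refine Real.abs_le_sqrt ?_
      linarith [(abs_le.1 (hgap j hj)).2]
    · rw [Real.sq_sqrt h0]
  have hN3 : (1 : ℝ) ≤ (N : ℝ) ^ 3 := one_le_pow₀ hN1
  have hrδ : r ≤ 2 * (N : ℝ) ^ 3 * δ := by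
    have h1 : 2 * (1 + (N : ℝ) ^ 4 * a) ≤ r := by
      have : 0 ≤ 2 * (N : ℝ) ^ 3 * δ0 := by positivity
      linarith
    have h2 := mul_le_mul_of_nonneg_right h1 (by linarith : 0 ≤ r)
    have h3 : r ^ 2 ≤ 2 * (N : ℝ) ^ 3 * δ ^ 2 := by
      linarith
    refine abs_le_of_sq_le_sq' ?_ (by positivity) |>.2
    have h4 : 2 * (N : ℝ) ^ 3 * δ ^ 2 ≤ (2 * (N : ℝ) ^ 3) * (2 * (N : ℝ) ^ 3) * δ ^ 2 := by
      refine mul_le_mul_of_nonneg_right ?_ (sq_nonneg _)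
      exact le_mul_of_one_le_right (by positivity) (by linarith)
    linarith
  have hδδ0 : δ0 ≤ δ := by
    have h1 : 0 ≤ 2 * (1 + (N : ℝ) ^ 4 * a) := by positivity
    have h2 : 2 * (N : ℝ) ^ 3 * δ0 ≤ 2 * (N : ℝ) ^ 3 * δ := by linarith
    exact le_of_mul_le_mul_left h2 (by positivity)
  have hδ0' : 0 < δ := by linarith
  have hsq : ∀ j ≤ N, |gap N v j ^ 2 - gap N v 0 ^ 2| ≤ c * δ := fun j hj => by
    refine (hgap j hj).trans ?_
    have := mul_le_mul_of_nonneg_left hrδ (by positivity : 0 ≤ N * a)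
    rw [hc]
    linarith
  have hd : ∀ j ≤ N, |(|gap N v j| - δ)| ≤ c := fun j hj => by
    have h1 := hsq j hj
    have e1 : gap N v j ^ 2 - gap N v 0 ^ 2 = (|gap N v j| - δ) * (|gap N v j| + δ) := by
      rw [← hδsq, ← sq_abs (gap N v j)]; ring
    have h2 : 0 ≤ |gap N v j| := abs_nonneg _
    rw [e1, abs_mul, abs_of_nonneg (by linarith : 0 ≤ |gap N v j| + δ)] at h1
    have h3 : |(|gap N v j| - δ)| * δ ≤ |(|gap N v j| - δ)| * (|gap N v j| + δ) := by
      gcongr; linarith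
    exact le_of_mul_le_mul_right (h3.trans h1) hδ0'
  have key := hP.potential_ge hN hc0 (by linarith : 2 + 2 * N * c < δ) hd (hsq N le_rfl)
  rw [← hb, ← he] at key
  have h5 : e + |C1| + 1 ≤ δ / 4 - b := by linarith
  have h6 := mul_le_mul_of_nonneg_left h5 hδ0'.le
  have h7 : e + |C1| + 1 ≤ δ * (e + |C1| + 1) := le_mul_of_one_le_left (by linarith) (by linarith)
  linarith [le_abs_self C1]

/-- Global solutions with a fixed number of particles are bounded uniformly in time. -/
theorem exists_inertia_bound {N : ℕ} (hN : 1 ≤ N) (C0 : ℝ) :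
    ∃ R : ℝ, ∀ (ρ Φ Ψ : ℝ → ℝ) (x : ℝ → ℕ → ℝ), Continuous ρ → Primitives ρ Φ Ψ →
      DiscreteFlow ρ N x → inertia N (x 0) ≤ C0 → ∀ t, 0 ≤ t → inertia N (x t) ≤ R := by
  have hN1 : (1 : ℝ) ≤ N := by exact_mod_cast hN
  set C1 : ℝ := 60 * N * √C0 ^ 3 with hC1
  have hC10 : 0 ≤ C1 := by positivity
  set C : ℝ := 155 * N with hC
  have hC0 : 0 ≤ C := by positivity
  set ν : ℝ := (N : ℝ) ^ 3 with hν
  have hν0 : 0 < ν := by positivity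
  set P := ((4 * C + 1) * Real.exp (growthRate ν C C1) + C1) * Real.exp (growthRate ν C C1) with hP
  obtain ⟨R, hR⟩ := exists_coercivity_radius hN (P / ν) C1
  refine ⟨R * Real.exp (growthRate ν C C1), fun ρ Φ Ψ x hρ hprim hx hx0 t ht => ?_⟩
  refine bounded_of_global (Y := fun t => inertia N (x t)) (E := fun t => -potential Φ Ψ N (x t))
    (V := fun t => ∑ i ∈ Finset.range N, x t (i + 1) * force Φ Ψ N (x t) i)
    (Γ := fun t => ∑ i ∈ Finset.range N, force Φ Ψ N (x t) i ^ 2) (Λ := P / ν) (R := R)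
    hν0 hC0 hC10 (fun t ht => ?_) (fun t ht => ?_) (fun t _ => one_le_inertia N _) (fun t _ => ?_)
    (fun t _ => sq_sum_mul_force_le) ?_ (le_of_eq (mul_div_cancel₀ P hν0.ne').symm)
    (fun t _ h1 h2 => hR ρ Φ Ψ hprim (x t) h1 (by linarith)) ht
  · refine ((HasDerivAt.fun_sum fun i hi => (hx.hasDerivAt_force hρ hprim ht
      (Finset.mem_range.1 hi)).fun_pow 2).const_add 1).congr_deriv ?_
    rw [Finset.mul_sum]
    refine Finset.sum_congr rfl fun i _ => ?_
    push_cast; ring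
  · simpa using (hx.hasDerivAt_potential hρ hprim hN ht).fun_neg
  · have := hprim.virial (v := x t) hN
    rw [mul_neg, sub_neg_eq_add]
    exact this
  · have h1 := hprim.abs_potential_le (v := x 0) hN
    have h2 : √(inertia N (x 0)) ≤ √C0 := Real.sqrt_le_sqrt hx0
    have h3 : 60 * N * √(inertia N (x 0)) ^ 3 ≤ C1 := by rw [hC1]; gcongr
    linarith [(abs_le.1 h1).2]

theorem abs_le_of_periodic {f : ℝ → ℝ} {C : ℝ} (hf : Function.Periodic f 1)
    (h : ∀ y ∈ Icc (0 : ℝ) 1, |f y| ≤ C) (y : ℝ) : |f y| ≤ C := by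
  obtain ⟨z, hz, e⟩ := hf.exists_mem_Ico₀ one_pos y
  rw [e]
  exact h z ⟨hz.1, hz.2.le⟩

theorem periodic_deriv {f : ℝ → ℝ} {c : ℝ} (hf : Function.Periodic f c) :
    Function.Periodic (deriv f) c := fun y => by
  rw [← deriv_comp_add_const, funext hf]

theorem abs_sub_one_le_of_integral {ρ : ℝ → ℝ} {ε : ℝ} (hρ : Differentiable ℝ ρ)
    (hper : Function.Periodic ρ 1) (hint : ∫ y in (0 : ℝ)..1, ρ y = 1)
    (hb : ∀ y, |deriv ρ y| ≤ ε) (y : ℝ) : |ρ y - 1| ≤ ε := by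
  have hε : 0 ≤ ε := (abs_nonneg _).trans (hb 0)
  refine abs_le_of_periodic (f := fun y => ρ y - 1) (fun z => by simp only [hper z])
    (fun z hz => ?_) y
  have h1 := intervalIntegral.norm_integral_le_of_norm_le_const (a := (0 : ℝ)) (b := 1) (C := ε)
    (f := fun s => ρ z - ρ s) (fun s hs => by
      rw [uIoc_of_le zero_le_one] at hs
      have := convex_univ.norm_image_sub_le_of_norm_deriv_le (fun w _ => hρ w) (fun w _ => hb w)
        (mem_univ s) (mem_univ z)
      refine this.trans (mul_le_of_le_one_right hε ?_)
      rw [Real.norm_eq_abs, abs_le]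
      constructor <;> linarith [hs.1, hs.2, hz.1, hz.2])
  rw [intervalIntegral.integral_sub (by simp) (hρ.continuous.intervalIntegrable _ _), hint] at h1
  simpa using h1

theorem niceDensity_of_periodic {ρ : ℝ → ℝ} {α ε K : ℝ} (hper : Function.Periodic ρ 1)
    (hint : ∫ y in (0 : ℝ)..1, ρ y = 1) (hK : C3HolderBound α K ρ) (hε : ε ≤ 1 / 2)
    (hd : ∀ y ∈ Icc (0 : ℝ) 1, ∀ y' ∈ Icc (0 : ℝ) 1, |deriv ρ y| + |deriv (deriv ρ) y'| ≤ ε) :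
    NiceDensity ρ ε K := by
  obtain ⟨hs, hk, -⟩ := hK
  have hp1 := periodic_deriv hper
  have hp2 := periodic_deriv hp1
  have h1 : ∀ y, |deriv ρ y| ≤ ε := abs_le_of_periodic hp1 fun y hy => by
    linarith [hd y hy y hy, abs_nonneg (deriv (deriv ρ) y)]
  have h0 := fun y =>
    abs_le.1 (abs_sub_one_le_of_integral (hs.differentiable (by norm_num)) hper hint h1 y)
  refine ⟨hs, fun y => by linarith [(h0 y).1], fun y => by linarith [(h0 y).2], h1,
    abs_le_of_periodic hp2 fun y hy => ?_, abs_le_of_periodic (periodic_deriv hp2) fun y hy => ?_⟩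
  · linarith [hd y hy y hy, abs_nonneg (deriv ρ y)]
  · simpa [iteratedDeriv_succ] using hk 3 le_rfl y hy

theorem regularFlow_of_initial {ρ : ℝ → ℝ} {X : ℝ → ℝ → ℝ} {ε K a A B α : ℝ}
    (hρ : NiceDensity ρ ε K) (hε : ε ≤ 1) (hX : ContinuumFlow ρ X) (ha : 0 < a) (hA : 0 < A)
    (hB : C4HolderBound α B (X 0))
    (hs : ∀ θ ∈ Icc (0 : ℝ) 1, a ≤ deriv (X 0) θ ∧ deriv (X 0) θ ≤ A) :
    RegularFlow ρ X ε K a A B := by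
  obtain ⟨hreg, hk, -⟩ := hB
  have hdiff : Differentiable ℝ (deriv (deriv (X 0))) := by
    have := hreg.differentiable_iteratedDeriv 2 (by norm_num)
    simpa [iteratedDeriv_succ] using this
  have h2 : ∀ θ ∈ Icc (0 : ℝ) 1, |deriv (deriv (X 0)) θ| ≤ B := fun θ hθ => by
    simpa [iteratedDeriv_succ] using hk 2 (by norm_num) θ hθ
  have h3 : ∀ θ ∈ Icc (0 : ℝ) 1, |deriv (deriv (deriv (X 0))) θ| ≤ B := fun θ hθ => by
    simpa [iteratedDeriv_succ] using hk 3 (by norm_num) θ hθ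
  exact ⟨hρ, hε, hX, ha, hA, (abs_nonneg _).trans (h2 0 ⟨le_rfl, zero_le_one⟩), hs, h2,
    fun x hx y hy => abs_sub_le_of_abs_deriv_le_Icc hdiff h3 hx hy⟩

theorem exists_closeness_of_coarse {N : ℕ} (hN : 1 ≤ N) (C' : ℝ) :
    ∃ R : ℝ, ∀ (ρ : ℝ → ℝ) (x : ℝ → ℕ → ℝ) (X : ℝ → ℝ → ℝ) (ε K a A B : ℝ),
      RegularFlow ρ X ε K a A B → Function.Periodic ρ 1 → ∫ y in (0 : ℝ)..1, ρ y = 1 →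
      DiscreteFlow ρ N x →
      (∀ i ∈ Finset.Icc 1 N, |X 0 (grid N i) - x 0 i| ≤ C' / (N : ℝ) ^ 2) → ∀ t, 0 ≤ t →
      (1 / (N : ℝ)) * ∑ i ∈ Finset.Icc 1 N, (x t i - X t (grid N i)) ^ 2 ≤ R / (N : ℝ) ^ 4 := by
  have hN1 : (1 : ℝ) ≤ N := by exact_mod_cast hN
  obtain ⟨R, hR⟩ := exists_inertia_bound hN (1 + N * (1 + |C'|) ^ 2)
  refine ⟨(2 * |R| + 2 * N) * (N : ℝ) ^ 4, fun ρ x X ε K a A B hX hper hint hx h0 t ht => ?_⟩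
  have hmem : ∀ t, 0 ≤ t → ∀ i ∈ Finset.Icc 1 N, X t (grid N i) ∈ Icc (0 : ℝ) 1 := by
    intro t ht i hi
    have hg := Profile.grid_mem hi
    have h1 := (hX.slope ht 0 (grid N i) le_rfl hg.1 hg.2).1
    have h2 := (hX.slope ht (grid N i) 1 hg.1 hg.2 le_rfl).1
    rw [hX.flow.left t ht] at h1
    rw [hX.flow.right t ht] at h2
    have ha := hX.a_pos
    have h3 : 0 ≤ a / 3 * (grid N i - 0) := mul_nonneg (by positivity) (by linarith [hg.1])
    have h4 : 0 ≤ a / 3 * (1 - grid N i) := mul_nonneg (by positivity) (by linarith [hg.2])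
    exact ⟨by linarith, by linarith⟩
  have hb : ∀ y, |ρ y - 1| ≤ 1 / 2 := fun y => by
    rw [abs_le]
    exact ⟨by linarith [hX.density.lower y], by linarith [hX.density.upper y]⟩
  obtain ⟨Φ, Ψ, hP⟩ := exists_primitives hX.density.continuous hper hint hb
  have hinit : inertia N (x 0) ≤ 1 + N * (1 + |C'|) ^ 2 := by
    have h1 : ∀ i ∈ Finset.range N, x 0 (i + 1) ^ 2 ≤ (1 + |C'|) ^ 2 := fun i hi => by
      have hi' : i + 1 ∈ Finset.Icc 1 N := Finset.mem_Icc.2 ⟨by lia, Finset.mem_range.1 hi⟩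
      have h2 := hmem 0 le_rfl _ hi'
      have h3 : C' / (N : ℝ) ^ 2 ≤ |C'| :=
        (div_le_div_of_nonneg_right (le_abs_self C') (by positivity)).trans
          (div_le_self (abs_nonneg _) (one_le_pow₀ hN1))
      have h4 := abs_le.1 ((h0 _ hi').trans h3)
      exact sq_le_sq' (by linarith [h2.1, h4.2]) (by linarith [h2.2, h4.1])
    have := Finset.sum_le_sum h1
    rw [Finset.sum_const, Finset.card_range, nsmul_eq_mul] at this
    unfold inertia
    linarith
  have hin := hR ρ Φ Ψ x hX.density.continuous hP hx hinit t ht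
  have hsum : ∑ i ∈ Finset.Icc 1 N, (x t i - X t (grid N i)) ^ 2 ≤ 2 * |R| + 2 * N := by
    have h1 : ∀ i ∈ Finset.Icc 1 N, (x t i - X t (grid N i)) ^ 2 ≤ 2 * x t i ^ 2 + 2 :=
      fun i hi => by
        have h2 := hmem t ht i hi
        nlinarith [sq_nonneg (x t i + X t (grid N i)), h2.1, h2.2]
    refine (Finset.sum_le_sum h1).trans ?_
    rw [Finset.sum_add_distrib, ← Finset.mul_sum, Finset.sum_const, Nat.card_Icc, nsmul_eq_mul,
      sum_Icc_one_eq]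
    unfold inertia at hin
    push_cast [Nat.add_sub_cancel]
    linarith [le_abs_self R]
  rw [mul_div_cancel_right₀ _ (by positivity)]
  refine (mul_le_of_le_one_left (Finset.sum_nonneg fun _ _ => sq_nonneg _) ?_).trans hsum
  rw [one_div]
  exact inv_le_one_of_one_le₀ hN1

theorem exists_fine_threshold {m : ℝ} (hm : 0 < m) (M : ℝ) {C : ℝ} (hC : 0 ≤ C) :
    ∃ N₀ : ℕ, ∀ N : ℕ, 1 ≤ N → N₀ ≤ N → 8 * M ^ 2 * (1 / N : ℝ) ^ 2 ≤ m / 2 ∧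
      2 * C * (1 / N : ℝ) ^ 3 ≤ (1 / N * m / 8 : ℝ) ^ 2 := by
  obtain ⟨N₀, h⟩ := exists_nat_ge (16 * M ^ 2 / m + 128 * C / m ^ 2)
  refine ⟨N₀, fun N hN hle => ?_⟩
  have hN1 : (1 : ℝ) ≤ N := by exact_mod_cast hN
  have hN0 : (0 : ℝ) < N := by linarith
  have hle' : (N₀ : ℝ) ≤ N := by exact_mod_cast hle
  have p1 : 0 ≤ 16 * M ^ 2 / m := by positivity
  have p2 : 0 ≤ 128 * C / m ^ 2 := by positivity
  have h1 : 16 * M ^ 2 ≤ N * m := (div_le_iff₀ hm).1 (by linarith)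
  have h2 : 128 * C ≤ N * m ^ 2 := (div_le_iff₀ (by positivity)).1 (by linarith)
  constructor
  · have h3 : N * m ≤ N ^ 2 * m := by
      have := mul_le_mul_of_nonneg_right hN1 (by positivity : 0 ≤ N * m)
      linarith
    rw [div_pow, one_pow, mul_one_div, div_le_iff₀ (by positivity)]
    linarith
  · have e : (1 / N * m / 8 : ℝ) ^ 2 = (N * m ^ 2 / 64) * (1 / N : ℝ) ^ 3 := by
      field_simp
      norm_num
    rw [e]
    gcongr
    linarith

end QuantizationFlow

open QuantizationFlow RegularFlow

theorem uniform_L2_closeness_general_rho (a0 A0 Kρ KX α : ℝ)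
    (ha0 : 0 < a0) (hA0 : 0 < A0) (hKρ : 0 < Kρ) (hKX : 0 < KX) (hα : 0 < α) :
    -- `ε₁` depends only on `a0, A0, ‖ρ‖_{C^{3,α}}, ‖X₀‖_{C^{4,α}}`
    ∃ ε1 : ℝ, 0 < ε1 ∧
      ∀ C' : ℝ, 0 < C' →
        ∃ Cbar : ℝ, 0 < Cbar ∧
          ∀ (N : ℕ), 1 ≤ N → ∀ (ρ : ℝ → ℝ) (x : ℝ → ℕ → ℝ) (X : ℝ → ℝ → ℝ),
            -- `ρ` is a periodic probability density of class `C^{3,α}`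
            Function.Periodic ρ 1 → (∀ y, 0 < ρ y) →
            (∫ y in (0 : ℝ)..1, ρ y) = 1 →
            C3HolderBound α Kρ ρ →
            -- smallness: `‖ρ'‖_∞ + ‖ρ''‖_∞ ≤ ε₁`
            (∀ y ∈ Set.Icc (0 : ℝ) 1, ∀ y' ∈ Set.Icc (0 : ℝ) 1,
              |deriv ρ y| + |deriv (deriv ρ) y'| ≤ ε1) →
            -- the rescaled discrete gradient flow
            (∀ t, 0 ≤ t → ∀ i ∈ Finset.Icc 1 N,
              HasDerivAt (fun s => x s i)
                (2 * (N : ℝ) ^ 3 *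
                  ∫ z in ((x t i + pad N (x t) (i - 1)) / 2)..(
                      (x t i + pad N (x t) (i + 1)) / 2),
                    (z - x t i) * ρ z) t) →
            -- the continuous solution: regularity, PDE, boundary conditions
            (∀ t, 0 ≤ t → ContDiff ℝ 2 (X t)) →
            (∀ t, 0 ≤ t → ∀ θ ∈ Set.Icc (0 : ℝ) 1,
              HasDerivAt (fun s => X s θ)
                ((1 / 2) * ρ (X t θ) * deriv (X t) θ * deriv (deriv (X t)) θ
                  + (1 / 6) * deriv ρ (X t θ) * (deriv (X t) θ) ^ 3) t) →
            (∀ t, 0 ≤ t → X t 0 = 0 ∧ X t 1 = 1) →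
            -- the initial datum
            C4HolderBound α KX (X 0) →
            X 0 0 = 0 → X 0 1 = 1 →
            (∀ θ ∈ Set.Icc (0 : ℝ) 1, a0 ≤ deriv (X 0) θ ∧ deriv (X 0) θ ≤ A0) →
            -- initial closeness: `|Xⁱ(0) - x̄ⁱ(0)| ≤ C'/N²`
            (∀ i ∈ Finset.Icc 1 N, |X 0 (grid N i) - x 0 i| ≤ C' / (N : ℝ) ^ 2) →
            -- conclusion: uniform-in-time L² closeness
            ∀ t, 0 ≤ t →
              (1 / (N : ℝ)) * ∑ i ∈ Finset.Icc 1 N, (x t i - X t (grid N i)) ^ 2 ≤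
                Cbar / (N : ℝ) ^ 4 := by
  set m := a0 / 3 with hm
  set M := profileBound Kρ a0 A0 KX with hM
  have hm0 : 0 < m := by positivity
  set ε : ℝ := min (1 / 2) (m / 256 / (9 * (9 * M ^ 2) ^ 3 + 1)) with hε
  have hε1 : ε ≤ 1 / 2 := min_le_left _ _
  have hε0 : 0 < ε := lt_min (by norm_num) (by positivity)
  have hεM : 9 * (9 * M ^ 2) ^ 3 * ε ≤ m / 256 := by
    have := (le_div_iff₀ (by positivity)).1 (min_le_right (1 / 2 : ℝ) _ : ε ≤ _)
    linarith
  refine ⟨ε, hε0, fun C' hC' => ?_⟩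
  set E := energyConst m (9 * M ^ 2) (velocityBound Kρ a0 A0 KX) with hE
  have hE0 : 0 ≤ E := energyConst_nonneg hm0
  set C : ℝ := (C' + 4 * M ^ 2) ^ 2 + 128 * E / m with hC
  have hC0 : 0 ≤ C := by positivity
  obtain ⟨N₀, hN₀⟩ := exists_fine_threshold hm0 M hC0
  choose! R hR using fun (N : ℕ) (hN : 1 ≤ N) => exists_closeness_of_coarse hN C'
  have hS : 0 ≤ ∑ N ∈ Finset.range N₀, |R N| := Finset.sum_nonneg fun _ _ => abs_nonneg _
  refine ⟨2 * C + 32 * M ^ 4 + ∑ N ∈ Finset.range N₀, |R N| + 1, by positivity, ?_⟩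
  intro N hN ρ x X hper _ hint hρ hsmall hx hreg hpde hbd hX0 _ _ hslope h0 t ht
  have hX : RegularFlow ρ X ε Kρ a0 A0 KX :=
    regularFlow_of_initial (niceDensity_of_periodic hper hint hρ hε1 hsmall) (by linarith)
      ⟨hreg, hpde, fun t ht => (hbd t ht).1, fun t ht => (hbd t ht).2⟩ ha0 hA0 hX0 hslope
  have hM4 : 0 ≤ M ^ 4 := by positivity
  by_cases hle : N₀ ≤ N
  · obtain ⟨h1, h2⟩ := hN₀ N hN hle
    refine (hX.closeness_of_fine hN hx hm hM hεM h1 hC' (C := C)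
      (le_add_of_nonneg_right (by positivity)) ?_ h2 h0 ht).trans ?_
    · have : m * C = m * (C' + 4 * M ^ 2) ^ 2 + 128 * E := by rw [hC]; field_simp
      rw [this]
      exact le_add_of_nonneg_left (by positivity)
    · exact div_le_div_of_nonneg_right (by linarith) (by positivity)
  · refine (hR N hN ρ x X ε Kρ a0 A0 KX hX hper hint hx h0 t ht).trans ?_
    have := Finset.single_le_sum (f := fun N => |R N|) (fun _ _ => abs_nonneg _)
      (Finset.mem_range.2 (not_le.1 hle))
    exact div_le_div_of_nonneg_right (by linarith [le_abs_self (R N)]) (by positivity)
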